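/- Fix 1/2 < η < 3/5 and set γ = (3 − 5η)/(2(1 − η)). Call a prime p bad if p divides D_A or ord(A,p) < p^η. Then there is a constant C > 0 such that for all x ≥ 2, the number of integers N ≤ x all of whose prime divisors are bad is at most C·x/(log x)^γ. -/

import Mathlib

open Matrix

/-- `matOrd A N` is the order of `A` modulo `N`: the least `k ≥ 1`
with `A^k ≡ I (mod N)`. -/
noncomputable def matOrd (A : Matrix (Fin 2) (Fin 2) ℤ) (N : ℕ) : ℕ :=
  sInf {k | 0 < k ∧ ∀ i j, (N : ℤ) ∣ (A ^ k - 1) i j}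

/-- A prime `p` is *bad* (for the exponent `η`) if `p ∣ D_A` or
`ord(A,p) < p^η`. -/
def BadPrime (A : Matrix (Fin 2) (Fin 2) ℤ) (η : ℝ) (p : ℕ) : Prop :=
  p ∣ (4 * (A.trace ^ 2 - 4)).natAbs ∨ (matOrd A p : ℝ) < (p : ℝ) ^ η

namespace FI

/-- The additive character `e(x) = exp(2 π i x)`. -/
noncomputable def ee (x : ℝ) : ℂ := Complex.exp (2 * Real.pi * x * Complex.I)

lemma ee_add (x y : ℝ) : ee (x + y) = ee x * ee y := by
  unfold ee; rw [← Complex.exp_add]; congr 1; push_cast; ring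

lemma ee_zero : ee 0 = 1 := by simp [ee]

lemma norm_ee (x : ℝ) : ‖ee x‖ = 1 := by
  have : (2 * Real.pi * x * Complex.I : ℂ) = ((2 * Real.pi * x : ℝ) : ℂ) * Complex.I := by
    push_cast; ring
  rw [ee, this, Complex.norm_exp_ofReal_mul_I]

lemma conj_ee (x : ℝ) : (starRingEnd ℂ) (ee x) = ee (-x) := by
  unfold ee
  rw [← Complex.exp_conj]
  congr 1
  have : (starRingEnd ℂ) 2 = 2 := map_ofNat _ 2
  simp [this]

lemma ee_int (k : ℤ) : ee k = 1 := by
  unfold ee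
  rw [Complex.exp_eq_one_iff]
  exact ⟨k, by push_cast; ring⟩

lemma ee_nat_mul (n : ℕ) (x : ℝ) : ee (n * x) = ee x ^ n := by
  unfold ee
  rw [← Complex.exp_nat_mul]
  congr 1; push_cast; ring

lemma norm_ee_sub_one {x : ℝ} (hx : |x| ≤ 1 / 2) : 4 * |x| ≤ ‖ee x - 1‖ := by
  have h : ee x = Complex.exp (Complex.I * ((2 * Real.pi * x : ℝ) : ℂ)) := by
    unfold ee; congr 1; push_cast; ring
  rw [h, Complex.norm_exp_I_mul_ofReal_sub_one, Real.norm_eq_abs, abs_mul]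
  have h2 : 2 * Real.pi * x / 2 = Real.pi * x := by ring
  rw [h2]
  have hpi := Real.pi_pos
  have h3 : |Real.pi * x| ≤ Real.pi / 2 := by
    rw [abs_mul, abs_of_pos hpi]; nlinarith
  have h4 := Real.mul_abs_le_abs_sin h3
  rw [abs_mul, abs_of_pos hpi] at h4
  have h5 : 2 / Real.pi * (Real.pi * |x|) = 2 * |x| := by field_simp
  rw [h5] at h4
  rw [abs_of_pos (by norm_num : (0:ℝ) < 2)]
  linarith

/-- Dirichlet kernel. -/
noncomputable def DK (H : ℕ) (x : ℝ) : ℂ := ∑ j ∈ Finset.range H, ee (j * x)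

lemma norm_DK_le (H : ℕ) (x : ℝ) : ‖DK H x‖ ≤ H := by
  unfold DK
  calc _ ≤ ∑ j ∈ Finset.range H, ‖ee (j * x)‖ := norm_sum_le _ _
    _ = H := by simp [norm_ee]

lemma DK_sub_int (H : ℕ) (x : ℝ) (k : ℤ) : DK H (x - k) = DK H x := by
  unfold DK
  refine Finset.sum_congr rfl fun j _ => ?_
  have : (j : ℝ) * x = j * (x - k) + ((j * k : ℤ) : ℝ) := by push_cast; ring
  rw [this, ee_add, ee_int, mul_one]

lemma norm_DK_le' (H : ℕ) {x : ℝ} (hx : |x| ≤ 1 / 2) (h0 : 0 < |x|) :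
    ‖DK H x‖ ≤ 1 / (2 * |x|) := by
  have h1 := norm_ee_sub_one hx
  have h2 : DK H x * (ee x - 1) = ee x ^ H - 1 := by
    unfold DK
    rw [← geom_sum_mul]
    congr 1
    exact Finset.sum_congr rfl fun j _ => ee_nat_mul j x
  have h3 : ‖DK H x‖ * ‖ee x - 1‖ ≤ 2 := by
    rw [← norm_mul, h2]
    calc _ ≤ ‖ee x ^ H‖ + ‖(1:ℂ)‖ := norm_sub_le _ _
      _ = 2 := by rw [norm_pow, norm_ee]; norm_num
  rw [le_div_iff₀ (by positivity)]
  nlinarith [norm_nonneg (DK H x)]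

/-- constant `∑_{k∈ℤ} 1/(1+k^2)`. -/
noncomputable def cZ : ℝ := ∑' k : ℤ, 1 / (1 + (k : ℝ) ^ 2)

lemma summable_cZ : Summable (fun k : ℤ => 1 / (1 + (k : ℝ) ^ 2)) := by
  have h : Summable (fun k : ℤ => 1 / (k : ℝ) ^ 2) :=
    Real.summable_one_div_int_pow.mpr (by norm_num)
  refine Summable.of_norm_bounded_eventually h ?_
  have : ∀ᶠ k : ℤ in Filter.cofinite, k ≠ 0 := by
    simpa using (Set.finite_singleton (0:ℤ)).compl_mem_cofinite
  filter_upwards [this] with k hk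
  have : (0:ℝ) < (k:ℝ) ^ 2 := by positivity
  rw [Real.norm_of_nonneg (by positivity)]
  gcongr; linarith

lemma sum_cZ_le (s : Finset ℤ) : ∑ k ∈ s, 1 / (1 + (k : ℝ) ^ 2) ≤ cZ :=
  summable_cZ.sum_le_tsum _ (fun _ _ => by positivity)

lemma cZ_nonneg : 0 ≤ cZ := tsum_nonneg fun _ => by positivity

lemma sum_DK_le {ι : Type*} [DecidableEq ι] (s : Finset ι) (α : ι → ℝ) {δ : ℝ} (hδ : 0 < δ)
    (hsep : ∀ i ∈ s, ∀ j ∈ s, i ≠ j → ∀ k : ℤ, δ ≤ |α i - α j - k|) (H : ℕ) (r : ι)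
    (hr : r ∈ s) :
    ∑ i ∈ s, ‖DK H (α r - α i)‖ ^ 2 ≤ (H : ℝ) ^ 2 + 2 * cZ / δ ^ 2 := by
  rw [← Finset.add_sum_erase s _ hr]
  have h1 : ‖DK H (α r - α r)‖ ^ 2 ≤ (H : ℝ) ^ 2 := by
    gcongr; exact norm_DK_le _ _
  refine add_le_add h1 ?_
  set θ : ι → ℝ := fun i => α r - α i - round (α r - α i) with hθ
  have hθ2 : ∀ i, |θ i| ≤ 1 / 2 := fun i => abs_sub_round _
  have hθδ : ∀ i ∈ s.erase r, δ ≤ |θ i| := fun i hi =>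
    hsep r hr i (Finset.mem_of_mem_erase hi) (Finset.ne_of_mem_erase hi).symm _
  set κ : ι → ℤ := fun i => ⌊θ i / δ⌋ with hκ
  have hinj : Set.InjOn κ (s.erase r : Finset ι) := by
    intro i hi j hj hij
    by_contra hne
    have hi' := Finset.mem_of_mem_erase (Finset.mem_coe.mp hi)
    have hj' := Finset.mem_of_mem_erase (Finset.mem_coe.mp hj)
    have h := hsep j hj' i hi' (Ne.symm hne) (round (α r - α i) - round (α r - α j))
    have h2 : α j - α i - ((round (α r - α i) - round (α r - α j) : ℤ) : ℝ) = θ i - θ j := by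
      simp only [hθ]; push_cast; ring
    rw [h2] at h
    have h3 := Int.abs_sub_lt_one_of_floor_eq_floor hij
    rw [← sub_div, abs_div, abs_of_pos hδ, div_lt_one hδ] at h3
    linarith
  have hterm : ∀ i ∈ s.erase r,
      ‖DK H (α r - α i)‖ ^ 2 ≤ 2 / δ ^ 2 * (1 / (1 + (κ i : ℝ) ^ 2)) := by
    intro i hi
    have hpos : 0 < |θ i| := lt_of_lt_of_le hδ (hθδ i hi)
    have h1 := norm_DK_le' H (hθ2 i) hpos
    have h2 : DK H (α r - α i) = DK H (θ i) := (DK_sub_int _ _ _).symm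
    rw [h2]
    have h3 : (1 + (κ i : ℝ) ^ 2) * δ ^ 2 ≤ 8 * |θ i| ^ 2 := by
      have hd := hθδ i hi
      have hf1 : (κ i : ℝ) ≤ θ i / δ := Int.floor_le _
      have hf2 : θ i / δ < κ i + 1 := Int.lt_floor_add_one _
      rw [le_div_iff₀ hδ] at hf1
      rw [div_lt_iff₀ hδ] at hf2
      have h4 : |(κ i : ℝ) * δ| ≤ 2 * |θ i| := by
        rw [abs_le]
        constructor
        · have := neg_abs_le (θ i); nlinarith
        · have := le_abs_self (θ i); nlinarith
      have h5 : ((κ i : ℝ) * δ) ^ 2 ≤ (2 * |θ i|) ^ 2 := by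
        rw [← sq_abs ((κ i : ℝ) * δ)]; gcongr
      nlinarith
    calc ‖DK H (θ i)‖ ^ 2 ≤ (1 / (2 * |θ i|)) ^ 2 := by gcongr
      _ = 2 / (8 * |θ i| ^ 2) := by field_simp; norm_num
      _ ≤ 2 / ((1 + (κ i : ℝ) ^ 2) * δ ^ 2) := by gcongr
      _ = _ := by field_simp
  calc _ ≤ ∑ i ∈ s.erase r, 2 / δ ^ 2 * (1 / (1 + (κ i : ℝ) ^ 2)) := Finset.sum_le_sum hterm
    _ = 2 / δ ^ 2 * ∑ k ∈ (s.erase r).image κ, 1 / (1 + (k : ℝ) ^ 2) := by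
        rw [← Finset.mul_sum, Finset.sum_image (fun i hi j hj h => hinj hi hj h)]
    _ ≤ 2 / δ ^ 2 * cZ := by gcongr; exact sum_cZ_le _
    _ = _ := by ring

/-- trigonometric polynomial -/
noncomputable def TP {ι : Type*} (s : Finset ι) (α : ι → ℝ) (c : ι → ℂ) (x : ℝ) : ℂ :=
  ∑ r ∈ s, c r * ee (x * α r)

lemma sum_TP_eq {ι : Type*} (s : Finset ι) (α : ι → ℝ) (c : ι → ℂ) (H : ℕ) :
    ((∑ i ∈ Finset.range H, ∑ j ∈ Finset.range H, ‖TP s α c ((i:ℝ) - j)‖ ^ 2 : ℝ) : ℂ)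
      = ∑ r ∈ s, ∑ t ∈ s, c r * (starRingEnd ℂ) (c t) * ((‖DK H (α r - α t)‖ ^ 2 : ℝ) : ℂ) := by
  have hD : ∀ x : ℝ, ((‖DK H x‖ ^ 2 : ℝ) : ℂ)
      = ∑ i ∈ Finset.range H, ∑ j ∈ Finset.range H, ee (((i:ℝ) - j) * x) := by
    intro x
    push_cast
    rw [← Complex.mul_conj']
    unfold DK
    rw [map_sum, Finset.sum_mul_sum]
    refine Finset.sum_congr rfl fun i _ => Finset.sum_congr rfl fun j _ => ?_
    rw [conj_ee, ← ee_add]; congr 1; ring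
  have hT : ∀ x : ℝ, ((‖TP s α c x‖ ^ 2 : ℝ) : ℂ)
      = ∑ r ∈ s, ∑ t ∈ s, c r * (starRingEnd ℂ) (c t) * ee (x * (α r - α t)) := by
    intro x
    push_cast
    rw [← Complex.mul_conj']
    unfold TP
    rw [map_sum, Finset.sum_mul_sum]
    refine Finset.sum_congr rfl fun i _ => Finset.sum_congr rfl fun j _ => ?_
    rw [map_mul, conj_ee, mul_mul_mul_comm, ← ee_add]; congr 2; ring
  push_cast
  simp_rw [← Complex.ofReal_pow, hT, hD, Finset.mul_sum]
  rw [Finset.sum_congr rfl fun i _ => Finset.sum_comm, Finset.sum_comm]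
  refine Finset.sum_congr rfl fun r _ => ?_
  rw [Finset.sum_congr rfl fun i _ => Finset.sum_comm, Finset.sum_comm]

lemma dual_large_sieve {ι : Type*} [DecidableEq ι] (s : Finset ι) (α : ι → ℝ) {δ : ℝ}
    (hδ : 0 < δ)
    (hsep : ∀ i ∈ s, ∀ j ∈ s, i ≠ j → ∀ k : ℤ, δ ≤ |α i - α j - k|) (c : ι → ℂ)
    (N h : ℕ) (hN : N ≤ h) (hh : 1 / δ ≤ h) :
    ∑ n ∈ Finset.range N, ‖TP s α c n‖ ^ 2 ≤ (4 + 2 * cZ) * h * ∑ r ∈ s, ‖c r‖ ^ 2 := by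
  have hh0 : (0:ℝ) < h := lt_of_lt_of_le (by positivity) hh
  have hcZ := cZ_nonneg
  -- upper bound
  have hup : ∑ i ∈ Finset.range (2*h), ∑ j ∈ Finset.range (2*h), ‖TP s α c ((i:ℝ) - j)‖ ^ 2
      ≤ (4 + 2 * cZ) * h ^ 2 * ∑ r ∈ s, ‖c r‖ ^ 2 := by
    have h1 := sum_TP_eq s α c (2 * h)
    set LHS := ∑ i ∈ Finset.range (2*h), ∑ j ∈ Finset.range (2*h), ‖TP s α c ((i:ℝ) - j)‖ ^ 2
    have hL : 0 ≤ LHS := Finset.sum_nonneg fun _ _ => Finset.sum_nonneg fun _ _ => by positivity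
    have h2 : LHS ≤ ∑ r ∈ s, ∑ t ∈ s, ‖c r‖ * ‖c t‖ * ‖DK (2*h) (α r - α t)‖ ^ 2 := by
      calc LHS = ‖(LHS : ℂ)‖ := by rw [Complex.norm_real, Real.norm_of_nonneg hL]
        _ ≤ _ := by
          rw [h1]
          refine (norm_sum_le _ _).trans (Finset.sum_le_sum fun r _ => ?_)
          refine (norm_sum_le _ _).trans (Finset.sum_le_sum fun t _ => ?_)
          rw [norm_mul, norm_mul, RCLike.norm_conj, Complex.norm_real,
            Real.norm_of_nonneg (by positivity)]
    have hsym : ∀ x : ℝ, ‖DK (2*h) (-x)‖ = ‖DK (2*h) x‖ := by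
      intro x
      rw [← RCLike.norm_conj (DK (2*h) x)]
      congr 1
      unfold DK
      rw [map_sum]
      exact Finset.sum_congr rfl fun j _ => by rw [conj_ee]; congr 1; ring
    have h3 : ∑ r ∈ s, ∑ t ∈ s, ‖c r‖ * ‖c t‖ * ‖DK (2*h) (α r - α t)‖ ^ 2
        ≤ ∑ r ∈ s, ∑ t ∈ s, ‖c r‖ ^ 2 * ‖DK (2*h) (α r - α t)‖ ^ 2 := by
      have e1 : ∑ r ∈ s, ∑ t ∈ s, ‖c r‖ ^ 2 * ‖DK (2*h) (α r - α t)‖ ^ 2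
          = ∑ r ∈ s, ∑ t ∈ s, (‖c r‖ ^ 2 + ‖c t‖ ^ 2) / 2 * ‖DK (2*h) (α r - α t)‖ ^ 2 := by
        have e2 : ∑ r ∈ s, ∑ t ∈ s, ‖c r‖ ^ 2 * ‖DK (2*h) (α r - α t)‖ ^ 2
          = ∑ r ∈ s, ∑ t ∈ s, ‖c t‖ ^ 2 * ‖DK (2*h) (α r - α t)‖ ^ 2 := by
          rw [Finset.sum_comm]
          refine Finset.sum_congr rfl fun t _ => Finset.sum_congr rfl fun r _ => ?_
          rw [← hsym, neg_sub]
        have e3 : ∑ r ∈ s, ∑ t ∈ s, (‖c r‖ ^ 2 + ‖c t‖ ^ 2) / 2 * ‖DK (2*h) (α r - α t)‖ ^ 2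
          = (∑ r ∈ s, ∑ t ∈ s, ‖c r‖ ^ 2 * ‖DK (2*h) (α r - α t)‖ ^ 2
            + ∑ r ∈ s, ∑ t ∈ s, ‖c t‖ ^ 2 * ‖DK (2*h) (α r - α t)‖ ^ 2) / 2 := by
          rw [← Finset.sum_add_distrib, Finset.sum_div]
          refine Finset.sum_congr rfl fun r _ => ?_
          rw [← Finset.sum_add_distrib, Finset.sum_div]
          refine Finset.sum_congr rfl fun t _ => by ring
        rw [e3, ← e2]; ring
      rw [e1]
      refine Finset.sum_le_sum fun r _ => Finset.sum_le_sum fun t _ => ?_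
      gcongr
      nlinarith [sq_nonneg (‖c r‖ - ‖c t‖)]
    refine h2.trans (h3.trans ?_)
    rw [Finset.mul_sum]
    refine Finset.sum_le_sum fun r hr => ?_
    rw [← Finset.mul_sum, mul_comm]
    gcongr
    refine (sum_DK_le s α hδ hsep (2*h) r hr).trans ?_
    have : 1 / δ ^ 2 ≤ (h:ℝ) ^ 2 := by
      have : (1 / δ) ^ 2 ≤ (h:ℝ) ^ 2 := by gcongr
      simpa [div_pow] using this
    have h5 : 2 * cZ / δ ^ 2 = 2 * cZ * (1 / δ ^ 2) := by ring
    rw [h5]; push_cast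
    nlinarith [mul_le_mul_of_nonneg_left this hcZ]
  -- lower bound
  have hlow : h * ∑ n ∈ Finset.range N, ‖TP s α c n‖ ^ 2 ≤
      ∑ i ∈ Finset.range (2*h), ∑ j ∈ Finset.range (2*h), ‖TP s α c ((i:ℝ) - j)‖ ^ 2 := by
    rw [← Finset.sum_product']
    have : h * ∑ n ∈ Finset.range N, ‖TP s α c n‖ ^ 2
        = ∑ x ∈ Finset.range N ×ˢ Finset.range h, ‖TP s α c x.1‖ ^ 2 := by
      rw [Finset.sum_product, Finset.mul_sum]
      simp
    rw [this]
    have hinj : Set.InjOn (fun x : ℕ × ℕ => (x.1 + x.2, x.2))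
        (Finset.range N ×ˢ Finset.range h : Finset (ℕ × ℕ)) := by
      rintro ⟨a, b⟩ _ ⟨a', b'⟩ _ hab
      simp only [Prod.mk.injEq] at hab
      ext <;> simp <;> omega
    calc _ = ∑ x ∈ (Finset.range N ×ˢ Finset.range h).image (fun x : ℕ × ℕ => (x.1 + x.2, x.2)),
          ‖TP s α c ((x.1 : ℝ) - x.2)‖ ^ 2 := by
          rw [Finset.sum_image hinj]
          refine Finset.sum_congr rfl fun x _ => ?_
          congr 3; push_cast; ring
      _ ≤ _ := by
          refine Finset.sum_le_sum_of_subset_of_nonneg ?_ (fun _ _ _ => by positivity)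
          intro x hx
          simp only [Finset.mem_image, Finset.mem_product, Finset.mem_range] at hx ⊢
          obtain ⟨y, ⟨h1, h2⟩, rfl⟩ := hx
          simp; omega
  have := hlow.trans hup
  have h6 : (h:ℝ) * ∑ n ∈ Finset.range N, ‖TP s α c n‖ ^ 2 ≤
    h * ((4 + 2 * cZ) * h * ∑ r ∈ s, ‖c r‖ ^ 2) := by
    refine this.trans (le_of_eq ?_); ring
  exact le_of_mul_le_mul_left h6 hh0

lemma large_sieve {ι : Type*} [DecidableEq ι] (s : Finset ι) (α : ι → ℝ) {δ : ℝ}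
    (hδ : 0 < δ)
    (hsep : ∀ i ∈ s, ∀ j ∈ s, i ≠ j → ∀ k : ℤ, δ ≤ |α i - α j - k|) (b : ℕ → ℝ)
    (N h : ℕ) (hN : N ≤ h) (hh : 1 / δ ≤ h) :
    ∑ r ∈ s, ‖∑ n ∈ Finset.range N, (b n : ℂ) * ee (n * α r)‖ ^ 2
      ≤ (4 + 2 * cZ) * h * ∑ n ∈ Finset.range N, b n ^ 2 := by
  set S : ι → ℂ := fun r => ∑ n ∈ Finset.range N, (b n : ℂ) * ee (n * α r) with hS
  set c : ι → ℂ := fun r => (starRingEnd ℂ) (S r)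
  set Z := ∑ r ∈ s, ‖S r‖ ^ 2 with hZ
  set K := (4 + 2 * cZ) * h
  have hK : 0 ≤ K := by have := cZ_nonneg; positivity
  have hB : 0 ≤ ∑ n ∈ Finset.range N, b n ^ 2 := Finset.sum_nonneg fun _ _ => by positivity
  have hZ0 : 0 ≤ Z := Finset.sum_nonneg fun _ _ => by positivity
  have hd := dual_large_sieve s α hδ hsep c N h hN hh
  have hc : ∑ r ∈ s, ‖c r‖ ^ 2 = Z := by simp [c, Z]
  rw [hc] at hd
  have h1 : (Z : ℂ) = ∑ n ∈ Finset.range N, (b n : ℂ) * TP s α c n := by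
    rw [hZ]
    push_cast
    simp_rw [← Complex.mul_conj', TP, Finset.mul_sum]
    rw [Finset.sum_comm]
    refine Finset.sum_congr rfl fun r _ => ?_
    simp only [hS, Finset.sum_mul]
    refine Finset.sum_congr rfl fun n _ => ?_
    simp only [c, hS]; ring
  have h2 : Z ≤ ∑ n ∈ Finset.range N, |b n| * ‖TP s α c n‖ := by
    calc Z = ‖(Z:ℂ)‖ := by rw [Complex.norm_real, Real.norm_of_nonneg hZ0]
      _ ≤ _ := by
        rw [h1]
        refine (norm_sum_le _ _).trans (Finset.sum_le_sum fun n _ => ?_)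
        rw [norm_mul, Complex.norm_real, Real.norm_eq_abs]
  have h3 : Z ^ 2 ≤ (∑ n ∈ Finset.range N, b n ^ 2) * (K * Z) := by
    calc Z ^ 2 ≤ (∑ n ∈ Finset.range N, |b n| * ‖TP s α c n‖) ^ 2 := by gcongr
      _ ≤ (∑ n ∈ Finset.range N, |b n| ^ 2) * ∑ n ∈ Finset.range N, ‖TP s α c n‖ ^ 2 :=
          Finset.sum_mul_sq_le_sq_mul_sq _ _ _
      _ ≤ _ := by simp only [sq_abs]; gcongr
  rcases hZ0.eq_or_lt with h0 | h0
  · rw [← h0]; positivity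
  · have : Z * Z ≤ (K * ∑ n ∈ Finset.range N, b n ^ 2) * Z := by nlinarith
    exact le_of_mul_le_mul_right this h0

end FI

namespace FI

/-- sum of `b` over a residue class -/
noncomputable def Zc (b : ℕ → ℝ) (N q h : ℕ) : ℝ :=
  ∑ n ∈ Finset.range N, if n % q = h then b n else 0

/-- variance in residue classes -/
noncomputable def Vq (b : ℕ → ℝ) (N q : ℕ) : ℝ :=
  ∑ h ∈ Finset.range q, (Zc b N q h - (∑ n ∈ Finset.range N, b n) / q) ^ 2

lemma Vq_nonneg (b : ℕ → ℝ) (N q : ℕ) : 0 ≤ Vq b N q :=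
  Finset.sum_nonneg fun _ _ => by positivity

lemma sum_Zc (b : ℕ → ℝ) (N : ℕ) {q : ℕ} (hq : 0 < q) :
    ∑ h ∈ Finset.range q, Zc b N q h = ∑ n ∈ Finset.range N, b n := by
  unfold Zc
  rw [Finset.sum_comm]
  refine Finset.sum_congr rfl fun n _ => ?_
  simp [Nat.mod_lt n hq]

lemma Vq_eq (b : ℕ → ℝ) (N : ℕ) {q : ℕ} (hq : 0 < q) :
    Vq b N q = ∑ h ∈ Finset.range q, Zc b N q h ^ 2 - (∑ n ∈ Finset.range N, b n) ^ 2 / q := by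
  unfold Vq
  simp_rw [sub_sq, Finset.sum_add_distrib, Finset.sum_sub_distrib]
  rw [← Finset.sum_mul, ← Finset.mul_sum, sum_Zc b N hq]
  have : (q:ℝ) ≠ 0 := by positivity
  simp
  field_simp
  ring

lemma sum_ee_orth {q : ℕ} (hq : 0 < q) (k : ℤ) :
    ∑ a ∈ Finset.range q, ee (a * ((k:ℝ) / q)) = if (q:ℤ) ∣ k then (q:ℂ) else 0 := by
  have hq' : (q:ℝ) ≠ 0 := by positivity
  split_ifs with h
  · obtain ⟨m, rfl⟩ := h
    have : ∀ a ∈ Finset.range q, ee (a * (((q * m : ℤ):ℝ) / q)) = 1 := by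
      intro a _
      have : (a * (((q * m : ℤ):ℝ) / q)) = ((a * m : ℤ) : ℝ) := by push_cast; field_simp
      rw [this, ee_int]
    rw [Finset.sum_congr rfl this]; simp
  · simp_rw [ee_nat_mul]
    have h1 : ee ((k:ℝ) / q) ≠ 1 := by
      intro h1
      unfold ee at h1
      rw [Complex.exp_eq_one_iff] at h1
      obtain ⟨n, hn⟩ := h1
      apply h
      have hpi : (2 * Real.pi * Complex.I : ℂ) ≠ 0 := Complex.two_pi_I_ne_zero
      have h2 : (((k:ℝ) / q : ℝ) : ℂ) = n := by
        apply mul_right_cancel₀ hpi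
        rw [← hn]; ring
      have h3 : (k:ℝ) / q = n := by exact_mod_cast h2
      rw [div_eq_iff hq'] at h3
      exact ⟨n, by rw [mul_comm]; exact_mod_cast h3⟩
    have h2 : ee ((k:ℝ) / q) ^ q = 1 := by
      rw [← ee_nat_mul]
      have : (q:ℝ) * (k / q) = k := by field_simp
      rw [this, ee_int]
    rw [geom_sum_eq h1, h2]; simp

lemma sum_sq_eq (b : ℕ → ℝ) (N : ℕ) {q : ℕ} (hq : 0 < q) :
    ∑ a ∈ Finset.range q, ‖∑ n ∈ Finset.range N, (b n : ℂ) * ee (n * ((a:ℝ) / q))‖ ^ 2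
      = q * ∑ h ∈ Finset.range q, Zc b N q h ^ 2 := by
  have h1 : ∀ a : ℕ, ((‖∑ n ∈ Finset.range N, (b n : ℂ) * ee (n * ((a:ℝ) / q))‖ ^ 2 : ℝ) : ℂ)
      = ∑ n ∈ Finset.range N, ∑ m ∈ Finset.range N,
        (b n : ℂ) * b m * ee (a * ((((n:ℤ) - m : ℤ):ℝ) / q)) := by
    intro a
    push_cast
    rw [← Complex.mul_conj', map_sum, Finset.sum_mul_sum]
    refine Finset.sum_congr rfl fun i _ => Finset.sum_congr rfl fun j _ => ?_
    rw [map_mul, conj_ee, mul_mul_mul_comm, ← ee_add, Complex.conj_ofReal]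
    congr 2; ring
  have h2 : ((∑ a ∈ Finset.range q,
      ‖∑ n ∈ Finset.range N, (b n : ℂ) * ee (n * ((a:ℝ) / q))‖ ^ 2 : ℝ) : ℂ)
      = ((q * ∑ h ∈ Finset.range q, Zc b N q h ^ 2 : ℝ) : ℂ) := by
    rw [Complex.ofReal_sum]
    simp_rw [h1]
    rw [Finset.sum_comm]
    rw [Finset.sum_congr rfl fun n _ => Finset.sum_comm]
    simp_rw [← Finset.mul_sum, sum_ee_orth hq]
    have h3 : ∑ h ∈ Finset.range q, Zc b N q h ^ 2 = ∑ n ∈ Finset.range N, ∑ m ∈ Finset.range N,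
        b n * b m * (if (q:ℤ) ∣ (n:ℤ) - m then 1 else 0) := by
      unfold Zc
      simp_rw [sq, Finset.sum_mul_sum]
      rw [Finset.sum_comm]
      refine Finset.sum_congr rfl fun n _ => ?_
      rw [Finset.sum_comm]
      refine Finset.sum_congr rfl fun m _ => ?_
      have : ((q:ℤ) ∣ (n:ℤ) - m) ↔ m % q = n % q := by
        rw [← Nat.modEq_iff_dvd]; rfl
      simp_rw [this]
      rw [Finset.sum_eq_single (n % q)]
      · simp
      · intro h _ hh
        rw [if_neg (Ne.symm hh)]; simp
      · intro hh; exact absurd (Finset.mem_range.mpr (Nat.mod_lt n hq)) hh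
    rw [h3]
    push_cast
    rw [Finset.mul_sum]
    refine Finset.sum_congr rfl fun n _ => ?_
    rw [Finset.mul_sum]
    refine Finset.sum_congr rfl fun m _ => ?_
    split_ifs <;> simp; ring
  exact_mod_cast h2

lemma Vq_fourier (b : ℕ → ℝ) (N : ℕ) {q : ℕ} (hq : 0 < q) :
    q * Vq b N q = ∑ a ∈ Finset.Ico 1 q,
      ‖∑ n ∈ Finset.range N, (b n : ℂ) * ee (n * ((a:ℝ) / q))‖ ^ 2 := by
  have h := sum_sq_eq b N hq
  rw [Finset.range_eq_Ico, Finset.sum_eq_sum_Ico_succ_bot hq] at h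
  rw [Vq_eq b N hq, mul_sub, Finset.range_eq_Ico, Finset.range_eq_Ico, ← h]
  have : (q:ℝ) ≠ 0 := by positivity
  simp only [Nat.cast_zero, zero_div, mul_zero, ee_zero, mul_one, ← Complex.ofReal_sum,
    Complex.norm_real, Real.norm_eq_abs, sq_abs, zero_add, Finset.range_eq_Ico]
  field_simp
  ring

lemma farey_sep {Q q q' a a' : ℕ} (hq : q.Prime) (hq' : q'.Prime) (h1 : q ≤ 2 * Q)
    (h1' : q' ≤ 2 * Q) (ha : 1 ≤ a) (haq : a < q) (haq' : a' < q')
    (hne : (q, a) ≠ (q', a')) (k : ℤ) :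
    1 / (4 * (Q:ℝ) ^ 2) ≤ |(a:ℝ) / q - (a':ℝ) / q' - k| := by
  have hq0 : (0:ℝ) < q := by exact_mod_cast hq.pos
  have hq0' : (0:ℝ) < q' := by exact_mod_cast hq'.pos
  have hz : (a:ℤ) * q' - a' * q - k * q * q' ≠ 0 := by
    intro h
    by_cases hqq : q = q'
    · subst hqq
      have h2 : (q:ℤ) * (a - a' - k * q) = 0 := by linarith
      have h3 : (a:ℤ) - a' - k * q = 0 := by
        rcases mul_eq_zero.mp h2 with h | h
        · exact absurd h (by exact_mod_cast hq.ne_zero)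
        · exact h
      have h4 : (q:ℤ) ∣ (a:ℤ) - a' := ⟨k, by linarith⟩
      have h5 : (a:ℤ) - a' = 0 := by
        apply Int.eq_zero_of_abs_lt_dvd h4
        rw [abs_lt]; constructor <;> omega
      exact hne (by ext <;> simp; omega)
    · have h2 : (q:ℤ) ∣ (a:ℤ) * q' := ⟨a' + k * q', by linarith⟩
      have h3 : q ∣ a * q' := by exact_mod_cast h2
      rcases hq.dvd_mul.mp h3 with h | h
      · exact absurd (Nat.le_of_dvd (by omega) h) (by omega)
      · exact hqq ((Nat.prime_dvd_prime_iff_eq hq hq').mp h)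
  have h2 : (a:ℝ) / q - (a':ℝ) / q' - k = (((a:ℤ) * q' - a' * q - k * q * q' : ℤ) : ℝ) / (q * q') := by
    push_cast; field_simp
  rw [h2, abs_div, abs_of_pos (by positivity : (0:ℝ) < q * q')]
  have h3 : (1:ℝ) ≤ |(((a:ℤ) * q' - a' * q - k * q * q' : ℤ) : ℝ)| := by
    rw [← Int.cast_abs]; exact_mod_cast Int.one_le_abs hz
  have h4 : (q:ℝ) * q' ≤ 4 * (Q:ℝ) ^ 2 := by
    have e1 : (q:ℝ) ≤ 2 * Q := by exact_mod_cast h1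
    have e2 : (q':ℝ) ≤ 2 * Q := by exact_mod_cast h1'
    nlinarith
  calc _ ≤ 1 / ((q:ℝ) * q') := by gcongr
    _ ≤ _ := by gcongr

/-- the large sieve constant -/
noncomputable def CL : ℝ := 4 + 2 * cZ

lemma CL_pos : 0 < CL := by unfold CL; have := cZ_nonneg; linarith

/-- Rényi's form of the large sieve for prime moduli in `(Q, 2 * Q]`. -/
lemma renyi (P : Finset ℕ) (Q : ℕ) (hQ : 1 ≤ Q)
    (hP : ∀ q ∈ P, q.Prime ∧ Q < q ∧ q ≤ 2 * Q) (b : ℕ → ℝ) (N : ℕ) :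
    ∑ q ∈ P, Vq b N q ≤ CL * ((N + 4 * (Q:ℝ) ^ 2) / Q) * ∑ n ∈ Finset.range N, b n ^ 2 := by
  have hQ0 : (0:ℝ) < Q := by exact_mod_cast hQ
  set s : Finset (Σ _ : ℕ, ℕ) := P.sigma (fun q => Finset.Ico 1 q) with hs
  set α : (Σ _ : ℕ, ℕ) → ℝ := fun x => (x.2 : ℝ) / x.1 with hα
  have h := large_sieve s α (δ := 1 / (4 * (Q:ℝ) ^ 2)) (by positivity) ?_ b N (N + 4 * Q ^ 2)
    (by omega) (by push_cast; rw [one_div_one_div]; linarith [(Nat.cast_nonneg N : (0:ℝ) ≤ N)])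
  · rw [hs, Finset.sum_sigma] at h
    have h2 : Q * ∑ q ∈ P, Vq b N q ≤ ∑ q ∈ P, ∑ a ∈ Finset.Ico 1 q,
      ‖∑ n ∈ Finset.range N, (b n : ℂ) * ee (n * ((a:ℝ) / q))‖ ^ 2 := by
      rw [Finset.mul_sum]
      refine Finset.sum_le_sum fun q hq => ?_
      rw [← Vq_fourier b N (hP q hq).1.pos]
      have : (Q:ℝ) ≤ q := by exact_mod_cast (hP q hq).2.1.le
      have := Vq_nonneg b N q
      gcongr
    have h3 := h2.trans h
    have h4 : Q * ∑ q ∈ P, Vq b N q ≤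
      Q * (CL * ((N + 4 * (Q:ℝ) ^ 2) / Q) * ∑ n ∈ Finset.range N, b n ^ 2) := by
      refine h3.trans (le_of_eq ?_)
      unfold CL; push_cast; field_simp
    exact le_of_mul_le_mul_left h4 hQ0
  · rintro ⟨q, a⟩ hi ⟨q', a'⟩ hj hij k
    simp only [hs, Finset.mem_sigma, Finset.mem_Ico] at hi hj
    refine farey_sep (hP q hi.1).1 (hP q' hj.1).1 (hP q hi.1).2.2 (hP q' hj.1).2.2 hi.2.1 hi.2.2
      hj.2.2 ?_ k
    intro h
    simp only [Prod.mk.injEq] at h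
    obtain ⟨rfl, rfl⟩ := h
    exact hij rfl

end FI

namespace FI

/-- balanced indicator of the class `a` mod `q` -/
noncomputable def kap (q : ℕ) (a : ℤ) (n : ℕ) : ℝ :=
  (if (q:ℤ) ∣ (n:ℤ) - a then 1 else 0) - (if q ∣ n then 0 else 1 / ((q:ℝ) - 1))

/-- the same on `ZMod q` -/
noncomputable def kz (q : ℕ) (a u : ZMod q) : ℝ :=
  (if u = a then 1 else 0) - (if u = 0 then 0 else 1 / ((q:ℝ) - 1))

lemma kap_eq_kz (q : ℕ) (a : ℤ) (n : ℕ) : kap q a n = kz q (a : ZMod q) (n : ZMod q) := by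
  unfold kap kz
  have h1 : ((q:ℤ) ∣ (n:ℤ) - a) ↔ (n : ZMod q) = (a : ZMod q) := by
    rw [← ZMod.intCast_zmod_eq_zero_iff_dvd]
    push_cast; rw [sub_eq_zero]
  have h2 : q ∣ n ↔ (n : ZMod q) = 0 := (ZMod.natCast_eq_zero_iff n q).symm
  simp only [h1, h2]

lemma kz_row (q : ℕ) [Fact q.Prime] (a : ZMod q) (ha : a ≠ 0) (h : ZMod q) :
    ∑ l : ZMod q, kz q a (h * l) = 0 := by
  have hq : 2 ≤ q := (Fact.out : q.Prime).two_le
  have hq1 : (q:ℝ) - 1 ≠ 0 := by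
    have : (2:ℝ) ≤ q := by exact_mod_cast hq
    linarith
  by_cases hh : h = 0
  · subst hh; simp [kz, ha.symm]
  · have : ∑ l : ZMod q, kz q a (h * l) = ∑ l : ZMod q, kz q a l :=
      Fintype.sum_equiv (Equiv.mulLeft₀ h hh) _ _ (fun l => by simp)
    rw [this]
    unfold kz
    rw [Finset.sum_sub_distrib, Finset.sum_ite_eq' Finset.univ a]
    have h2 : ∀ u : ZMod q, (if u = 0 then (0:ℝ) else 1 / ((q:ℝ) - 1))
        = 1 / ((q:ℝ) - 1) - (if u = 0 then 1 / ((q:ℝ) - 1) else 0) := by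
      intro u; split_ifs <;> simp
    simp_rw [h2]
    rw [Finset.sum_sub_distrib, Finset.sum_ite_eq' Finset.univ (0 : ZMod q)]
    simp [ZMod.card]
    field_simp
    ring

lemma kz_bound (q : ℕ) [Fact q.Prime] (a : ZMod q) (ha : a ≠ 0) (A B : ZMod q → ℝ) :
    |∑ h, ∑ l, A h * B l * kz q a (h * l)| ≤ 2 * (√(∑ h, A h ^ 2) * √(∑ h, B h ^ 2)) := by
  have hq : 2 ≤ q := (Fact.out : q.Prime).two_le
  have hq1 : 0 < (q:ℝ) - 1 := by
    have : (2:ℝ) ≤ q := by exact_mod_cast hq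
    linarith
  set U : Finset (ZMod q) := Finset.univ.erase 0 with hU
  have hUc : (U.card : ℝ) = q - 1 := by
    rw [hU, Finset.card_erase_of_mem (Finset.mem_univ _), Finset.card_univ, ZMod.card]
    push_cast [Nat.cast_sub (by omega : 1 ≤ q)]; ring
  have hA : ∑ h ∈ U, A h ^ 2 ≤ ∑ h, A h ^ 2 :=
    Finset.sum_le_sum_of_subset_of_nonneg (Finset.subset_univ _) (fun _ _ _ => by positivity)
  have hB : ∑ h ∈ U, B h ^ 2 ≤ ∑ h, B h ^ 2 :=
    Finset.sum_le_sum_of_subset_of_nonneg (Finset.subset_univ _) (fun _ _ _ => by positivity)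
  have key : ∑ h, ∑ l, A h * B l * kz q a (h * l)
      = ∑ h ∈ U, A h * B (h⁻¹ * a) - 1 / ((q:ℝ) - 1) * ((∑ h ∈ U, A h) * ∑ l ∈ U, B l) := by
    rw [← Finset.add_sum_erase Finset.univ _ (Finset.mem_univ (0 : ZMod q)), ← hU]
    have h0 : ∑ l, A 0 * B l * kz q a (0 * l) = 0 := by
      simp [kz, ha.symm]
    rw [h0, zero_add, Finset.sum_mul, Finset.mul_sum, ← Finset.sum_sub_distrib]
    refine Finset.sum_congr rfl fun h hh => ?_
    have hh0 : h ≠ 0 := Finset.ne_of_mem_erase hh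
    unfold kz
    simp_rw [mul_sub]
    rw [Finset.sum_sub_distrib]
    congr 1
    · rw [Finset.sum_eq_single (h⁻¹ * a)]
      · rw [mul_inv_cancel_left₀ hh0]; simp
      · intro l _ hl
        rw [if_neg, mul_zero]
        intro h2
        apply hl
        rw [← h2, inv_mul_cancel_left₀ hh0]
      · simp
    · rw [Finset.mul_sum, Finset.mul_sum,
        ← Finset.add_sum_erase Finset.univ _ (Finset.mem_univ (0 : ZMod q)), ← hU]
      simp only [mul_zero, if_true, zero_add]
      refine Finset.sum_congr rfl fun l hl => ?_
      have hl0 : l ≠ 0 := Finset.ne_of_mem_erase hl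
      rw [if_neg (mul_ne_zero hh0 hl0)]; ring
  rw [key]
  have b1 : |∑ h ∈ U, A h * B (h⁻¹ * a)| ≤ √(∑ h, A h ^ 2) * √(∑ h, B h ^ 2) := by
    have e : ∑ h ∈ U, B (h⁻¹ * a) ^ 2 ≤ ∑ h, B h ^ 2 := by
      have hinj : Set.InjOn (fun h : ZMod q => h⁻¹ * a) (U : Set (ZMod q)) := by
        intro x _ y _ hxy
        exact inv_injective (mul_right_cancel₀ ha hxy)
      rw [← Finset.sum_image (f := fun x => B x ^ 2) hinj]
      exact Finset.sum_le_sum_of_subset_of_nonneg (Finset.subset_univ _)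
        (fun _ _ _ => by positivity)
    rw [← Real.sqrt_mul (Finset.sum_nonneg fun _ _ => by positivity)]
    apply Real.abs_le_sqrt
    refine (Finset.sum_mul_sq_le_sq_mul_sq _ _ _).trans ?_
    gcongr
  have b2 : |1 / ((q:ℝ) - 1) * ((∑ h ∈ U, A h) * ∑ l ∈ U, B l)|
      ≤ √(∑ h, A h ^ 2) * √(∑ h, B h ^ 2) := by
    have c1 : (∑ h ∈ U, A h) ^ 2 ≤ ((q:ℝ) - 1) * ∑ h, A h ^ 2 := by
      rw [← hUc]; exact sq_sum_le_card_mul_sum_sq.trans (by gcongr)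
    have c2 : (∑ h ∈ U, B h) ^ 2 ≤ ((q:ℝ) - 1) * ∑ h, B h ^ 2 := by
      rw [← hUc]; exact sq_sum_le_card_mul_sum_sq.trans (by gcongr)
    rw [← Real.sqrt_mul (Finset.sum_nonneg fun _ _ => by positivity)]
    apply Real.abs_le_sqrt
    rw [mul_pow, mul_pow]
    calc (1 / ((q:ℝ) - 1)) ^ 2 * ((∑ h ∈ U, A h) ^ 2 * (∑ l ∈ U, B l) ^ 2)
        ≤ (1 / ((q:ℝ) - 1)) ^ 2 * ((((q:ℝ) - 1) * ∑ h, A h ^ 2) * (((q:ℝ) - 1) * ∑ h, B h ^ 2)) := by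
          have : 0 ≤ ∑ h, A h ^ 2 := Finset.sum_nonneg fun _ _ => by positivity
          gcongr
      _ = _ := by field_simp
  calc _ ≤ |∑ h ∈ U, A h * B (h⁻¹ * a)| +
        |1 / ((q:ℝ) - 1) * ((∑ h ∈ U, A h) * ∑ l ∈ U, B l)| := abs_sub _ _
    _ ≤ _ := by linarith

lemma kz_shift (q : ℕ) [Fact q.Prime] (a : ZMod q) (ha : a ≠ 0) (A B : ZMod q → ℝ) (c d : ℝ) :
    ∑ h, ∑ l, (A h - c) * (B l - d) * kz q a (h * l) = ∑ h, ∑ l, A h * B l * kz q a (h * l) := by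
  have h1 : ∀ h l : ZMod q, (A h - c) * (B l - d) * kz q a (h * l)
      = A h * B l * kz q a (h * l) - d * (A h - c) * kz q a (h * l) - c * B l * kz q a (l * h) := by
    intro h l; rw [mul_comm l h]; ring
  simp_rw [h1, Finset.sum_sub_distrib]
  have h2 : ∑ h, ∑ l, d * (A h - c) * kz q a (h * l) = 0 := by
    refine Finset.sum_eq_zero fun h _ => ?_
    rw [← Finset.mul_sum, kz_row q a ha, mul_zero]
  have h3 : ∑ h, ∑ l, c * B l * kz q a (l * h) = 0 := by
    rw [Finset.sum_comm]
    refine Finset.sum_eq_zero fun h _ => ?_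
    rw [← Finset.mul_sum, kz_row q a ha, mul_zero]
  rw [h2, h3]; ring

lemma sum_zmod (q : ℕ) [NeZero q] (f : ℕ → ℝ) :
    ∑ h : ZMod q, f h.val = ∑ h ∈ Finset.range q, f h := by
  refine Finset.sum_nbij' (fun h => h.val) (fun n => (n : ZMod q)) ?_ ?_ ?_ ?_ ?_
  · intro h _; exact Finset.mem_range.mpr (ZMod.val_lt h)
  · intro n _; exact Finset.mem_univ _
  · intro h _; exact ZMod.natCast_zmod_val h
  · intro n hn; exact ZMod.val_cast_of_lt (Finset.mem_range.mp hn)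
  · intro h _; rfl

lemma rect_bound {q : ℕ} (hq : q.Prime) (a : ℤ) (ha : ¬ (q:ℤ) ∣ a) (x y : ℕ → ℝ) (M K : ℕ) :
    |∑ m ∈ Finset.range M, ∑ k ∈ Finset.range K, x m * y k * kap q a (m * k)|
      ≤ 2 * (√(Vq x M q) * √(Vq y K q)) := by
  have : Fact q.Prime := ⟨hq⟩
  have ha' : (a : ZMod q) ≠ 0 := by rwa [Ne, ZMod.intCast_zmod_eq_zero_iff_dvd]
  have hZ : ∀ (x : ℕ → ℝ) (M : ℕ) (h : ZMod q),
      Zc x M q h.val = ∑ m ∈ Finset.range M, if (m : ZMod q) = h then x m else 0 := by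
    intro x M h
    unfold Zc
    refine Finset.sum_congr rfl fun m _ => ?_
    have : m % q = h.val ↔ (m : ZMod q) = h := by
      rw [← ZMod.val_natCast]
      exact (ZMod.val_injective q).eq_iff
    simp only [this]
  have hV : ∀ (x : ℕ → ℝ) (M : ℕ), Vq x M q
      = ∑ h : ZMod q, (Zc x M q h.val - (∑ n ∈ Finset.range M, x n) / q) ^ 2 := by
    intro x M
    exact (sum_zmod q fun h => (Zc x M q h - (∑ n ∈ Finset.range M, x n) / q) ^ 2).symm
  rw [hV, hV]
  have h1 : ∑ m ∈ Finset.range M, ∑ k ∈ Finset.range K, x m * y k * kap q a (m * k)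
      = ∑ h : ZMod q, ∑ l : ZMod q, Zc x M q h.val * Zc y K q l.val * kz q a (h * l) := by
    have e1 : ∀ h l : ZMod q, Zc x M q h.val * Zc y K q l.val * kz q a (h * l)
        = ∑ m ∈ Finset.range M, ∑ k ∈ Finset.range K,
          (if (m : ZMod q) = h then (if (k : ZMod q) = l then x m * y k * kz q a (h * l) else 0)
            else 0) := by
      intro h l
      rw [hZ, hZ, Finset.sum_mul_sum, Finset.sum_mul]
      refine Finset.sum_congr rfl fun m _ => ?_
      rw [Finset.sum_mul]
      refine Finset.sum_congr rfl fun k _ => ?_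
      split_ifs <;> simp
    simp_rw [e1]
    symm
    have sc : ∀ (T : Finset ℕ) (F : ZMod q → ZMod q → ℕ → ℝ),
        ∑ h, ∑ l, ∑ m ∈ T, F h l m = ∑ m ∈ T, ∑ h, ∑ l, F h l m := by
      intro T F
      rw [Finset.sum_comm]
      rw [Finset.sum_congr rfl fun h _ => Finset.sum_comm, Finset.sum_comm]
      exact Finset.sum_congr rfl fun m _ => Finset.sum_comm
    rw [sc]
    refine Finset.sum_congr rfl fun m _ => ?_
    rw [sc]
    refine Finset.sum_congr rfl fun k _ => ?_
    rw [Finset.sum_eq_single (m : ZMod q), Finset.sum_eq_single (k : ZMod q)]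
    · simp [kap_eq_kz]
    · intro b _ hb; rw [if_pos rfl, if_neg (fun h => hb h.symm)]
    · intro h; exact absurd (Finset.mem_univ _) h
    · intro b _ hb
      refine Finset.sum_eq_zero fun c _ => ?_
      rw [if_neg (fun h => hb h.symm)]
    · intro h; exact absurd (Finset.mem_univ _) h
  rw [h1, ← kz_shift q _ ha' _ _ ((∑ n ∈ Finset.range M, x n) / q)
    ((∑ n ∈ Finset.range K, y n) / q)]
  exact kz_bound q _ ha' _ _

lemma bit_decomp (r : ℕ) : ∀ n y : ℕ, y < 2 ^ r → (if n < y then (1:ℝ) else 0)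
    = ∑ l ∈ Finset.range r, (if y / 2 ^ l % 2 = 1 then 1 else 0)
      * (if n / 2 ^ l % 2 = 0 ∧ n / 2 ^ (l+1) = y / 2 ^ (l+1) then 1 else 0) := by
  induction r with
  | zero => intro n y hy; simp at hy; subst hy; simp
  | succ r ih =>
    intro n y hy
    rw [Finset.sum_range_succ']
    have h1 := ih (n / 2) (y / 2) (by rw [pow_succ] at hy; omega)
    simp only [Nat.div_div_eq_div_mul, ← pow_succ'] at h1
    rw [← h1]
    simp only [pow_zero, Nat.div_one, zero_add, pow_one]
    split_ifs <;> first | omega | norm_num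

lemma bilin (P : Finset ℕ) (Q : ℕ) (hQ : 1 ≤ Q)
    (hP : ∀ q ∈ P, q.Prime ∧ Q < q ∧ q ≤ 2 * Q) (a : ℤ) (ha : ∀ q ∈ P, ¬ (q:ℤ) ∣ a)
    (x y : ℕ → ℝ) (M K r : ℕ) (cut : ℕ → ℕ) (hcut : ∀ m, cut m < 2 ^ r) :
    ∑ q ∈ P, |∑ m ∈ Finset.range M, ∑ k ∈ Finset.range K,
        if k < cut m then x m * y k * kap q a (m * k) else 0|
      ≤ r * (2 * (√(CL * ((M + 4 * (Q:ℝ) ^ 2) / Q) * ∑ n ∈ Finset.range M, x n ^ 2)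
        * √(CL * ((K + 4 * (Q:ℝ) ^ 2) / Q) * ∑ n ∈ Finset.range K, y n ^ 2))) := by
  classical
  set X : ℕ → ℕ → ℕ → ℝ := fun l j m =>
    if cut m / 2 ^ l % 2 = 1 ∧ cut m / 2 ^ (l+1) = j then x m else 0 with hX
  set Y : ℕ → ℕ → ℕ → ℝ := fun l j k =>
    if k / 2 ^ l % 2 = 0 ∧ k / 2 ^ (l+1) = j then y k else 0 with hY
  have hjj : ∀ (t : ℕ) (l : ℕ), t < 2 ^ r → t / 2 ^ (l+1) ∈ Finset.range (2 ^ r) := fun t l ht =>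
    Finset.mem_range.mpr (lt_of_le_of_lt (Nat.div_le_self _ _) ht)
  -- pointwise decomposition
  have hdec : ∀ q, ∑ m ∈ Finset.range M, ∑ k ∈ Finset.range K,
        (if k < cut m then x m * y k * kap q a (m * k) else 0)
      = ∑ l ∈ Finset.range r, ∑ j ∈ Finset.range (2 ^ r),
        ∑ m ∈ Finset.range M, ∑ k ∈ Finset.range K, X l j m * Y l j k * kap q a (m * k) := by
    intro q
    have e1 : ∀ m k, (if k < cut m then x m * y k * kap q a (m * k) else 0)
        = ∑ l ∈ Finset.range r, ∑ j ∈ Finset.range (2 ^ r),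
          X l j m * Y l j k * kap q a (m * k) := by
      intro m k
      have e2 : (if k < cut m then x m * y k * kap q a (m * k) else 0)
          = (if k < cut m then (1:ℝ) else 0) * (x m * y k * kap q a (m * k)) := by
        split_ifs <;> simp
      rw [e2, bit_decomp r k (cut m) (hcut m), Finset.sum_mul]
      refine Finset.sum_congr rfl fun l _ => ?_
      rw [Finset.sum_eq_single (cut m / 2 ^ (l+1))]
      · simp only [hX, hY, and_true]
        by_cases c1 : cut m / 2 ^ l % 2 = 1
        · by_cases c2 : k / 2 ^ l % 2 = 0 ∧ k / 2 ^ (l+1) = cut m / 2 ^ (l+1)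
          · simp only [if_pos c1, if_pos c2]; ring
          · simp only [if_neg c2]; ring
        · simp only [if_neg c1]; ring
      · intro j _ hj
        have : X l j m = 0 := by
          simp only [hX]; rw [if_neg]; rintro ⟨_, h⟩; exact hj h.symm
        rw [this]; ring
      · intro h; exact absurd (hjj (cut m) l (hcut m)) h
    simp_rw [e1]
    rw [Finset.sum_congr rfl fun m _ => Finset.sum_comm, Finset.sum_comm]
    refine Finset.sum_congr rfl fun l _ => ?_
    rw [Finset.sum_congr rfl fun m _ => Finset.sum_comm, Finset.sum_comm]
  have hXs : ∀ l, ∑ j ∈ Finset.range (2 ^ r), ∑ m ∈ Finset.range M, X l j m ^ 2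
      ≤ ∑ m ∈ Finset.range M, x m ^ 2 := by
    intro l
    rw [Finset.sum_comm]
    refine Finset.sum_le_sum fun m _ => ?_
    have : ∀ j, X l j m ^ 2 ≤ if cut m / 2 ^ (l+1) = j then x m ^ 2 else 0 := by
      intro j; simp only [hX]
      by_cases c2 : cut m / 2 ^ (l+1) = j
      · simp only [c2, and_true, if_true]; split_ifs
        · exact le_rfl
        · simp; positivity
      · simp [c2]
    refine (Finset.sum_le_sum fun j _ => this j).trans ?_
    rw [Finset.sum_ite_eq]; split_ifs
    · exact le_rfl
    · positivity
  have hYs : ∀ l, ∑ j ∈ Finset.range (2 ^ r), ∑ m ∈ Finset.range K, Y l j m ^ 2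
      ≤ ∑ m ∈ Finset.range K, y m ^ 2 := by
    intro l
    rw [Finset.sum_comm]
    refine Finset.sum_le_sum fun m _ => ?_
    have : ∀ j, Y l j m ^ 2 ≤ if m / 2 ^ (l+1) = j then y m ^ 2 else 0 := by
      intro j; simp only [hY]
      by_cases c2 : m / 2 ^ (l+1) = j
      · simp only [c2, and_true, if_true]; split_ifs
        · exact le_rfl
        · simp; positivity
      · simp [c2]
    refine (Finset.sum_le_sum fun j _ => this j).trans ?_
    rw [Finset.sum_ite_eq]; split_ifs
    · exact le_rfl
    · positivity
  have hvar : ∀ (W : ℕ → ℕ → ℝ) (w : ℕ → ℝ) (N : ℕ),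
      (∑ j ∈ Finset.range (2 ^ r), ∑ m ∈ Finset.range N, W j m ^ 2
        ≤ ∑ m ∈ Finset.range N, w m ^ 2) →
      ∑ z ∈ P ×ˢ Finset.range (2 ^ r), Vq (W z.2) N z.1
        ≤ CL * ((N + 4 * (Q:ℝ) ^ 2) / Q) * ∑ n ∈ Finset.range N, w n ^ 2 := by
    intro W w N hW
    rw [Finset.sum_product_right]
    have hc : 0 ≤ CL * ((N + 4 * (Q:ℝ) ^ 2) / Q) := by have := CL_pos; positivity
    calc _ ≤ ∑ j ∈ Finset.range (2 ^ r),
          CL * ((N + 4 * (Q:ℝ) ^ 2) / Q) * ∑ n ∈ Finset.range N, W j n ^ 2 :=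
          Finset.sum_le_sum fun j _ => renyi P Q hQ hP (W j) N
      _ = CL * ((N + 4 * (Q:ℝ) ^ 2) / Q) *
          ∑ j ∈ Finset.range (2 ^ r), ∑ n ∈ Finset.range N, W j n ^ 2 := by rw [Finset.mul_sum]
      _ ≤ _ := by gcongr
  calc _ ≤ ∑ q ∈ P, ∑ l ∈ Finset.range r, ∑ j ∈ Finset.range (2 ^ r),
        2 * (√(Vq (X l j) M q) * √(Vq (Y l j) K q)) := by
        refine Finset.sum_le_sum fun q hq => ?_
        rw [hdec q]
        refine (Finset.abs_sum_le_sum_abs _ _).trans (Finset.sum_le_sum fun l _ => ?_)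
        refine (Finset.abs_sum_le_sum_abs _ _).trans (Finset.sum_le_sum fun j _ => ?_)
        exact rect_bound (hP q hq).1 a (ha q hq) _ _ _ _
    _ = ∑ l ∈ Finset.range r, 2 * ∑ z ∈ P ×ˢ Finset.range (2 ^ r),
        (√(Vq (X l z.2) M z.1) * √(Vq (Y l z.2) K z.1)) := by
        rw [Finset.sum_comm]
        refine Finset.sum_congr rfl fun l _ => ?_
        rw [Finset.sum_product, Finset.mul_sum]
        simp_rw [Finset.mul_sum]
    _ ≤ ∑ l ∈ Finset.range r,
        2 * (√(CL * ((M + 4 * (Q:ℝ) ^ 2) / Q) * ∑ n ∈ Finset.range M, x n ^ 2)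
        * √(CL * ((K + 4 * (Q:ℝ) ^ 2) / Q) * ∑ n ∈ Finset.range K, y n ^ 2)) := by
        refine Finset.sum_le_sum fun l _ => ?_
        refine mul_le_mul_of_nonneg_left ?_ (by norm_num)
        refine (Real.sum_sqrt_mul_sqrt_le _ (fun _ => Vq_nonneg _ _ _)
          (fun _ => Vq_nonneg _ _ _)).trans ?_
        gcongr
        · exact hvar (X l) x M (hXs l)
        · exact hvar (Y l) y K (hYs l)
    _ = _ := by simp

end FI

namespace FI

/-- a real completely multiplicative periodic function bounded by one -/
structure Chr (g : ℕ → ℝ) (D : ℕ) : Prop where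
  mul : ∀ m n, g (m * n) = g m * g n
  le : ∀ n, |g n| ≤ 1
  per : ∀ n, g (n + D) = g n
  pos : 0 < D

lemma chr_one : Chr (fun _ => 1) 1 := ⟨by simp, by simp, by simp, by simp⟩

lemma Chr.perm {g : ℕ → ℝ} {D : ℕ} (hg : Chr g D) (n c : ℕ) : g (n + D * c) = g n := by
  induction c with
  | zero => simp
  | succ c ih => rw [mul_add, mul_one, ← add_assoc, hg.per, ih]

/-- sums over residue classes -/
noncomputable def TS (q : ℕ) (g : ℕ → ℝ) (y : ℕ) (h : ZMod q) : ℝ :=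
  ∑ k ∈ Finset.range y, if (k : ZMod q) = h then g k else 0

lemma class_cnt (q : ℕ) [NeZero q] (D u L : ℕ) (hL : L ≤ D * q) (h : ZMod q) :
    ∑ k ∈ Finset.range L, (if ((u + k : ℕ) : ZMod q) = h then (1:ℝ) else 0) ≤ D := by
  have hq : 0 < q := Nat.pos_of_ne_zero (NeZero.ne q)
  calc _ ≤ ∑ k ∈ Finset.range (D * q), (if ((u + k : ℕ) : ZMod q) = h then (1:ℝ) else 0) :=
        Finset.sum_le_sum_of_subset_of_nonneg (Finset.range_mono hL)
          (fun _ _ _ => by split_ifs <;> norm_num)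
    _ = D := by
      clear hL
      induction D with
      | zero => simp
      | succ D ih =>
        rw [add_mul, one_mul, Finset.sum_range_add, ih]
        push_cast
        congr 1
        have := sum_zmod q (fun k => if ((u : ZMod q) + ((D : ZMod q) * (q : ZMod q) + (k : ZMod q))) = h
          then (1:ℝ) else 0)
        rw [← this]
        simp only [ZMod.natCast_val, ZMod.cast_id', id_eq, CharP.cast_eq_zero, mul_zero, zero_add]
        have h2 : ∀ x : ZMod q, ((u : ZMod q) + x = h) ↔ x = h - u := by
          intro x; rw [eq_sub_iff_add_eq, add_comm]
        simp only [h2]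
        simp

lemma class_diff {g : ℕ → ℝ} {D : ℕ} (hg : Chr g D) {q : ℕ} (hq : q.Prime) (hqD : ¬ q ∣ D)
    (y : ℕ) (h h' : ZMod q) : |TS q g y h - TS q g y h'| ≤ 2 * D := by
  have : Fact q.Prime := ⟨hq⟩
  have hD0 : (D : ZMod q) ≠ 0 := by rwa [Ne, ZMod.natCast_eq_zero_iff]
  set c : ℕ := ((D : ZMod q)⁻¹ * (h' - h)).val with hc
  have hcq : c < q := ZMod.val_lt _
  have hDc : (D : ZMod q) * (c : ZMod q) = h' - h := by
    rw [hc, ZMod.natCast_val, ZMod.cast_id', id_eq, mul_inv_cancel_left₀ hD0]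
  have e1 : TS q g y h = ∑ k ∈ Finset.range y,
      if ((D * c + k : ℕ) : ZMod q) = h' then g (D * c + k) else 0 := by
    unfold TS
    refine Finset.sum_congr rfl fun k _ => ?_
    have h2 : ((D * c + k : ℕ) : ZMod q) = h' ↔ (k : ZMod q) = h := by
      push_cast; rw [hDc]
      constructor
      · intro e; linear_combination e
      · intro e; rw [e]; ring
    rw [add_comm (D * c) k, hg.perm]
    rw [add_comm (D * c) k] at h2
    simp only [h2]
  have e2 := Finset.sum_range_add (fun k : ℕ => if (k : ZMod q) = h' then g k else 0) (D * c) y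
  have e3 := Finset.sum_range_add (fun k : ℕ => if (k : ZMod q) = h' then g k else 0) y (D * c)
  rw [← e1] at e2
  rw [add_comm y, e2] at e3
  have bd : ∀ u : ℕ, |∑ k ∈ Finset.range (D * c),
      if ((u + k : ℕ) : ZMod q) = h' then g (u + k) else 0| ≤ D := by
    intro u
    refine (Finset.abs_sum_le_sum_abs _ _).trans
      (le_trans (Finset.sum_le_sum fun k _ => ?_)
        (class_cnt q D u (D * c) (Nat.mul_le_mul_left _ hcq.le) h'))
    split_ifs
    · exact hg.le _
    · simp
  have b1 := bd 0
  have b2 := bd y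
  simp only [zero_add] at b1
  rw [abs_le] at *
  unfold TS at *
  constructor <;> linarith [b1.1, b1.2, b2.1, b2.2]

lemma typeI {g : ℕ → ℝ} {D : ℕ} (hg : Chr g D) {q : ℕ} (hq : q.Prime) (hqD : ¬ q ∣ D)
    (a : ℤ) (ha : ¬ (q:ℤ) ∣ a) (d y : ℕ) :
    |∑ k ∈ Finset.range y, g k * kap q a (d * k)| ≤ 2 * D := by
  have : Fact q.Prime := ⟨hq⟩
  have ha' : (a : ZMod q) ≠ 0 := by rwa [Ne, ZMod.intCast_zmod_eq_zero_iff_dvd]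
  have hD : (0:ℝ) ≤ D := by positivity
  have hq2 : (2:ℝ) ≤ q := by exact_mod_cast hq.two_le
  have e1 : ∑ k ∈ Finset.range y, g k * kap q a (d * k)
      = ∑ h : ZMod q, kz q a (d * h) * TS q g y h := by
    unfold TS
    simp_rw [Finset.mul_sum]
    rw [Finset.sum_comm]
    refine Finset.sum_congr rfl fun k _ => ?_
    rw [Finset.sum_eq_single (k : ZMod q)]
    · rw [if_pos rfl, kap_eq_kz]; push_cast; ring
    · intro b _ hb; rw [if_neg (fun h => hb h.symm), mul_zero]
    · intro h; exact absurd (Finset.mem_univ _) h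
  by_cases hd : (d : ZMod q) = 0
  · rw [e1, hd]
    have : kz q a (0 : ZMod q) = 0 := by simp [kz, ha'.symm]
    simp [this, hD]
  set h0 : ZMod q := (d : ZMod q)⁻¹ * a with hh0
  have e2 : ∑ k ∈ Finset.range y, g k * kap q a (d * k)
      = ∑ h : ZMod q, kz q a (d * h) * (TS q g y h - TS q g y h0) := by
    rw [e1]
    simp_rw [mul_sub]
    rw [Finset.sum_sub_distrib, ← Finset.sum_mul, kz_row q _ ha', zero_mul, sub_zero]
  rw [e2]
  have e3 : ∀ h : ZMod q, |kz q a (d * h) * (TS q g y h - TS q g y h0)|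
      ≤ if h = 0 then 0 else 1 / ((q:ℝ) - 1) * (2 * D) := by
    intro h
    by_cases c0 : h = 0
    · subst c0; simp [kz, ha'.symm]
    · rw [if_neg c0]
      by_cases c1 : h = h0
      · rw [c1, sub_self, mul_zero, abs_zero]
        have : 0 < (q:ℝ) - 1 := by linarith
        positivity
      · have : kz q a (d * h) = - (1 / ((q:ℝ) - 1)) := by
          unfold kz
          rw [if_neg, if_neg]
          · ring
          · exact mul_ne_zero hd c0
          · intro e; apply c1; rw [hh0, ← e, inv_mul_cancel_left₀ hd]
        rw [abs_mul, this, abs_neg, abs_of_nonneg (by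
          have : 0 < (q:ℝ) - 1 := by linarith
          positivity)]
        refine mul_le_mul_of_nonneg_left (class_diff hg hq hqD _ _ _) ?_
        have : 0 < (q:ℝ) - 1 := by linarith
        positivity
  refine (Finset.abs_sum_le_sum_abs _ _).trans ((Finset.sum_le_sum fun h _ => e3 h).trans ?_)
  rw [Finset.sum_ite, Finset.sum_const_zero, zero_add, Finset.sum_const, nsmul_eq_mul]
  have : (Finset.univ.filter fun h : ZMod q => ¬ h = 0).card = q - 1 := by
    rw [Finset.filter_not, Finset.filter_eq' Finset.univ (0 : ZMod q), if_pos (Finset.mem_univ _),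
      Finset.card_sdiff_of_subset (Finset.subset_univ _), Finset.card_univ, ZMod.card,
      Finset.card_singleton]
  rw [this, Nat.cast_sub (by linarith [hq.two_le])]
  have : (q:ℝ) - 1 ≠ 0 := by linarith
  push_cast
  field_simp
  exact le_refl _

/-- summation by parts bound -/
lemma abel_mono (c b : ℕ → ℝ) (B : ℝ) (n : ℕ) (hB : ∀ m, |∑ k ∈ Finset.range m, c k| ≤ B)
    (hb : ∀ k, 0 ≤ b k) (hm : Monotone b) :
    |∑ k ∈ Finset.range n, c k * b k| ≤ 2 * B * b n := by
  have key : ∀ n, ∑ k ∈ Finset.range n, c k * b k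
      = (∑ k ∈ Finset.range n, c k) * b n
        - ∑ k ∈ Finset.range n, (∑ j ∈ Finset.range (k+1), c j) * (b (k+1) - b k) := by
    intro n
    induction n with
    | zero => simp
    | succ n ih => rw [Finset.sum_range_succ, ih, Finset.sum_range_succ _ n,
        Finset.sum_range_succ _ n, Finset.sum_range_succ _ n]; ring
  have hB0 : 0 ≤ B := (abs_nonneg _).trans (hB 0)
  have h2 : |∑ k ∈ Finset.range n, (∑ j ∈ Finset.range (k+1), c j) * (b (k+1) - b k)|
      ≤ B * (b n - b 0) := by
    rw [← Finset.sum_range_sub, Finset.mul_sum]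
    refine (Finset.abs_sum_le_sum_abs _ _).trans (Finset.sum_le_sum fun k _ => ?_)
    rw [abs_mul, abs_of_nonneg (sub_nonneg.mpr (hm (Nat.le_succ k)))]
    exact mul_le_mul_of_nonneg_right (hB _) (sub_nonneg.mpr (hm (Nat.le_succ k)))
  have h1 : |(∑ k ∈ Finset.range n, c k) * b n| ≤ B * b n := by
    rw [abs_mul, abs_of_nonneg (hb n)]
    exact mul_le_mul_of_nonneg_right (hB _) (hb n)
  rw [key]
  refine (abs_sub _ _).trans ?_
  nlinarith [hb 0, mul_nonneg hB0 (hb 0)]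

lemma typeI_log {g : ℕ → ℝ} {D : ℕ} (hg : Chr g D) {q : ℕ} (hq : q.Prime) (hqD : ¬ q ∣ D)
    (a : ℤ) (ha : ¬ (q:ℤ) ∣ a) (d y : ℕ) :
    |∑ k ∈ Finset.range y, Real.log k * (g k * kap q a (d * k))| ≤ 4 * D * Real.log y := by
  have := abel_mono (fun k => g k * kap q a (d * k)) (fun k => Real.log k) (2 * D) y
    (fun m => typeI hg hq hqD a ha d m) (fun k => Real.log_natCast_nonneg k) (by
      intro m n h
      rcases Nat.eq_zero_or_pos m with rfl | hm
      · simpa using Real.log_natCast_nonneg n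
      · exact Real.log_le_log (by exact_mod_cast hm) (by exact_mod_cast h))
  simp_rw [mul_comm (Real.log _) (g _ * _)]
  linarith

lemma kap_abs_le {q : ℕ} (hq : q.Prime) (a : ℤ) (n : ℕ) : |kap q a n| ≤ 1 := by
  have hq2 : (2:ℝ) ≤ q := by exact_mod_cast hq.two_le
  have h1 : 1 / ((q:ℝ) - 1) ≤ 1 := by rw [div_le_one (by linarith)]; linarith
  have h2 : 0 ≤ 1 / ((q:ℝ) - 1) := by
    have : 0 < (q:ℝ) - 1 := by linarith
    positivity
  unfold kap
  rw [abs_le]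
  split_ifs <;> constructor <;> linarith

/-- sum of squares of divisor function -/
lemma harm_le (N : ℕ) : ∑ k ∈ Finset.Ioc 0 N, (1:ℝ) / k ≤ 1 + Real.log N := by
  have := harmonic_le_one_add_log N
  rw [harmonic_eq_sum_Icc] at this
  push_cast at this
  have e : Finset.Ioc 0 N = Finset.Icc 1 N := by
    ext k; simp only [Finset.mem_Ioc, Finset.mem_Icc]; omega
  rw [e]
  simpa using this

lemma tau_submul (m n : ℕ) : (m * n).divisors.card ≤ m.divisors.card * n.divisors.card := by
  rw [Nat.divisors_mul]; exact Finset.card_mul_le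

lemma sum_tau_gen (F : ℕ → ℝ) (N : ℕ) : ∑ k ∈ Finset.Ioc 0 N, (k.divisors.card : ℝ) * F k
    = ∑ d ∈ Finset.Ioc 0 N, ∑ m ∈ Finset.Ioc 0 (N / d), F (d * m) := by
  have e1 : ∀ k ∈ Finset.Ioc 0 N, (k.divisors.card : ℝ) * F k
      = ∑ d ∈ Finset.Ioc 0 N, if d ∣ k then F k else 0 := by
    intro k hk
    rw [Finset.mem_Ioc] at hk
    rw [← Finset.sum_filter, Finset.sum_const, nsmul_eq_mul]
    congr 3
    ext d
    simp only [Nat.mem_divisors, Finset.mem_filter, Finset.mem_Ioc]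
    constructor
    · rintro ⟨h, h0⟩
      exact ⟨⟨Nat.pos_of_dvd_of_pos h hk.1, (Nat.le_of_dvd hk.1 h).trans hk.2⟩, h⟩
    · rintro ⟨_, h⟩; exact ⟨h, by omega⟩
  rw [Finset.sum_congr rfl e1, Finset.sum_comm]
  refine Finset.sum_congr rfl fun d hd => ?_
  rw [Finset.mem_Ioc] at hd
  rw [← Finset.sum_filter]
  symm
  refine Finset.sum_nbij' (fun m => d * m) (fun k => k / d) ?_ ?_ ?_ ?_ ?_
  · intro m hm
    simp only [Finset.mem_Ioc, Finset.mem_filter] at hm ⊢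
    refine ⟨⟨Nat.mul_pos hd.1 hm.1, ?_⟩, Dvd.intro _ rfl⟩
    rw [mul_comm]; exact (Nat.le_div_iff_mul_le hd.1).mp hm.2
  · intro k hk
    simp only [Finset.mem_Ioc, Finset.mem_filter] at hk ⊢
    exact ⟨Nat.div_pos (Nat.le_of_dvd hk.1.1 hk.2) hd.1, Nat.div_le_div_right hk.1.2⟩
  · intro m _; exact Nat.mul_div_cancel_left m hd.1
  · intro k hk
    simp only [Finset.mem_filter] at hk
    exact Nat.mul_div_cancel' hk.2
  · intro m _; rfl

lemma tau_sum (N : ℕ) : ∑ k ∈ Finset.Ioc 0 N, (k.divisors.card : ℝ) ≤ N * (1 + Real.log N) := by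
  have := sum_tau_gen (fun _ => 1) N
  simp only [mul_one] at this
  rw [this]
  calc _ ≤ ∑ d ∈ Finset.Ioc 0 N, (N:ℝ) * (1 / d) := by
        refine Finset.sum_le_sum fun d _ => ?_
        simp only [Finset.sum_const, Nat.card_Ioc, tsub_zero, nsmul_eq_mul, mul_one]
        rw [mul_one_div]; exact Nat.cast_div_le
    _ ≤ _ := by
        rw [← Finset.mul_sum]
        exact mul_le_mul_of_nonneg_left (harm_le N) (by positivity)

lemma tau_div_sum (N : ℕ) :
    ∑ k ∈ Finset.Ioc 0 N, (k.divisors.card : ℝ) * (1 / k) ≤ (1 + Real.log N) ^ 2 := by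
  rw [sum_tau_gen (fun k => 1 / (k:ℝ)) N]
  have h0 := Real.log_natCast_nonneg N
  calc _ ≤ ∑ d ∈ Finset.Ioc 0 N, (1 + Real.log N) * (1 / (d:ℝ)) := by
        refine Finset.sum_le_sum fun d _ => ?_
        have : ∀ m : ℕ, 1 / ((d * m : ℕ) : ℝ) = 1 / (d:ℝ) * (1 / m) := by
          intro m; push_cast; rw [one_div_mul_one_div]
        simp_rw [this]
        rw [← Finset.mul_sum, mul_comm]
        refine mul_le_mul_of_nonneg_right ?_ (by positivity)
        refine le_trans (Finset.sum_le_sum_of_subset_of_nonneg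
          (Finset.Ioc_subset_Ioc_right (Nat.div_le_self N d)) (fun _ _ _ => by positivity)) ?_
        exact harm_le N
    _ ≤ _ := by
        rw [← Finset.mul_sum, sq]
        exact mul_le_mul_of_nonneg_left (harm_le N) (by positivity)

lemma tau_sq_sum (N : ℕ) :
    ∑ k ∈ Finset.Ioc 0 N, (k.divisors.card : ℝ) ^ 2 ≤ N * (1 + Real.log N) ^ 3 := by
  simp_rw [sq]
  rw [sum_tau_gen (fun k => (k.divisors.card : ℝ)) N]
  have h0 := Real.log_natCast_nonneg N
  calc _ ≤ ∑ d ∈ Finset.Ioc 0 N, (N * (1 + Real.log N)) * ((d.divisors.card : ℝ) * (1 / d)) := by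
        refine Finset.sum_le_sum fun d hd => ?_
        rw [Finset.mem_Ioc] at hd
        have hd0 : (0:ℝ) < d := by exact_mod_cast hd.1
        have h1 : ∀ m ∈ Finset.Ioc 0 (N / d), ((d * m).divisors.card : ℝ)
            ≤ d.divisors.card * m.divisors.card := by
          intro m _; exact_mod_cast tau_submul d m
        refine (Finset.sum_le_sum h1).trans ?_
        rw [← Finset.mul_sum]
        have h2 : ((N / d : ℕ) : ℝ) * (1 + Real.log (N / d : ℕ)) ≤ N / d * (1 + Real.log N) := by
          have : Real.log (N / d : ℕ) ≤ Real.log N := by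
            rcases Nat.eq_zero_or_pos (N / d) with h | h
            · rw [h]; simpa using h0
            · exact Real.log_le_log (by exact_mod_cast h) (by exact_mod_cast Nat.div_le_self N d)
          have h3 := Real.log_natCast_nonneg (N / d)
          exact mul_le_mul Nat.cast_div_le (by linarith) (by positivity) (by positivity)
        calc _ ≤ (d.divisors.card : ℝ) * (N / d * (1 + Real.log N)) :=
              mul_le_mul_of_nonneg_left ((tau_sum _).trans h2) (by positivity)
          _ = _ := by ring
    _ ≤ _ := by
        rw [← Finset.mul_sum]
        calc _ ≤ (N * (1 + Real.log N)) * (1 + Real.log N) ^ 2 :=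
              mul_le_mul_of_nonneg_left (tau_div_sum N) (by positivity)
          _ = _ := by ring

end FI

namespace FI
open ArithmeticFunction

lemma sum_conv (α β : ArithmeticFunction ℝ) (H : ℕ → ℝ) (N : ℕ) :
    ∑ n ∈ Finset.Ioc 0 N, (α * β) n * H n
      = ∑ d ∈ Finset.Ioc 0 N, ∑ k ∈ Finset.Ioc 0 (N / d), α d * β k * H (d * k) := by
  have e1 : ∀ k ∈ Finset.Ioc 0 N, (α * β) k * H k
      = ∑ d ∈ Finset.Ioc 0 N, if d ∣ k then α d * β (k / d) * H k else 0 := by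
    intro k hk
    rw [Finset.mem_Ioc] at hk
    rw [← Finset.sum_filter, ArithmeticFunction.mul_apply,
      Nat.sum_divisorsAntidiagonal (f := fun i j => α i * β j), Finset.sum_mul]
    refine Finset.sum_congr ?_ fun _ _ => rfl
    ext d
    simp only [Nat.mem_divisors, Finset.mem_filter, Finset.mem_Ioc]
    constructor
    · rintro ⟨h, h0⟩
      exact ⟨⟨Nat.pos_of_dvd_of_pos h hk.1, (Nat.le_of_dvd hk.1 h).trans hk.2⟩, h⟩
    · rintro ⟨_, h⟩; exact ⟨h, by omega⟩
  rw [Finset.sum_congr rfl e1, Finset.sum_comm]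
  refine Finset.sum_congr rfl fun d hd => ?_
  rw [Finset.mem_Ioc] at hd
  rw [← Finset.sum_filter]
  symm
  refine Finset.sum_nbij' (fun m => d * m) (fun k => k / d) ?_ ?_ ?_ ?_ ?_
  · intro m hm
    simp only [Finset.mem_Ioc, Finset.mem_filter] at hm ⊢
    refine ⟨⟨Nat.mul_pos hd.1 hm.1, ?_⟩, Dvd.intro _ rfl⟩
    rw [mul_comm]; exact (Nat.le_div_iff_mul_le hd.1).mp hm.2
  · intro k hk
    simp only [Finset.mem_Ioc, Finset.mem_filter] at hk ⊢
    exact ⟨Nat.div_pos (Nat.le_of_dvd hk.1.1 hk.2) hd.1, Nat.div_le_div_right hk.1.2⟩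
  · intro m _; exact Nat.mul_div_cancel_left m hd.1
  · intro k hk
    simp only [Finset.mem_filter] at hk
    exact Nat.mul_div_cancel' hk.2
  · intro m _; simp [Nat.mul_div_cancel_left m hd.1]

/-- truncations -/
noncomputable def lo (F : ArithmeticFunction ℝ) (V : ℕ) : ArithmeticFunction ℝ :=
  ⟨fun n => if n ≤ V then F n else 0, by simp⟩

noncomputable def hi (F : ArithmeticFunction ℝ) (V : ℕ) : ArithmeticFunction ℝ :=
  ⟨fun n => if n ≤ V then 0 else F n, by simp⟩

lemma lo_apply (F : ArithmeticFunction ℝ) (V n : ℕ) : lo F V n = if n ≤ V then F n else 0 := rfl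
lemma hi_apply (F : ArithmeticFunction ℝ) (V n : ℕ) : hi F V n = if n ≤ V then 0 else F n := rfl

lemma hi_eq (F : ArithmeticFunction ℝ) (V : ℕ) : hi F V = F - lo F V := by
  rw [eq_sub_iff_add_eq]
  ext n
  rw [ArithmeticFunction.add_apply, lo_apply, hi_apply]
  split_ifs <;> simp

/-- the Moebius function with real values -/
noncomputable def muR : ArithmeticFunction ℝ := ((ArithmeticFunction.moebius : ArithmeticFunction ℤ) : ArithmeticFunction ℝ)
noncomputable def zeR : ArithmeticFunction ℝ := ((ArithmeticFunction.zeta : ArithmeticFunction ℕ) : ArithmeticFunction ℝ)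

lemma muR_zeR : muR * zeR = 1 := ArithmeticFunction.coe_moebius_mul_coe_zeta

lemma vonM_zeR : vonMangoldt * zeR = ArithmeticFunction.log := vonMangoldt_mul_zeta

lemma vaughan (V : ℕ) : vonMangoldt = lo vonMangoldt V + lo muR V * ArithmeticFunction.log
    - (lo vonMangoldt V * lo muR V) * zeR + hi vonMangoldt V * (hi muR V * zeR) := by
  rw [hi_eq, hi_eq, ← vonM_zeR]
  linear_combination (-vonMangoldt + lo vonMangoldt V) * muR_zeR

lemma muR_abs (n : ℕ) : |muR n| ≤ 1 := by
  have := ArithmeticFunction.abs_moebius_le_one (n := n)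
  have h : muR n = ((ArithmeticFunction.moebius n : ℤ) : ℝ) := rfl
  rw [h]; exact_mod_cast this

lemma vonM_nonneg (n : ℕ) : 0 ≤ vonMangoldt n := ArithmeticFunction.vonMangoldt_nonneg
lemma vonM_le (n : ℕ) : vonMangoldt n ≤ Real.log n := ArithmeticFunction.vonMangoldt_le_log

lemma piece2_abs (V d : ℕ) : |(lo vonMangoldt V * lo muR V) d| ≤ if d ≤ V ^ 2 then Real.log d else 0 := by
  split_ifs with h
  · have e : Real.log d = (vonMangoldt * zeR) d := by rw [vonM_zeR]; rfl
    rw [e, ArithmeticFunction.mul_apply, ArithmeticFunction.mul_apply]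
    refine (Finset.abs_sum_le_sum_abs _ _).trans (Finset.sum_le_sum fun p hp => ?_)
    have hp2 : p.2 ≠ 0 := (Nat.pos_of_mem_divisors (Nat.snd_mem_divisors_of_mem_antidiagonal hp)).ne'
    have ez : zeR p.2 = 1 := by
      simp [zeR, ArithmeticFunction.natCoe_apply, ArithmeticFunction.zeta_apply, hp2]
    rw [ez, abs_mul, lo_apply, lo_apply]
    refine mul_le_mul ?_ ?_ (abs_nonneg _) (vonM_nonneg _)
    · split_ifs
      · rw [abs_of_nonneg (vonM_nonneg _)]
      · simp
    · split_ifs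
      · exact muR_abs _
      · simp
  · rw [ArithmeticFunction.mul_apply, Finset.sum_eq_zero, abs_zero]
    intro p hp
    rw [Nat.mem_divisorsAntidiagonal] at hp
    rw [lo_apply, lo_apply]
    by_cases h1 : p.1 ≤ V
    · by_cases h2 : p.2 ≤ V
      · exfalso; apply h; rw [← hp.1, sq]; exact Nat.mul_le_mul h1 h2
      · simp [h2]
    · simp [h1]

lemma hi_mu_abs (V k : ℕ) : |(hi muR V * zeR) k| ≤ k.divisors.card := by
  rw [ArithmeticFunction.mul_apply, Nat.sum_divisorsAntidiagonal (f := fun i j => hi muR V i * zeR j)]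
  refine (Finset.abs_sum_le_sum_abs _ _).trans ?_
  rw [Finset.card_eq_sum_ones]
  push_cast
  refine Finset.sum_le_sum fun d _ => ?_
  have ez : |zeR (k / d)| ≤ 1 := by
    simp only [zeR, ArithmeticFunction.natCoe_apply, ArithmeticFunction.zeta_apply]
    split_ifs <;> simp
  have e2 : |hi muR V d| ≤ 1 := by
    rw [hi_apply]; split_ifs
    · simp
    · exact muR_abs _
  rw [abs_mul]
  exact mul_le_one₀ e2 (abs_nonneg _) ez

lemma hi_mu_zero (V k : ℕ) (hk : k ≤ V) : (hi muR V * zeR) k = 0 := by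
  rw [ArithmeticFunction.mul_apply, Finset.sum_eq_zero]
  intro p hp
  have := Nat.le_of_dvd (Nat.pos_of_ne_zero (Nat.mem_divisorsAntidiagonal.mp hp).2)
    (Nat.dvd_of_mem_divisors (Nat.fst_mem_divisors_of_mem_antidiagonal hp))
  rw [hi_apply, if_pos (this.trans hk), zero_mul]

/-- twisted sums -/
noncomputable def ET (g : ℕ → ℝ) (q : ℕ) (a : ℤ) (x : ℕ) (F : ArithmeticFunction ℝ) : ℝ :=
  ∑ n ∈ Finset.Ioc 0 x, F n * (g n * kap q a n)

lemma ET_conv {g : ℕ → ℝ} {D : ℕ} (hg : Chr g D) (q : ℕ) (a : ℤ) (x : ℕ)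
    (α β : ArithmeticFunction ℝ) : ET g q a x (α * β)
      = ∑ d ∈ Finset.Ioc 0 x, (α d * g d) *
          ∑ k ∈ Finset.Ioc 0 (x / d), β k * (g k * kap q a (d * k)) := by
  unfold ET
  rw [sum_conv α β (fun n => g n * kap q a n)]
  refine Finset.sum_congr rfl fun d _ => ?_
  rw [Finset.mul_sum]
  refine Finset.sum_congr rfl fun k _ => ?_
  rw [hg.mul]; ring

lemma kap_zero (q : ℕ) (a : ℤ) (ha : ¬ (q:ℤ) ∣ a) : kap q a 0 = 0 := by
  simp [kap, ha]

lemma Ioc_eq_range (F : ℕ → ℝ) (h0 : F 0 = 0) (y : ℕ) :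
    ∑ k ∈ Finset.Ioc 0 y, F k = ∑ k ∈ Finset.range (y + 1), F k := by
  rw [Finset.sum_range_succ', h0, add_zero]
  rw [Finset.sum_bij' (fun k _ => k - 1) (fun k _ => k + 1)]
  · intro k hk; simp only [Finset.mem_Ioc, Finset.mem_range] at *; omega
  · intro k hk; simp only [Finset.mem_Ioc, Finset.mem_range] at *; omega
  · intro k hk; simp only [Finset.mem_Ioc] at hk; omega
  · intro k hk; omega
  · intro k hk; simp only [Finset.mem_Ioc] at hk; rw [Nat.sub_add_cancel hk.1]

lemma log_mono_nat {m n : ℕ} (h : m ≤ n) : Real.log m ≤ Real.log n := by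
  rcases Nat.eq_zero_or_pos m with rfl | hm
  · simpa using Real.log_natCast_nonneg n
  · exact Real.log_le_log (by exact_mod_cast hm) (by exact_mod_cast h)

lemma log_succ_le {x : ℕ} (hx : 1 ≤ x) : Real.log (x + 1) ≤ 1 + Real.log x := by
  have hx' : (1:ℝ) ≤ x := by exact_mod_cast hx
  have : Real.log (x + 1) ≤ Real.log (Real.exp 1 * x) := by
    apply Real.log_le_log (by linarith)
    have := Real.add_one_le_exp (1:ℝ)
    nlinarith
  rwa [Real.log_mul (Real.exp_pos 1).ne' (by linarith), Real.log_exp] at this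

lemma sum_trunc (x W : ℕ) (c : ℝ) (hc : 0 ≤ c) :
    ∑ d ∈ Finset.Ioc 0 x, (if d ≤ W then c else 0) ≤ W * c := by
  rw [← Finset.sum_filter, Finset.sum_const, nsmul_eq_mul]
  refine mul_le_mul_of_nonneg_right ?_ hc
  have : ((Finset.Ioc 0 x).filter (fun d => d ≤ W)).card ≤ (Finset.Ioc 0 W).card := by
    apply Finset.card_le_card
    intro d; simp only [Finset.mem_filter, Finset.mem_Ioc]; omega
  rw [Nat.card_Ioc, Nat.sub_zero] at this
  exact_mod_cast this

lemma ET_typeI {g : ℕ → ℝ} {D : ℕ} (hg : Chr g D) {q : ℕ} (hq : q.Prime) (hqD : ¬ q ∣ D)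
    (a : ℤ) (ha : ¬ (q:ℤ) ∣ a) (x V : ℕ) (hx : 1 ≤ x) (hV : 1 ≤ V) :
    |ET g q a x (lo vonMangoldt V)| + |ET g q a x (lo muR V * ArithmeticFunction.log)|
      + |ET g q a x ((lo vonMangoldt V * lo muR V) * zeR)|
      ≤ 7 * D * V ^ 2 * (1 + Real.log x) := by
  have hD : (1:ℝ) ≤ D := by exact_mod_cast hg.pos
  have hl := Real.log_natCast_nonneg x
  have hV' : (1:ℝ) ≤ V := by exact_mod_cast hV
  have b1 : |ET g q a x (lo vonMangoldt V)| ≤ V * (1 + Real.log x) := by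
    unfold ET
    refine (Finset.abs_sum_le_sum_abs _ _).trans (le_trans (Finset.sum_le_sum fun n hn => ?_)
      (sum_trunc x V (1 + Real.log x) (by linarith)))
    rw [Finset.mem_Ioc] at hn
    rw [lo_apply]
    split_ifs
    · rw [abs_mul, abs_of_nonneg (vonM_nonneg _), abs_mul]
      have := mul_le_one₀ (hg.le n) (abs_nonneg _) (kap_abs_le hq a n)
      have h2 := (vonM_le n).trans (log_mono_nat hn.2)
      have h3 := vonM_nonneg n
      nlinarith
    · simp
  have b2 : |ET g q a x (lo muR V * ArithmeticFunction.log)| ≤ V * (4 * D * (1 + Real.log x)) := by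
    rw [ET_conv hg]
    refine (Finset.abs_sum_le_sum_abs _ _).trans (le_trans (Finset.sum_le_sum fun n hn => ?_)
      (sum_trunc x V (4 * D * (1 + Real.log x)) (by positivity)))
    rw [lo_apply]
    split_ifs
    · rw [abs_mul, abs_mul]
      have h1 := mul_le_one₀ (muR_abs n) (abs_nonneg _) (hg.le n)
      have h2 : |∑ k ∈ Finset.Ioc 0 (x / n), ArithmeticFunction.log k * (g k * kap q a (n * k))|
          ≤ 4 * D * (1 + Real.log x) := by
        rw [Ioc_eq_range _ (by simp)]
        refine (typeI_log hg hq hqD a ha n _).trans ?_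
        refine mul_le_mul_of_nonneg_left ?_ (by positivity)
        refine (log_mono_nat (Nat.succ_le_succ (Nat.div_le_self x n))).trans ?_
        have := log_succ_le hx
        push_cast; exact this
      calc _ ≤ 1 * (4 * D * (1 + Real.log x)) := mul_le_mul h1 h2 (abs_nonneg _) (by norm_num)
        _ = _ := one_mul _
    · simp
  have b3 : |ET g q a x ((lo vonMangoldt V * lo muR V) * zeR)|
      ≤ (V ^ 2 : ℕ) * (2 * D * (1 + Real.log x)) := by
    rw [ET_conv hg]
    refine (Finset.abs_sum_le_sum_abs _ _).trans (le_trans (Finset.sum_le_sum fun n hn => ?_)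
      (sum_trunc x (V ^ 2) (2 * D * (1 + Real.log x)) (by positivity)))
    rw [Finset.mem_Ioc] at hn
    have h0 := piece2_abs V n
    rw [abs_mul, abs_mul]
    split_ifs at h0 ⊢
    · have h2 : |∑ k ∈ Finset.Ioc 0 (x / n), zeR k * (g k * kap q a (n * k))| ≤ 2 * D := by
        have e : ∀ k ∈ Finset.Ioc 0 (x / n), zeR k * (g k * kap q a (n * k))
            = g k * kap q a (n * k) := by
          intro k hk
          rw [Finset.mem_Ioc] at hk
          have : zeR k = 1 := by
            simp [zeR, ArithmeticFunction.natCoe_apply, ArithmeticFunction.zeta_apply, hk.1.ne']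
          rw [this, one_mul]
        rw [Finset.sum_congr rfl e, Ioc_eq_range _ (by simp [kap_zero q a ha])]
        exact typeI hg hq hqD a ha n _
      have h3 := h0.trans (log_mono_nat hn.2)
      calc _ ≤ ((1 + Real.log x) * 1) * (2 * D) := by
            refine mul_le_mul (mul_le_mul (by linarith) (hg.le n) (abs_nonneg _) (by linarith))
              h2 (abs_nonneg _) (by linarith)
        _ = _ := by ring
    · have : |(lo vonMangoldt V * lo muR V) n| = 0 := le_antisymm h0 (abs_nonneg _)
      rw [this]; simp
  push_cast at b3
  have hL : 0 ≤ 1 + Real.log x := by linarith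
  have hV2 : (V:ℝ) ≤ V ^ 2 := by nlinarith
  have c1 : (V:ℝ) * (1 + Real.log x) ≤ D * V ^ 2 * (1 + Real.log x) := by
    refine mul_le_mul_of_nonneg_right ?_ hL; nlinarith
  have c2 : (V:ℝ) * (4 * D * (1 + Real.log x)) ≤ V ^ 2 * (4 * D * (1 + Real.log x)) :=
    mul_le_mul_of_nonneg_right hV2 (by positivity)
  linarith

end FI

namespace FI
open ArithmeticFunction

lemma dyadic_sum (T : ℕ → ℝ) (r : ℕ) : ∑ m ∈ Finset.Ico 1 (2 ^ r), T m
    = ∑ i ∈ Finset.range r, ∑ m ∈ Finset.range (2 ^ (i + 1)), if 2 ^ i ≤ m then T m else 0 := by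
  induction r with
  | zero => simp
  | succ r ih =>
    rw [Finset.sum_range_succ, ← ih, ← Finset.sum_filter]
    have : (Finset.range (2 ^ (r+1))).filter (fun m => 2 ^ r ≤ m) = Finset.Ico (2 ^ r) (2 ^ (r+1)) := by
      ext m; simp only [Finset.mem_filter, Finset.mem_range, Finset.mem_Ico]; omega
    rw [this, Finset.sum_Ico_consecutive _ Nat.one_le_two_pow
      (Nat.pow_le_pow_right (by norm_num) (Nat.le_succ r))]

lemma two_sqrt_bound (x Q V M K R : ℝ) (hx : 1 ≤ x) (hQ : 1 ≤ Q) (hV : 1 ≤ V) (hM : 0 ≤ M)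
    (hK : 0 ≤ K) (hR : 1 ≤ R) (hMK : M * K ≤ 4 * x) (hMV : M ≤ 2 * x / V) (hKV : K ≤ 4 * x / V)
    (s1 s2 : ℝ) (hs1 : s1 ≤ M * R ^ 2) (hs2 : s2 ≤ K * R ^ 3) (C : ℝ) (hC : 0 ≤ C)
    (h1 : 0 ≤ s1) (h2 : 0 ≤ s2) :
    √(C * ((M + 4 * Q ^ 2) / Q) * s1) * √(C * ((K + 4 * Q ^ 2) / Q) * s2)
      ≤ C * R ^ 3 * (10 * (x / Q + x / √V + √x * Q)) := by
  have hQ0 : 0 < Q := by linarith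
  have hV0 : 0 < V := by linarith
  have hsV : 0 < √V := Real.sqrt_pos.mpr hV0
  rw [← Real.sqrt_mul (by positivity)]
  apply Real.sqrt_le_iff.mpr
  have hRHS : 0 ≤ C * R ^ 3 * (10 * (x / Q + x / √V + √x * Q)) := by positivity
  refine ⟨hRHS, ?_⟩
  have e1 : C * ((M + 4 * Q ^ 2) / Q) * s1 * (C * ((K + 4 * Q ^ 2) / Q) * s2)
      ≤ C * ((M + 4 * Q ^ 2) / Q) * (M * R ^ 2) * (C * ((K + 4 * Q ^ 2) / Q) * (K * R ^ 3)) := by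
    gcongr
  refine e1.trans ?_
  have e2 : C * ((M + 4 * Q ^ 2) / Q) * (M * R ^ 2) * (C * ((K + 4 * Q ^ 2) / Q) * (K * R ^ 3))
      = C ^ 2 * R ^ 5 * ((M * K) * (M * K + 4 * Q ^ 2 * (M + K) + 16 * Q ^ 4) / Q ^ 2) := by
    field_simp; ring
  rw [e2]
  have e3 : (M * K) * (M * K + 4 * Q ^ 2 * (M + K) + 16 * Q ^ 4) / Q ^ 2
      ≤ (4 * x) * (4 * x + 4 * Q ^ 2 * (6 * x / V) + 16 * Q ^ 4) / Q ^ 2 := by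
    have : M + K ≤ 6 * x / V := by
      calc M + K ≤ 2 * x / V + 4 * x / V := add_le_add hMV hKV
        _ = _ := by ring
    gcongr
  have e4 : (4 * x) * (4 * x + 4 * Q ^ 2 * (6 * x / V) + 16 * Q ^ 4) / Q ^ 2
      = 16 * (x / Q) ^ 2 + 96 * (x / √V) ^ 2 + 64 * (√x * Q) ^ 2 := by
    rw [div_pow x (√V), mul_pow (√x), Real.sq_sqrt (by linarith), Real.sq_sqrt (by linarith)]
    field_simp
    ring
  have e5 : 16 * (x / Q) ^ 2 + 96 * (x / √V) ^ 2 + 64 * (√x * Q) ^ 2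
      ≤ (10 * (x / Q + x / √V + √x * Q)) ^ 2 := by
    have a1 : 0 ≤ x / Q := by positivity
    have a2 : 0 ≤ x / √V := by positivity
    have a3 : 0 ≤ √x * Q := by positivity
    nlinarith [mul_nonneg a1 a2, mul_nonneg a1 a3, mul_nonneg a2 a3]
  have e6 : R ^ 5 ≤ R ^ 6 := pow_le_pow_right₀ hR (by norm_num)
  calc _ ≤ C ^ 2 * R ^ 6 * (10 * (x / Q + x / √V + √x * Q)) ^ 2 := by
        refine mul_le_mul (mul_le_mul_of_nonneg_left e6 (by positivity))
          (e3.trans (e4.le.trans e5)) ?_ (by positivity)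
        positivity
    _ = _ := by ring

lemma typeII {g : ℕ → ℝ} {D : ℕ} (hg : Chr g D) (P : Finset ℕ) (Q : ℕ) (hQ : 1 ≤ Q)
    (hP : ∀ q ∈ P, q.Prime ∧ Q < q ∧ q ≤ 2 * Q) (a : ℤ) (ha : ∀ q ∈ P, ¬ (q:ℤ) ∣ a)
    (x V : ℕ) (hx : 2 ≤ x) (hV : 1 ≤ V) :
    ∑ q ∈ P, |ET g q a x (hi vonMangoldt V * (hi muR V * zeR))|
      ≤ 120 * CL * (1 + Real.log x) ^ 5 * ((x:ℝ) / Q + x / √V + √x * Q) := by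
  classical
  set R : ℝ := 1 + Real.log x with hR
  have hlog := Real.log_natCast_nonneg x
  have hR1 : 1 ≤ R := by linarith
  set r : ℕ := Nat.log 2 x + 1 with hr
  have hxr : x < 2 ^ r := Nat.lt_pow_succ_log_self (by norm_num) x
  have hrx : ∀ i < r, 2 ^ i ≤ x := by
    intro i hi
    exact (Nat.pow_le_pow_right (by norm_num) (by omega : i ≤ Nat.log 2 x)).trans
      (Nat.pow_log_le_self 2 (by omega))
  have hrR : (r:ℝ) ≤ 2 * R := by
    have h1 : ((2:ℝ) ^ (Nat.log 2 x)) ≤ x := by exact_mod_cast Nat.pow_log_le_self 2 (by omega)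
    have h2 := Real.log_le_log (by positivity) h1
    rw [Real.log_pow] at h2
    have := Real.log_two_gt_d9
    have h3 : (0:ℝ) ≤ Nat.log 2 x := by positivity
    rw [hr, hR]; push_cast; nlinarith
  set A : ℕ → ℝ := fun m => hi vonMangoldt V m * g m with hA
  set B : ℕ → ℝ := fun k => (hi muR V * zeR) k * g k with hB
  have hA0 : ∀ m ≤ V, A m = 0 := by intro m hm; simp [hA, hi_apply, hm]
  have hB0 : ∀ m ≤ V, B m = 0 := by intro m hm; simp only [hB]; rw [hi_mu_zero V m hm, zero_mul]
  have hAabs : ∀ m, A m ^ 2 ≤ Real.log m ^ 2 := by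
    intro m
    apply sq_le_sq.mpr
    rw [abs_of_nonneg (Real.log_natCast_nonneg m), hA]
    simp only [abs_mul]
    have h1 : |hi vonMangoldt V m| ≤ Real.log m := by
      rw [hi_apply]; split_ifs
      · simpa using Real.log_natCast_nonneg m
      · rw [abs_of_nonneg (vonM_nonneg _)]; exact vonM_le m
    calc _ ≤ Real.log m * 1 := mul_le_mul h1 (hg.le m) (abs_nonneg _) (Real.log_natCast_nonneg m)
      _ = _ := mul_one _
  have hBabs : ∀ k, B k ^ 2 ≤ (k.divisors.card : ℝ) ^ 2 := by
    intro k
    apply sq_le_sq.mpr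
    rw [abs_of_nonneg (by positivity : (0:ℝ) ≤ k.divisors.card), hB]
    simp only [abs_mul]
    calc _ ≤ (k.divisors.card : ℝ) * 1 :=
          mul_le_mul (hi_mu_abs V k) (hg.le k) (abs_nonneg _) (by positivity)
      _ = _ := mul_one _
  set W : ℕ → ℕ → ℝ := fun i q => ∑ m ∈ Finset.range (2 ^ (i+1)), ∑ k ∈ Finset.range (x / 2 ^ i + 1),
    if k < x / m + 1 then (if 2 ^ i ≤ m then A m else 0) * B k * kap q a (m * k) else 0 with hW
  have hdec : ∀ q, ET g q a x (hi vonMangoldt V * (hi muR V * zeR)) = ∑ i ∈ Finset.range r, W i q := by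
    intro q
    rw [ET_conv hg]
    set T : ℕ → ℝ := fun m => A m * ∑ k ∈ Finset.Ioc 0 (x / m), B k * kap q a (m * k) with hT
    have e1 : ∑ d ∈ Finset.Ioc 0 x, hi vonMangoldt V d * g d *
          ∑ k ∈ Finset.Ioc 0 (x / d), (hi muR V * zeR) k * (g k * kap q a (d * k))
        = ∑ m ∈ Finset.Ico 1 (2 ^ r), T m := by
      have : Finset.Ioc 0 x ⊆ Finset.Ico 1 (2 ^ r) := by
        intro m; simp only [Finset.mem_Ioc, Finset.mem_Ico]; omega
      rw [← Finset.sum_subset this]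
      · refine Finset.sum_congr rfl fun d _ => ?_
        simp only [hT, hA, hB, mul_assoc]
      · intro m hm hm'
        simp only [Finset.mem_Ioc, Finset.mem_Ico] at hm hm'
        simp only [hT]
        rw [Nat.div_eq_of_lt (by omega)]; simp
    rw [e1, dyadic_sum]
    refine Finset.sum_congr rfl fun i _ => ?_
    simp only [hW]
    refine Finset.sum_congr rfl fun m _ => ?_
    by_cases hm : 2 ^ i ≤ m
    · simp only [hm, if_true, hT]
      rw [Ioc_eq_range _ (by simp [hB]), Finset.mul_sum, ← Finset.sum_filter]
      have : (Finset.range (x / 2 ^ i + 1)).filter (fun k => k < x / m + 1)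
          = Finset.range (x / m + 1) := by
        have : x / m ≤ x / 2 ^ i := Nat.div_le_div_left hm (by positivity)
        ext k; simp only [Finset.mem_filter, Finset.mem_range]; omega
      rw [this]
      refine Finset.sum_congr rfl fun k _ => by ring
    · simp [hm]
  have hWb : ∀ i ∈ Finset.range r, ∑ q ∈ P, |W i q|
      ≤ 60 * CL * R ^ 4 * ((x:ℝ) / Q + x / √V + √x * Q) := by
    intro i hi
    rw [Finset.mem_range] at hi
    have hi' := hrx i hi
    have hpos : 0 ≤ 60 * CL * R ^ 4 * ((x:ℝ) / Q + x / √V + √x * Q) := by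
      have := CL_pos
      positivity
    by_cases c1 : V < 2 ^ (i+1)
    swap
    · have : ∀ q ∈ P, |W i q| = 0 := by
        intro q _
        rw [abs_eq_zero]
        refine Finset.sum_eq_zero fun m hm => Finset.sum_eq_zero fun k _ => ?_
        rw [Finset.mem_range] at hm
        rw [hA0 m (by omega)]; simp
      rw [Finset.sum_eq_zero this]; exact hpos
    by_cases c2 : V < x / 2 ^ i
    swap
    · have : ∀ q ∈ P, |W i q| = 0 := by
        intro q _
        rw [abs_eq_zero]
        refine Finset.sum_eq_zero fun m hm => Finset.sum_eq_zero fun k hk => ?_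
        rw [Finset.mem_range] at hk
        rw [hB0 k (by omega)]; simp
      rw [Finset.sum_eq_zero this]; exact hpos
    have hb := bilin P Q hQ hP a ha (fun m => if 2 ^ i ≤ m then A m else 0) B (2 ^ (i+1))
      (x / 2 ^ i + 1) (r + 1) (fun m => x / m + 1) (by
        intro m
        have := Nat.div_le_self x m
        rw [pow_succ]; omega)
    refine hb.trans ?_
    have hxR : (2:ℝ) ≤ x := by exact_mod_cast hx
    have h2i : (0:ℝ) < 2 ^ i := by positivity
    have h2x : (2:ℝ) ^ i ≤ x := by exact_mod_cast hi'
    have hV0 : (1:ℝ) ≤ V := by exact_mod_cast hV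
    have hdiv : ((x / 2 ^ i : ℕ) : ℝ) ≤ x / 2 ^ i := by
      refine (Nat.cast_div_le).trans ?_
      push_cast; exact le_rfl
    have h1d : 1 ≤ (x:ℝ) / 2 ^ i := by rw [le_div_iff₀ h2i]; linarith
    have hKle : ((x / 2 ^ i + 1 : ℕ) : ℝ) ≤ 2 * x / 2 ^ i := by
      push_cast; rw [mul_div_assoc]; linarith
    have key := two_sqrt_bound x Q V ((2 ^ (i+1) : ℕ) : ℝ) ((x / 2 ^ i + 1 : ℕ) : ℝ) R (by linarith)
      (by exact_mod_cast hQ) hV0 (by positivity) (by positivity) hR1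
      (by
        calc _ ≤ ((2 ^ (i+1) : ℕ) : ℝ) * (2 * x / 2 ^ i) :=
              mul_le_mul_of_nonneg_left hKle (by positivity)
          _ = 4 * x := by push_cast; rw [pow_succ]; field_simp; ring)
      (by
        rw [le_div_iff₀ (by linarith)]
        have : V * 2 ^ i ≤ x := (Nat.mul_le_mul_right _ c2.le).trans (Nat.div_mul_le_self x _)
        have : (V:ℝ) * 2 ^ i ≤ x := by exact_mod_cast this
        push_cast; rw [pow_succ]; linarith)
      (by
        refine hKle.trans ?_
        rw [div_le_div_iff₀ h2i (by linarith)]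
        have : (V:ℝ) ≤ 2 ^ (i+1) := by exact_mod_cast c1.le
        rw [pow_succ] at this
        nlinarith)
      (∑ n ∈ Finset.range (2 ^ (i+1)), (fun m => if 2 ^ i ≤ m then A m else 0) n ^ 2)
      (∑ n ∈ Finset.range (x / 2 ^ i + 1), B n ^ 2)
      (by
        calc _ ≤ ∑ n ∈ Finset.range (2 ^ (i+1)), R ^ 2 := by
              refine Finset.sum_le_sum fun m hm => ?_
              rw [Finset.mem_range] at hm
              dsimp only
              split_ifs
              · refine (hAabs m).trans ?_
                have h0 := Real.log_natCast_nonneg m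
                have : Real.log m ≤ R := by
                  have h1 : Real.log m ≤ Real.log (2 * x : ℕ) := log_mono_nat (by
                    rw [pow_succ] at hm; omega)
                  push_cast at h1
                  rw [Real.log_mul (by norm_num) (by linarith)] at h1
                  have := Real.log_two_lt_d9
                  linarith
                exact pow_le_pow_left₀ h0 this 2
              · simp; positivity
          _ = _ := by rw [Finset.sum_const, Finset.card_range, nsmul_eq_mul])
      (by
        rw [← Ioc_eq_range (fun n => B n ^ 2) (by simp [hB])]
        refine (Finset.sum_le_sum fun k _ => hBabs k).trans ((tau_sq_sum _).trans ?_)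
        refine mul_le_mul (by exact_mod_cast Nat.le_succ _) ?_ ?_ (by positivity)
        · refine pow_le_pow_left₀ ?_ ?_ 3
          · have := Real.log_natCast_nonneg (x / 2 ^ i); linarith
          · have := log_mono_nat (Nat.div_le_self x (2 ^ i)); linarith
        · have := Real.log_natCast_nonneg (x / 2 ^ i); positivity)
      CL CL_pos.le (Finset.sum_nonneg fun _ _ => by positivity)
      (Finset.sum_nonneg fun _ _ => by positivity)
    have hr3 : ((r + 1 : ℕ) : ℝ) ≤ 3 * R := by push_cast; linarith
    have hC0 := CL_pos
    calc _ ≤ (3 * R) * (2 * (CL * R ^ 3 * (10 * ((x:ℝ) / Q + x / √V + √x * Q)))) := by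
          refine mul_le_mul hr3 (mul_le_mul_of_nonneg_left key (by norm_num)) (by positivity)
            (by positivity)
      _ = _ := by ring
  calc ∑ q ∈ P, |ET g q a x (hi vonMangoldt V * (hi muR V * zeR))|
      ≤ ∑ q ∈ P, ∑ i ∈ Finset.range r, |W i q| := by
        refine Finset.sum_le_sum fun q _ => ?_
        rw [hdec]; exact Finset.abs_sum_le_sum_abs _ _
    _ = ∑ i ∈ Finset.range r, ∑ q ∈ P, |W i q| := Finset.sum_comm
    _ ≤ r * (60 * CL * R ^ 4 * ((x:ℝ) / Q + x / √V + √x * Q)) := by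
        refine (Finset.sum_le_sum hWb).trans ?_
        rw [Finset.sum_const, Finset.card_range, nsmul_eq_mul]
    _ ≤ (2 * R) * (60 * CL * R ^ 4 * ((x:ℝ) / Q + x / √V + √x * Q)) := by
        refine mul_le_mul_of_nonneg_right hrR ?_
        have := CL_pos
        positivity
    _ = _ := by ring

lemma BVdy {g : ℕ → ℝ} {D : ℕ} (hg : Chr g D) (P : Finset ℕ) (Q : ℕ) (hQ : 1 ≤ Q)
    (hP : ∀ q ∈ P, q.Prime ∧ Q < q ∧ q ≤ 2 * Q) (hPD : ∀ q ∈ P, ¬ q ∣ D)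
    (a : ℤ) (ha : ∀ q ∈ P, ¬ (q:ℤ) ∣ a) (x V : ℕ) (hx : 2 ≤ x) (hV : 1 ≤ V) :
    ∑ q ∈ P, |ET g q a x vonMangoldt|
      ≤ 120 * CL * (1 + Real.log x) ^ 5 * ((x:ℝ) / Q + x / √V + √x * Q)
        + 7 * D * Q * V ^ 2 * (1 + Real.log x) := by
  have hcard : (P.card : ℝ) ≤ Q := by
    have : P ⊆ Finset.Ioc Q (2 * Q) := by
      intro q hq; rw [Finset.mem_Ioc]; exact ⟨(hP q hq).2.1, (hP q hq).2.2⟩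
    have := Finset.card_le_card this
    rw [Nat.card_Ioc] at this
    exact_mod_cast (by omega : P.card ≤ Q)
  have h1 : ∀ q ∈ P, |ET g q a x vonMangoldt|
      ≤ 7 * D * V ^ 2 * (1 + Real.log x)
        + |ET g q a x (hi vonMangoldt V * (hi muR V * zeR))| := by
    intro q hq
    have e : ET g q a x vonMangoldt = ET g q a x (lo vonMangoldt V)
        + ET g q a x (lo muR V * ArithmeticFunction.log)
        - ET g q a x ((lo vonMangoldt V * lo muR V) * zeR)
        + ET g q a x (hi vonMangoldt V * (hi muR V * zeR)) := by
      conv_lhs => rw [vaughan V]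
      unfold ET
      rw [← Finset.sum_add_distrib, ← Finset.sum_sub_distrib, ← Finset.sum_add_distrib]
      refine Finset.sum_congr rfl fun n _ => ?_
      have hs : ∀ F G : ArithmeticFunction ℝ, (F - G) n = F n - G n := by
        intro F G; rw [eq_sub_iff_add_eq, ← ArithmeticFunction.add_apply, sub_add_cancel]
      simp only [ArithmeticFunction.add_apply, hs]
      ring
    have := ET_typeI hg (hP q hq).1 (hPD q hq) a (ha q hq) x V (by omega) hV
    rw [e]
    have t1 := abs_add_le (ET g q a x (lo vonMangoldt V)
        + ET g q a x (lo muR V * ArithmeticFunction.log)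
        - ET g q a x ((lo vonMangoldt V * lo muR V) * zeR))
        (ET g q a x (hi vonMangoldt V * (hi muR V * zeR)))
    have t2 := abs_sub (ET g q a x (lo vonMangoldt V)
        + ET g q a x (lo muR V * ArithmeticFunction.log))
        (ET g q a x ((lo vonMangoldt V * lo muR V) * zeR))
    have t3 := abs_add_le (ET g q a x (lo vonMangoldt V))
        (ET g q a x (lo muR V * ArithmeticFunction.log))
    linarith
  refine (Finset.sum_le_sum h1).trans ?_
  rw [Finset.sum_add_distrib, Finset.sum_const, nsmul_eq_mul]
  have h2 := typeII hg P Q hQ hP a ha x V hx hV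
  have h3 : (P.card : ℝ) * (7 * D * V ^ 2 * (1 + Real.log x))
      ≤ Q * (7 * D * V ^ 2 * (1 + Real.log x)) := by
    refine mul_le_mul_of_nonneg_right hcard ?_
    have := Real.log_natCast_nonneg x
    positivity
  linarith

end FI

namespace FI
open ArithmeticFunction

lemma log_pow_le (δ : ℝ) (hδ : 0 < δ) (k : ℕ) :
    ∃ C : ℝ, 0 < C ∧ ∀ u : ℝ, 1 ≤ u → (1 + Real.log u) ^ k ≤ C * u ^ δ := by
  rcases Nat.eq_zero_or_pos k with rfl | hk
  · refine ⟨1, one_pos, fun u hu => ?_⟩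
    simpa using Real.one_le_rpow hu hδ.le
  · have hk' : (0:ℝ) < k := by exact_mod_cast hk
    refine ⟨(1 + k / δ) ^ k, by positivity, fun u hu => ?_⟩
    have h1 := Real.log_le_rpow_div (by linarith : 0 ≤ u) (div_pos hδ hk')
    have h2 : 1 ≤ u ^ (δ / k) := Real.one_le_rpow hu (by positivity)
    have h3 : 1 + Real.log u ≤ (1 + k / δ) * u ^ (δ / k) := by
      have : u ^ (δ / k) / (δ / k) = k / δ * u ^ (δ / k) := by field_simp
      rw [this] at h1; linarith
    have h4 := pow_le_pow_left₀ (by have := Real.log_nonneg hu; linarith) h3 k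
    rw [mul_pow, ← Real.rpow_mul_natCast (by linarith), div_mul_cancel₀ _ hk'.ne'] at h4
    exact h4

lemma BV_all {g : ℕ → ℝ} {D : ℕ} (hg : Chr g D) (ε : ℝ) (hε : 0 < ε) (hε2 : ε ≤ 1 / 10) :
    ∃ C : ℝ, 0 < C ∧ ∀ (u : ℕ), 2 ≤ u → ∀ (a : ℤ) (P : Finset ℕ),
      (∀ q ∈ P, q.Prime ∧ (u:ℝ) ^ (ε / 2) < q ∧ (q:ℝ) ≤ (u:ℝ) ^ (1 / 2 - ε) ∧ ¬ q ∣ D ∧ ¬ (q:ℤ) ∣ a) →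
      ∑ q ∈ P, |ET g q a u vonMangoldt| ≤ C * (u:ℝ) ^ (1 - ε / 4) := by
  obtain ⟨C, hC, hCu⟩ := log_pow_le (ε / 4) (by linarith) 6
  have hCL := CL_pos
  have hD0 : (0:ℝ) < D := by exact_mod_cast hg.pos
  refine ⟨2 * (120 * CL * 5 + 7 * D) * C, by positivity, ?_⟩
  intro u hu a P hP
  have hu1 : (1:ℝ) ≤ u := by exact_mod_cast (by omega : 1 ≤ u)
  have hu2 : (2:ℝ) ≤ u := by exact_mod_cast hu
  set R : ℝ := 1 + Real.log u with hR
  have hl := Real.log_natCast_nonneg u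
  have hR1 : 1 ≤ R := by linarith
  set r : ℕ := Nat.log 2 u + 1 with hr
  have hxr : u < 2 ^ r := Nat.lt_pow_succ_log_self (by norm_num) u
  have hrR : (r:ℝ) ≤ 2 * R := by
    have h1 : ((2:ℝ) ^ (Nat.log 2 u)) ≤ u := by exact_mod_cast Nat.pow_log_le_self 2 (by omega)
    have h2 := Real.log_le_log (by positivity) h1
    rw [Real.log_pow] at h2
    have := Real.log_two_gt_d9
    have h3 : (0:ℝ) ≤ Nat.log 2 u := by positivity
    rw [hr, hR]; push_cast; nlinarith
  -- choice of V
  set V : ℕ := ⌊(u:ℝ) ^ (1/5 : ℝ)⌋₊ with hV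
  have hV1 : 1 ≤ V := Nat.le_floor (by simpa using Real.one_le_rpow hu1 (by norm_num))
  have hVle : (V:ℝ) ≤ (u:ℝ) ^ (1/5 : ℝ) := Nat.floor_le (by positivity)
  have hV2 : (V:ℝ) ^ 2 ≤ (u:ℝ) ^ (2/5 : ℝ) := by
    calc (V:ℝ) ^ 2 ≤ ((u:ℝ) ^ (1/5 : ℝ)) ^ 2 := pow_le_pow_left₀ (by positivity) hVle 2
      _ = _ := by rw [← Real.rpow_mul_natCast (by linarith)]; norm_num
  have hVge : (u:ℝ) ^ (1/5 : ℝ) ≤ 4 * V := by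
    have := Nat.lt_floor_add_one ((u:ℝ) ^ (1/5 : ℝ))
    have h1 : (1:ℝ) ≤ V := by exact_mod_cast hV1
    rw [← hV] at this; linarith
  have hsV : (u:ℝ) ^ (1/10 : ℝ) ≤ 2 * √V := by
    have h1 := Real.sqrt_le_sqrt hVge
    rw [Real.sqrt_mul (by norm_num), show (4:ℝ) = 2 ^ 2 by norm_num,
      Real.sqrt_sq (by norm_num), Real.sqrt_eq_rpow, ← Real.rpow_mul (by linarith)] at h1
    norm_num at h1 ⊢
    exact h1
  set Z : ℝ := (u:ℝ) ^ (1 - ε / 2) with hZ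
  have hZ0 : 0 < Z := by positivity
  -- each dyadic piece
  have hpiece : ∀ j ∈ Finset.range r,
      ∑ q ∈ P.filter (fun q => 2 ^ j < q ∧ q ≤ 2 * 2 ^ j), |ET g q a u vonMangoldt|
        ≤ (120 * CL * 5 + 7 * D) * R ^ 5 * Z := by
    intro j _
    rcases (P.filter (fun q => 2 ^ j < q ∧ q ≤ 2 * 2 ^ j)).eq_empty_or_nonempty with he | ⟨q0, hq0⟩
    · rw [he, Finset.sum_empty]; positivity
    rw [Finset.mem_filter] at hq0
    have hq0P := hP q0 hq0.1
    have hb := BVdy hg (P.filter (fun q => 2 ^ j < q ∧ q ≤ 2 * 2 ^ j)) (2 ^ j) Nat.one_le_two_pow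
      (fun q hq => by
        rw [Finset.mem_filter] at hq; exact ⟨(hP q hq.1).1, hq.2.1, hq.2.2⟩)
      (fun q hq => (hP q (Finset.mem_filter.mp hq).1).2.2.2.1) a
      (fun q hq => (hP q (Finset.mem_filter.mp hq).1).2.2.2.2) u V hu hV1
    refine hb.trans ?_
    have hQ0 : (0:ℝ) < ((2 ^ j : ℕ) : ℝ) := by positivity
    have hQhi : ((2 ^ j : ℕ) : ℝ) ≤ (u:ℝ) ^ (1/2 - ε) := by
      refine le_trans ?_ hq0P.2.2.1
      exact_mod_cast hq0.2.1.le
    have hQlo : (u:ℝ) ^ (ε / 2) ≤ 2 * ((2 ^ j : ℕ) : ℝ) := by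
      refine hq0P.2.1.le.trans ?_
      exact_mod_cast hq0.2.2
    have t1 : (u:ℝ) / ((2 ^ j : ℕ) : ℝ) ≤ 2 * Z := by
      rw [div_le_iff₀ hQ0]
      have : (u:ℝ) = Z * (u:ℝ) ^ (ε / 2) := by
        rw [hZ, ← Real.rpow_add (by linarith)]; norm_num
      calc (u:ℝ) = Z * (u:ℝ) ^ (ε / 2) := this
        _ ≤ Z * (2 * ((2 ^ j : ℕ) : ℝ)) := by gcongr
        _ = _ := by ring
    have t2 : (u:ℝ) / √V ≤ 2 * Z := by
      have hs0 : 0 < √(V:ℝ) := Real.sqrt_pos.mpr (by exact_mod_cast hV1)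
      rw [div_le_iff₀ hs0]
      have : (u:ℝ) = (u:ℝ) ^ (9/10 : ℝ) * (u:ℝ) ^ (1/10 : ℝ) := by
        rw [← Real.rpow_add (by linarith)]; norm_num
      have h9 : (u:ℝ) ^ (9/10 : ℝ) ≤ Z := Real.rpow_le_rpow_of_exponent_le hu1 (by linarith)
      calc (u:ℝ) = (u:ℝ) ^ (9/10 : ℝ) * (u:ℝ) ^ (1/10 : ℝ) := this
        _ ≤ Z * (2 * √V) := by gcongr
        _ = _ := by ring
    have t3 : √(u:ℝ) * ((2 ^ j : ℕ) : ℝ) ≤ Z := by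
      calc √(u:ℝ) * ((2 ^ j : ℕ) : ℝ) ≤ (u:ℝ) ^ (1/2 : ℝ) * (u:ℝ) ^ (1/2 - ε) := by
            rw [Real.sqrt_eq_rpow]; gcongr
        _ = (u:ℝ) ^ (1/2 + (1/2 - ε)) := by rw [← Real.rpow_add (by linarith)]
        _ ≤ Z := Real.rpow_le_rpow_of_exponent_le hu1 (by linarith)
    have t4 : ((2 ^ j : ℕ) : ℝ) * V ^ 2 ≤ Z := by
      calc ((2 ^ j : ℕ) : ℝ) * V ^ 2 ≤ (u:ℝ) ^ (1/2 - ε) * (u:ℝ) ^ (2/5 : ℝ) := by gcongr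
        _ = (u:ℝ) ^ ((1/2 - ε) + 2/5) := by rw [← Real.rpow_add (by linarith)]
        _ ≤ Z := Real.rpow_le_rpow_of_exponent_le hu1 (by linarith)
    have hR5 : R ≤ R ^ 5 := le_self_pow₀ hR1 (by norm_num)
    calc _ ≤ 120 * CL * R ^ 5 * (2 * Z + 2 * Z + Z) + 7 * D * (Z * R ^ 5) := by
          refine add_le_add ?_ ?_
          · gcongr
          · calc 7 * D * ((2 ^ j : ℕ) : ℝ) * V ^ 2 * R = 7 * D * ((((2 ^ j : ℕ) : ℝ) * V ^ 2) * R) := by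
                  ring
              _ ≤ _ := by gcongr
      _ = _ := by ring
  have hcover : ∑ q ∈ P, |ET g q a u vonMangoldt|
      ≤ ∑ j ∈ Finset.range r, ∑ q ∈ P.filter (fun q => 2 ^ j < q ∧ q ≤ 2 * 2 ^ j),
        |ET g q a u vonMangoldt| := by
    simp_rw [Finset.sum_filter]
    rw [Finset.sum_comm]
    refine Finset.sum_le_sum fun q hq => ?_
    have hqP := hP q hq
    have hq2 := hqP.1.two_le
    set j := Nat.log 2 (q - 1) with hj
    have hj1 : 2 ^ j ≤ q - 1 := Nat.pow_log_le_self 2 (by omega)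
    have hj2 : q - 1 < 2 ^ (j + 1) := Nat.lt_pow_succ_log_self (by norm_num) _
    have hqu : q ≤ u := by
      have : (q:ℝ) ≤ u := by
        refine hqP.2.2.1.trans ?_
        calc (u:ℝ) ^ (1/2 - ε) ≤ (u:ℝ) ^ (1:ℝ) :=
              Real.rpow_le_rpow_of_exponent_le hu1 (by linarith)
          _ = u := Real.rpow_one _
      exact_mod_cast this
    have hjr : j ∈ Finset.range r := by
      rw [Finset.mem_range]
      by_contra h
      have := Nat.pow_le_pow_right (by norm_num : 0 < 2) (not_lt.mp h)
      omega
    refine le_trans ?_ (Finset.single_le_sum (f := fun j => if 2 ^ j < q ∧ q ≤ 2 * 2 ^ j then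
      |ET g q a u vonMangoldt| else 0) (fun _ _ => by split_ifs <;> positivity) hjr)
    rw [if_pos]
    rw [pow_succ] at hj2
    omega
  refine hcover.trans ((Finset.sum_le_sum hpiece).trans ?_)
  rw [Finset.sum_const, Finset.card_range, nsmul_eq_mul]
  have h6 := hCu u hu1
  have hZ2 : (u:ℝ) ^ (ε / 4) * Z = (u:ℝ) ^ (1 - ε / 4) := by
    rw [hZ, ← Real.rpow_add (by linarith)]; congr 1; ring
  calc (r:ℝ) * ((120 * CL * 5 + 7 * D) * R ^ 5 * Z)
      ≤ (2 * R) * ((120 * CL * 5 + 7 * D) * R ^ 5 * Z) := by gcongr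
    _ = 2 * (120 * CL * 5 + 7 * D) * R ^ 6 * Z := by ring
    _ ≤ 2 * (120 * CL * 5 + 7 * D) * (C * (u:ℝ) ^ (ε / 4)) * Z := by gcongr
    _ = _ := by rw [← hZ2]; ring

/-- summation by parts over a block -/
lemma abel_block (c : ℕ → ℝ) (X : ℕ) (hX : 1 ≤ X) (E : ℝ) :
    ∀ Y, X ≤ Y → (∀ u, X ≤ u → u ≤ Y → ∑ n ∈ Finset.Ioc X u, c n ≤ E) →
    ∑ n ∈ Finset.Ioc X Y, c n / n ≤ E / X := by
  intro Y hXY hE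
  have hE0 : 0 ≤ E := by simpa using hE X le_rfl hXY
  have hX0 : (0:ℝ) < X := by exact_mod_cast hX
  have key : ∀ Y, X ≤ Y → ∑ n ∈ Finset.Ioc X Y, c n / n
      = (∑ n ∈ Finset.Ioc X Y, c n) / (Y + 1)
        + ∑ u ∈ Finset.Ioc X Y, (∑ n ∈ Finset.Ioc X u, c n) * (1 / u - 1 / (u + 1)) := by
    intro Y hY
    induction Y, hY using Nat.le_induction with
    | base => simp
    | succ Y hY ih =>
      have hY0 : (0:ℝ) < Y := by
        have : (X:ℝ) ≤ Y := by exact_mod_cast hY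
        linarith
      rw [Finset.sum_Ioc_succ_top hY, ih, Finset.sum_Ioc_succ_top hY, Finset.sum_Ioc_succ_top hY,
        Finset.sum_Ioc_succ_top hY]
      push_cast
      field_simp
      ring
  have tel : ∀ Y, X ≤ Y → ∑ u ∈ Finset.Ioc X Y, ((1:ℝ) / u - 1 / (u + 1)) = 1 / (X + 1) - 1 / (Y + 1) := by
    intro Y hY
    induction Y, hY using Nat.le_induction with
    | base => simp
    | succ Y hY ih => rw [Finset.sum_Ioc_succ_top hY, ih]; push_cast; ring
  rw [key Y hXY]
  have h1 : ∑ u ∈ Finset.Ioc X Y, (∑ n ∈ Finset.Ioc X u, c n) * ((1:ℝ) / u - 1 / (u + 1))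
      ≤ E * (1 / (X + 1) - 1 / (Y + 1)) := by
    rw [← tel Y hXY, Finset.mul_sum]
    refine Finset.sum_le_sum fun u hu => ?_
    rw [Finset.mem_Ioc] at hu
    refine mul_le_mul_of_nonneg_right (hE u hu.1.le hu.2) ?_
    have hu0 : (0:ℝ) < u := by exact_mod_cast (by omega : 0 < u)
    rw [sub_nonneg]
    exact one_div_le_one_div_of_le hu0 (by linarith)
  have h2 : (∑ n ∈ Finset.Ioc X Y, c n) / ((Y:ℝ) + 1) ≤ E / (Y + 1) :=
    div_le_div_of_nonneg_right (hE Y hXY le_rfl) (by positivity)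
  calc _ ≤ E / (Y + 1) + E * (1 / (X + 1) - 1 / (Y + 1)) := add_le_add h2 h1
    _ = E / (X + 1) := by ring
    _ ≤ E / X := div_le_div_of_nonneg_left hE0 hX0 (by linarith)

end FI

namespace FI
open ArithmeticFunction

/-- the constant in Mertens' estimate -/
noncomputable def C0 : ℝ := Real.log 4 + 5

lemma C0_pos : 0 < C0 := by unfold C0; have := Real.log_nonneg (by norm_num : (1:ℝ) ≤ 4); linarith

lemma psi_nat (x : ℕ) : ∑ n ∈ Finset.Ioc 0 x, vonMangoldt n ≤ (Real.log 4 + 4) * x := by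
  have := Chebyshev.psi_le_const_mul_self (x := x) (by positivity)
  unfold Chebyshev.psi at this
  simpa using this

lemma log_fact_eq (x : ℕ) : Real.log x.factorial
    = ∑ d ∈ Finset.Ioc 0 x, vonMangoldt d * ((x / d : ℕ) : ℝ) := by
  rw [← ArithmeticFunction.sum_Ioc_mul_zeta_eq_sum, vonMangoldt_mul_zeta]
  induction x with
  | zero => simp
  | succ x ih =>
    rw [Finset.sum_Ioc_succ_top (Nat.zero_le x), ← ih, Nat.factorial_succ]
    push_cast
    rw [Real.log_mul (by positivity) (by positivity), ArithmeticFunction.log_apply]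
    push_cast; ring

lemma mertens_lower (x : ℕ) (hx : 1 ≤ x) :
    Real.log x - 1 ≤ ∑ n ∈ Finset.Ioc 0 x, vonMangoldt n / n := by
  have hx0 : (0:ℝ) < x := by exact_mod_cast hx
  have h1 : Real.log x.factorial ≤ x * ∑ n ∈ Finset.Ioc 0 x, vonMangoldt n / n := by
    rw [log_fact_eq, Finset.mul_sum]
    refine Finset.sum_le_sum fun d _ => ?_
    calc vonMangoldt d * ((x / d : ℕ) : ℝ) ≤ vonMangoldt d * ((x:ℝ) / d) :=
          mul_le_mul_of_nonneg_left Nat.cast_div_le (vonM_nonneg d)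
      _ = _ := by ring
  have h2 : x * Real.log x - x ≤ Real.log x.factorial := by
    have := Real.pow_div_factorial_le_exp (x := x) hx0.le x
    have hf : (0:ℝ) < x.factorial := by positivity
    have h3 := Real.log_le_log (by positivity) this
    rw [Real.log_exp, Real.log_div (by positivity) hf.ne', Real.log_pow] at h3
    linarith
  have h3 : (x:ℝ) * (Real.log x - 1) ≤ x * ∑ n ∈ Finset.Ioc 0 x, vonMangoldt n / n := by linarith
  exact le_of_mul_le_mul_left h3 hx0

lemma mertens_upper (x : ℕ) (hx : 1 ≤ x) :
    ∑ n ∈ Finset.Ioc 0 x, vonMangoldt n / n ≤ Real.log x + (Real.log 4 + 4) := by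
  have hx0 : (0:ℝ) < x := by exact_mod_cast hx
  have h1 : x * ∑ n ∈ Finset.Ioc 0 x, vonMangoldt n / n
      ≤ Real.log x.factorial + ∑ n ∈ Finset.Ioc 0 x, vonMangoldt n := by
    rw [log_fact_eq, Finset.mul_sum, ← Finset.sum_add_distrib]
    refine Finset.sum_le_sum fun d hd => ?_
    rw [Finset.mem_Ioc] at hd
    have hd0 : (0:ℝ) < d := by exact_mod_cast hd.1
    have h : (x:ℝ) / d ≤ ((x / d : ℕ) : ℝ) + 1 := by
      rw [div_le_iff₀ hd0]
      have := Nat.lt_div_mul_add (a := x) hd.1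
      have : (x:ℝ) ≤ (x / d : ℕ) * d + d := by exact_mod_cast this.le
      linarith
    calc (x:ℝ) * (vonMangoldt d / d) = vonMangoldt d * ((x:ℝ) / d) := by ring
      _ ≤ vonMangoldt d * (((x / d : ℕ) : ℝ) + 1) := mul_le_mul_of_nonneg_left h (vonM_nonneg d)
      _ = _ := by ring
  have h2 : Real.log x.factorial ≤ x * Real.log x := by
    rw [← Real.log_pow]
    refine Real.log_le_log (by positivity) ?_
    exact_mod_cast Nat.factorial_le_pow x
  have h3 := psi_nat x
  have h4 : (x:ℝ) * ∑ n ∈ Finset.Ioc 0 x, vonMangoldt n / n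
      ≤ x * (Real.log x + (Real.log 4 + 4)) := by linarith
  exact le_of_mul_le_mul_left h4 hx0

lemma mertens_block (A B : ℕ) (hA : 1 ≤ A) (hAB : A ≤ B) :
    ∑ n ∈ Finset.Ioc A B, vonMangoldt n / n ≤ Real.log B - Real.log A + C0 := by
  have h := Finset.sum_Ioc_consecutive (fun n => vonMangoldt n / (n:ℝ)) (Nat.zero_le A) hAB
  have h1 := mertens_upper B (hA.trans hAB)
  have h2 := mertens_lower A hA
  unfold C0; linarith

/-- Mertens with real exponents; primes only. -/
lemma mertens_rpow (X : ℕ) (hX : 2 ≤ X) (α β : ℝ) (hα : 0 ≤ α) (hαβ : α ≤ β) (P : Finset ℕ)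
    (hP : ∀ q ∈ P, q.Prime ∧ (X:ℝ) ^ α < q ∧ (q:ℝ) ≤ (X:ℝ) ^ β) :
    ∑ q ∈ P, Real.log q / q ≤ (β - α) * Real.log X + (C0 + 1) := by
  have hX1 : (1:ℝ) ≤ X := by exact_mod_cast (by omega : 1 ≤ X)
  have hA1 : 1 ≤ (X:ℝ) ^ α := Real.one_le_rpow hX1 hα
  have hAB : (X:ℝ) ^ α ≤ (X:ℝ) ^ β := Real.rpow_le_rpow_of_exponent_le hX1 hαβ
  set A := ⌊(X:ℝ) ^ α⌋₊ with hA
  set B := ⌊(X:ℝ) ^ β⌋₊ with hB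
  have hA' : 1 ≤ A := Nat.le_floor (by simpa using hA1)
  have hA0 : (1:ℝ) ≤ A := by exact_mod_cast hA'
  have h1 := mertens_block A B hA' (Nat.floor_le_floor hAB)
  have hBl : Real.log B ≤ β * Real.log X := by
    rw [← Real.log_rpow (by linarith)]
    have hB1 : 1 ≤ B := Nat.le_floor (by simpa using hA1.trans hAB)
    exact Real.log_le_log (by exact_mod_cast hB1) (Nat.floor_le (by positivity))
  have hAl : α * Real.log X - 1 ≤ Real.log A := by
    rw [← Real.log_rpow (by linarith)]
    have h2 : (X:ℝ) ^ α ≤ 2 * A := by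
      have := Nat.lt_floor_add_one ((X:ℝ) ^ α)
      rw [← hA] at this; linarith
    have h3 := Real.log_le_log (by linarith) h2
    rw [Real.log_mul (by norm_num) (by linarith)] at h3
    have := Real.log_two_lt_d9
    linarith
  have h2 : ∑ q ∈ P, Real.log q / q ≤ ∑ n ∈ Finset.Ioc A B, vonMangoldt n / n := by
    calc ∑ q ∈ P, Real.log q / q = ∑ q ∈ P, vonMangoldt q / q := by
          refine Finset.sum_congr rfl fun q hq => ?_
          rw [vonMangoldt_apply_prime (hP q hq).1]
      _ ≤ _ := by
          refine Finset.sum_le_sum_of_subset_of_nonneg ?_ (fun n _ _ => ?_)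
          · intro q hq
            rw [Finset.mem_Ioc]
            exact ⟨Nat.floor_lt (by positivity) |>.mpr (hP q hq).2.1, Nat.le_floor (hP q hq).2.2⟩
          · exact div_nonneg (vonM_nonneg n) (by positivity)
  linarith

/-- tail of the proper prime powers -/
lemma summable_nonprime : Summable fun n : ℕ => (if n.Prime then 0 else vonMangoldt n) / (n:ℝ) := by
  have := vonMangoldt.summable_residueClass_non_primes_div (q := 1) (a := 1)
  refine this.congr fun n => ?_
  congr 1
  split_ifs
  · rfl
  · unfold vonMangoldt.residueClass
    rw [Set.indicator_of_mem]
    exact Subsingleton.elim _ _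

lemma euler_fin (s : Finset ℕ) (F : Finset ℕ)
    (hF : ∀ n ∈ F, n ≠ 0 ∧ n.primeFactors ⊆ s) :
    ∑ n ∈ F, (1:ℝ) / n ≤ ∏ p ∈ s with p.Prime, (1 - 1 / (p:ℝ))⁻¹ := by
  let f : ℕ →* ℝ := ⟨⟨fun n => 1 / (n:ℝ), by simp⟩, by intro m n; simp [mul_comm]⟩
  have h := EulerProduct.summable_and_hasSum_factoredNumbers_prod_filter_prime_geometric (f := f)
    (by
      intro p hp
      have : (1:ℝ) < p := by exact_mod_cast hp.one_lt
      show ‖1 / (p:ℝ)‖ < 1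
      rw [Real.norm_of_nonneg (by positivity), div_lt_one (by linarith)]; exact this) s
  have h2 := h.2
  have hmem : ∀ n ∈ F, n ∈ Nat.factoredNumbers s := by
    intro n hn
    rw [Nat.mem_factoredNumbers_iff_primeFactors_subset]
    exact hF n hn
  have h3 := sum_le_hasSum (F.attach.map ⟨fun n => (⟨n.1, hmem n.1 n.2⟩ : Nat.factoredNumbers s), by
    intro a b hab; exact Subtype.ext (congrArg (fun t : Nat.factoredNumbers s => t.1) hab)⟩) (fun m _ => by
      show 0 ≤ 1 / ((m:ℕ):ℝ); positivity) h2
  rw [Finset.sum_map] at h3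
  refine le_trans (le_of_eq ?_) h3
  rw [← Finset.sum_attach]
  rfl

end FI

namespace FI
open ArithmeticFunction

/-- support of the Selberg weights -/
def ST (q z : ℕ) : Finset ℕ := (Finset.Ioc 0 z).filter (fun m => Squarefree m ∧ ¬ q ∣ m)

lemma mem_ST {q z m : ℕ} : m ∈ ST q z ↔ (0 < m ∧ m ≤ z) ∧ Squarefree m ∧ ¬ q ∣ m := by
  simp [ST]

noncomputable def SG (q z : ℕ) : ℝ := ∑ m ∈ ST q z, 1 / (Nat.totient m : ℝ)

lemma one_mem_ST {q z : ℕ} (hq : q.Prime) (hz : 1 ≤ z) : 1 ∈ ST q z := by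
  rw [mem_ST]; exact ⟨⟨one_pos, hz⟩, squarefree_one, hq.not_dvd_one⟩

lemma tot_pos {q z m : ℕ} (hm : m ∈ ST q z) : (0:ℝ) < (Nat.totient m : ℝ) := by
  exact_mod_cast Nat.totient_pos.mpr (mem_ST.mp hm).1.1

lemma SG_pos {q z : ℕ} (hq : q.Prime) (hz : 1 ≤ z) : 0 < SG q z := by
  unfold SG
  exact Finset.sum_pos (fun m hm => by have := tot_pos hm; positivity) ⟨1, one_mem_ST hq hz⟩

/-- sum over all squarefree -/
lemma sqf_sum_ge (z : ℕ) : ∑ n ∈ Finset.Ioc 0 z, (1:ℝ) / n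
    ≤ ∑ m ∈ (Finset.Ioc 0 z).filter Squarefree, 1 / (Nat.totient m : ℝ) := by
  classical
  -- radical
  have hmap : ∀ n ∈ Finset.Ioc 0 z, (∏ p ∈ n.primeFactors, p) ∈ (Finset.Ioc 0 z).filter Squarefree := by
    intro n hn
    rw [Finset.mem_Ioc] at hn
    rw [Finset.mem_filter, Finset.mem_Ioc]
    refine ⟨⟨Finset.prod_pos fun p hp => (Nat.prime_of_mem_primeFactors hp).pos,
      (Nat.le_of_dvd hn.1 (Nat.prod_primeFactors_dvd n)).trans hn.2⟩, ?_⟩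
    refine Finset.squarefree_prod_of_pairwise_isCoprime ?_ ?_
    · intro p hp p' hp' hne
      exact Nat.coprime_iff_isRelPrime.mp ((Nat.coprime_primes (Nat.prime_of_mem_primeFactors hp)
        (Nat.prime_of_mem_primeFactors hp')).mpr hne)
    · intro p hp; exact (Nat.prime_of_mem_primeFactors hp).squarefree
  rw [← Finset.sum_fiberwise_of_maps_to hmap]
  refine Finset.sum_le_sum fun m hm => ?_
  rw [Finset.mem_filter, Finset.mem_Ioc] at hm
  have hm0 : (0:ℝ) < m := by exact_mod_cast hm.1.1
  set F := (Finset.Ioc 0 z).filter (fun n => (∏ p ∈ n.primeFactors, p) = m) with hF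
  have hFd : ∀ n ∈ F, m ∣ n := by
    intro n hn; rw [hF, Finset.mem_filter] at hn
    rw [← hn.2]; exact Nat.prod_primeFactors_dvd n
  have hFp : ∀ n ∈ F, n.primeFactors = m.primeFactors := by
    intro n hn; rw [hF, Finset.mem_filter] at hn
    rw [← hn.2, Nat.primeFactors_prod (fun p hp => Nat.prime_of_mem_primeFactors hp)]
  have e := euler_fin m.primeFactors (F.image (fun n => n / m)) (by
    intro t ht
    rw [Finset.mem_image] at ht
    obtain ⟨n, hn, rfl⟩ := ht
    have hn0 : 0 < n := (Finset.mem_Ioc.mp (Finset.mem_filter.mp hn).1).1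
    have hd := hFd n hn
    refine ⟨(Nat.div_pos (Nat.le_of_dvd hn0 hd) hm.1.1).ne', ?_⟩
    rw [← hFp n hn]
    exact Nat.primeFactors_mono (Nat.div_dvd_of_dvd hd) hn0.ne')
  rw [Finset.sum_image (by
    intro a ha b hb hab
    have h1 := Nat.div_mul_cancel (hFd a ha)
    have h2 := Nat.div_mul_cancel (hFd b hb)
    simp only at hab
    rw [← h1, ← h2, hab])] at e
  have hprod : ∏ p ∈ m.primeFactors with p.Prime, (1 - 1 / (p:ℝ))⁻¹ = m / (Nat.totient m : ℝ) := by
    rw [Finset.filter_true_of_mem (fun p hp => Nat.prime_of_mem_primeFactors hp)]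
    have h1 := Nat.totient_eq_mul_prod_factors m
    have h2 : (Nat.totient m : ℝ) = m * ∏ p ∈ m.primeFactors, (1 - (p:ℝ)⁻¹) := by
      have := congrArg (fun t : ℚ => (t : ℝ)) h1
      push_cast at this
      exact this
    have h3 : ∏ p ∈ m.primeFactors, (1 - (p:ℝ)⁻¹) ≠ 0 := by
      rw [Finset.prod_ne_zero_iff]
      intro p hp
      have : (1:ℝ) < p := by exact_mod_cast (Nat.prime_of_mem_primeFactors hp).one_lt
      have := inv_lt_one_of_one_lt₀ this
      linarith
    rw [h2, Finset.prod_inv_distrib]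
    simp only [one_div]
    field_simp
  rw [hprod] at e
  calc ∑ n ∈ F, (1:ℝ) / n = (1 / m) * ∑ n ∈ F, (1:ℝ) / ((n / m : ℕ) : ℝ) := by
        rw [Finset.mul_sum]
        refine Finset.sum_congr rfl fun n hn => ?_
        rw [one_div_mul_one_div]
        congr 1
        rw [mul_comm]
        exact_mod_cast (Nat.div_mul_cancel (hFd n hn)).symm
    _ ≤ (1 / m) * (m / (Nat.totient m : ℝ)) := mul_le_mul_of_nonneg_left e (by positivity)
    _ = _ := by field_simp

lemma SG_ge {q z : ℕ} (hq : q.Prime) (hz : 1 ≤ z) :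
    Real.log z ≤ SG q z * (1 + 1 / ((q:ℝ) - 1)) := by
  have hq1 : 0 < (q:ℝ) - 1 := by
    have : (1:ℝ) < q := by exact_mod_cast hq.one_lt
    linarith
  have h1 : Real.log z ≤ ∑ n ∈ Finset.Ioc 0 z, (1:ℝ) / n := by
    have := log_add_one_le_harmonic z
    rw [harmonic_eq_sum_Icc] at this
    push_cast at this
    have e : Finset.Ioc 0 z = Finset.Icc 1 z := by
      ext k; simp only [Finset.mem_Ioc, Finset.mem_Icc]; omega
    rw [e]; simp only [one_div]
    refine le_trans (Real.log_le_log (by exact_mod_cast hz) (by linarith)) this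
  refine h1.trans ((sqf_sum_ge z).trans ?_)
  rw [← Finset.sum_filter_add_sum_filter_not _ (fun m => ¬ q ∣ m)]
  rw [Finset.filter_filter, Finset.filter_filter, mul_add, mul_one]
  refine add_le_add le_rfl ?_
  rw [mul_one_div, SG, Finset.sum_div]
  simp only [not_not]
  have hinj : ∀ m ∈ (Finset.Ioc 0 z).filter (fun m => Squarefree m ∧ q ∣ m), m / q ∈ ST q z := by
    intro m hm
    simp only [Finset.mem_filter, Finset.mem_Ioc] at hm
    obtain ⟨⟨h0, hmz⟩, hs, k, rfl⟩ := hm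
    rw [Nat.mul_div_cancel_left _ hq.pos, mem_ST]
    refine ⟨⟨Nat.pos_of_mul_pos_left h0, ?_⟩, hs.of_mul_right, ?_⟩
    · exact (Nat.le_mul_of_pos_left k hq.pos).trans hmz
    · have := (Nat.squarefree_mul_iff.mp hs).1
      exact (Nat.Prime.coprime_iff_not_dvd hq).mp this
  have : ∀ m ∈ (Finset.Ioc 0 z).filter (fun m => Squarefree m ∧ q ∣ m),
      1 / (Nat.totient m : ℝ) = 1 / (Nat.totient (m / q) : ℝ) / ((q:ℝ) - 1) := by
    intro m hm
    simp only [Finset.mem_filter, Finset.mem_Ioc] at hm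
    obtain ⟨⟨h0, hmz⟩, hs, k, rfl⟩ := hm
    rw [Nat.mul_div_cancel_left _ hq.pos, Nat.totient_mul (Nat.squarefree_mul_iff.mp hs).1,
      Nat.totient_prime hq]
    push_cast [Nat.cast_sub hq.one_le]
    rw [div_div, mul_comm]
  rw [Finset.sum_congr rfl this]
  rw [← Finset.sum_image (f := fun k => 1 / (Nat.totient k : ℝ) / ((q:ℝ) - 1)) (g := fun m => m / q)]
  · refine Finset.sum_le_sum_of_subset_of_nonneg ?_ (fun m hm _ => by have := tot_pos hm; positivity)
    intro k hk
    rw [Finset.mem_image] at hk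
    obtain ⟨m, hm, rfl⟩ := hk
    exact hinj m hm
  · intro a ha b hb hab
    simp only [Finset.coe_filter, Set.mem_ofPred_eq] at ha hb
    simp only at hab
    rw [← Nat.div_mul_cancel ha.2.2, ← Nat.div_mul_cancel hb.2.2, hab]

end FI

namespace FI
open ArithmeticFunction

lemma ST_dvd {q z d m : ℕ} (hm : m ∈ ST q z) (hd : d ∣ m) : d ∈ ST q z := by
  rw [mem_ST] at *
  refine ⟨⟨Nat.pos_of_dvd_of_pos hd hm.1.1, (Nat.le_of_dvd hm.1.1 hd).trans hm.1.2⟩,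
    hm.2.1.squarefree_of_dvd hd, fun h => hm.2.2 (h.trans hd)⟩

/-- Selberg weights -/
noncomputable def lam (q z d : ℕ) : ℝ :=
  d * muR d * ∑ m ∈ (ST q z).filter (fun m => d ∣ m), 1 / ((Nat.totient m : ℝ) * SG q z)

lemma lam_one {q z : ℕ} (hq : q.Prime) (hz : 1 ≤ z) : lam q z 1 = 1 := by
  have hG := SG_pos hq hz
  have : ∑ m ∈ ST q z, 1 / ((Nat.totient m : ℝ) * SG q z) = 1 := by
    have : ∀ m ∈ ST q z, 1 / ((Nat.totient m : ℝ) * SG q z)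
        = (1 / (Nat.totient m : ℝ)) * (1 / SG q z) := by
      intro m _; rw [one_div_mul_one_div]
    rw [Finset.sum_congr rfl this, ← Finset.sum_mul]
    change SG q z * (1 / SG q z) = 1
    field_simp
  simp [lam, muR]
  simpa using this

lemma mu_interval {l m : ℕ} (hm : Squarefree m) (hl : l ∣ m) :
    ∑ d ∈ m.divisors.filter (fun d => l ∣ d), muR d = if m = l then muR l else 0 := by
  obtain ⟨k, rfl⟩ := hl
  have hm0 := hm.ne_zero
  have hl0 : l ≠ 0 := left_ne_zero_of_mul hm0
  have hk0 : k ≠ 0 := right_ne_zero_of_mul hm0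
  have hcop : Nat.Coprime l k := (Nat.squarefree_mul_iff.mp hm).1
  have e : (l * k).divisors.filter (fun d => l ∣ d) = k.divisors.image (fun e => l * e) := by
    ext d
    simp only [Finset.mem_filter, Nat.mem_divisors, Finset.mem_image]
    constructor
    · rintro ⟨⟨h1, h2⟩, e, rfl⟩
      exact ⟨e, ⟨Nat.dvd_of_mul_dvd_mul_left (Nat.pos_of_ne_zero hl0) h1, hk0⟩, rfl⟩
    · rintro ⟨e, ⟨h1, h2⟩, rfl⟩
      exact ⟨⟨Nat.mul_dvd_mul_left l h1, hm0⟩, Dvd.intro e rfl⟩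
  rw [e, Finset.sum_image (by
    intro a _ b _ hab
    exact Nat.eq_of_mul_eq_mul_left (Nat.pos_of_ne_zero hl0) hab)]
  have h1 : ∀ e ∈ k.divisors, muR (l * e) = muR l * muR e := by
    intro e he
    have := isMultiplicative_moebius.map_mul_of_coprime
      (Nat.Coprime.coprime_dvd_right (Nat.dvd_of_mem_divisors he) hcop)
    simp [muR, this]
  rw [Finset.sum_congr rfl h1, ← Finset.mul_sum]
  have h2 : ∑ e ∈ k.divisors, muR e = if k = 1 then 1 else 0 := by
    have h := congrArg (fun f : ArithmeticFunction ℤ => f k) moebius_mul_coe_zeta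
    simp only [coe_mul_zeta_apply, ArithmeticFunction.one_apply] at h
    have h' := congrArg (fun t : ℤ => (t : ℝ)) h
    simp only [muR]
    push_cast at h' 
    simpa using h'
  rw [h2]
  have h3 : (l * k = l) ↔ k = 1 := by
    constructor
    · intro h; exact Nat.eq_of_mul_eq_mul_left (Nat.pos_of_ne_zero hl0) (by rw [h, mul_one])
    · rintro rfl; simp
  simp [h3]

lemma lam_div_sum {q z l : ℕ} (hl : l ∈ ST q z) :
    ∑ d ∈ (ST q z).filter (fun d => l ∣ d), lam q z d / d
      = muR l * (1 / ((Nat.totient l : ℝ) * SG q z)) := by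
  have h1 : ∀ d ∈ (ST q z).filter (fun d => l ∣ d), lam q z d / d
      = ∑ m ∈ ST q z, if d ∣ m then muR d * (1 / ((Nat.totient m : ℝ) * SG q z)) else 0 := by
    intro d hd
    have hd0 : (d:ℝ) ≠ 0 := by
      have := (mem_ST.mp (Finset.mem_filter.mp hd).1).1.1
      exact_mod_cast this.ne'
    rw [lam, ← Finset.sum_filter, ← Finset.mul_sum, mul_assoc, mul_div_cancel_left₀ _ hd0]
  rw [Finset.sum_congr rfl h1, Finset.sum_comm]
  have h2 : ∀ m ∈ ST q z, (∑ d ∈ (ST q z).filter (fun d => l ∣ d),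
      if d ∣ m then muR d * (1 / ((Nat.totient m : ℝ) * SG q z)) else 0)
      = if m = l then muR l * (1 / ((Nat.totient l : ℝ) * SG q z)) else 0 := by
    intro m hm
    rw [← Finset.sum_filter, ← Finset.sum_mul, Finset.filter_filter]
    have e : (ST q z).filter (fun d => l ∣ d ∧ d ∣ m) = m.divisors.filter (fun d => l ∣ d) := by
      ext d
      simp only [Finset.mem_filter, Nat.mem_divisors]
      constructor
      · rintro ⟨h, h1, h2⟩; exact ⟨⟨h2, (mem_ST.mp hm).1.1.ne'⟩, h1⟩
      · rintro ⟨⟨h, _⟩, h1⟩; exact ⟨ST_dvd hm h, h1, h⟩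
    rw [e]
    by_cases hlm : l ∣ m
    · rw [mu_interval (mem_ST.mp hm).2.1 hlm]
      by_cases h : m = l
      · simp [h]
      · simp [h]
    · have : m ≠ l := by rintro rfl; exact hlm dvd_rfl
      rw [if_neg this, Finset.filter_false_of_mem]
      · simp
      · intro d hd h
        exact hlm (h.trans (Nat.dvd_of_mem_divisors hd))
  rw [Finset.sum_congr rfl h2, Finset.sum_ite_eq' , if_pos hl]

lemma muR_sq {n : ℕ} (h : Squarefree n) : muR n ^ 2 = 1 := by
  have := moebius_sq_eq_one_of_squarefree h
  have h : ((moebius n ^ 2 : ℤ) : ℝ) = 1 := by exact_mod_cast this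
  simp only [muR]
  simpa using h

lemma tau_tot (n : ℕ) (hn : 0 < n) : (n:ℝ) ≤ n.divisors.card * (Nat.totient n : ℝ) := by
  have h := Nat.sum_totient n
  have : n ≤ n.divisors.card * Nat.totient n := by
    calc n = ∑ d ∈ n.divisors, Nat.totient d := h.symm
      _ ≤ ∑ d ∈ n.divisors, Nat.totient n := Finset.sum_le_sum fun d hd =>
          Nat.le_of_dvd (Nat.totient_pos.mpr hn) (Nat.totient_dvd_of_dvd (Nat.dvd_of_mem_divisors hd))
      _ = _ := by simp
  exact_mod_cast this

lemma lam_abs {q z d : ℕ} (hq : q.Prime) (hz : 1 ≤ z) (hd : d ∈ ST q z) :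
    |lam q z d| ≤ d.divisors.card := by
  have hG := SG_pos hq hz
  have hφ := tot_pos hd
  have hd0 := (mem_ST.mp hd).1.1
  have hd0' : (0:ℝ) < d := by exact_mod_cast hd0
  have key : ∑ m ∈ (ST q z).filter (fun m => d ∣ m), 1 / ((Nat.totient m : ℝ) * SG q z)
      ≤ 1 / (Nat.totient d : ℝ) := by
    have h1 : ∀ m ∈ (ST q z).filter (fun m => d ∣ m), 1 / ((Nat.totient m : ℝ) * SG q z)
        = (1 / ((Nat.totient d : ℝ) * SG q z)) * (1 / (Nat.totient (m / d) : ℝ)) := by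
      intro m hm
      rw [Finset.mem_filter] at hm
      obtain ⟨hm, k, rfl⟩ := hm
      rw [Nat.mul_div_cancel_left _ hd0,
        Nat.totient_mul (Nat.squarefree_mul_iff.mp (mem_ST.mp hm).2.1).1, one_div_mul_one_div]
      push_cast
      congr 1; ring
    rw [Finset.sum_congr rfl h1, ← Finset.mul_sum]
    have h2 : ∑ m ∈ (ST q z).filter (fun m => d ∣ m), 1 / (Nat.totient (m / d) : ℝ) ≤ SG q z := by
      rw [← Finset.sum_image (f := fun k => 1 / (Nat.totient k : ℝ)) (g := fun m => m / d)]
      · refine Finset.sum_le_sum_of_subset_of_nonneg ?_ (fun m hm _ => by have := tot_pos hm; positivity)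
        intro k hk
        rw [Finset.mem_image] at hk
        obtain ⟨m, hm, rfl⟩ := hk
        rw [Finset.mem_filter] at hm
        exact ST_dvd hm.1 (Nat.div_dvd_of_dvd hm.2)
      · intro a ha b hb hab
        simp only [Finset.coe_filter, Set.mem_ofPred_eq] at ha hb
        simp only at hab
        rw [← Nat.div_mul_cancel ha.2, ← Nat.div_mul_cancel hb.2, hab]
    calc _ ≤ (1 / ((Nat.totient d : ℝ) * SG q z)) * SG q z :=
          mul_le_mul_of_nonneg_left h2 (by positivity)
      _ = _ := by field_simp
  have key0 : 0 ≤ ∑ m ∈ (ST q z).filter (fun m => d ∣ m), 1 / ((Nat.totient m : ℝ) * SG q z) :=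
    Finset.sum_nonneg fun m hm => by positivity
  rw [lam, abs_mul, abs_mul, abs_of_nonneg key0, abs_of_pos hd0']
  calc _ ≤ d * 1 * (1 / (Nat.totient d : ℝ)) := by
        have := muR_abs d
        gcongr
    _ ≤ _ := by
        rw [mul_one, mul_one_div, div_le_iff₀ hφ]
        exact tau_tot d hd0

lemma lam_abs_sum {q z : ℕ} (hq : q.Prime) (hz : 1 ≤ z) :
    ∑ d ∈ ST q z, |lam q z d| ≤ z * (1 + Real.log z) := by
  refine le_trans (Finset.sum_le_sum fun d hd => lam_abs hq hz hd) ?_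
  refine le_trans (Finset.sum_le_sum_of_subset_of_nonneg (Finset.filter_subset _ _)
    (fun _ _ _ => by positivity)) (tau_sum z)

lemma lam_quad {q z : ℕ} (hq : q.Prime) (hz : 1 ≤ z) :
    ∑ d ∈ ST q z, ∑ e ∈ ST q z, lam q z d * lam q z e / (Nat.lcm d e : ℝ) = 1 / SG q z := by
  have hG := SG_pos hq hz
  have h1 : ∀ d ∈ ST q z, ∀ e ∈ ST q z, lam q z d * lam q z e / (Nat.lcm d e : ℝ)
      = ∑ l ∈ ST q z, (Nat.totient l : ℝ) * ((if l ∣ d then lam q z d / d else 0)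
        * (if l ∣ e then lam q z e / e else 0)) := by
    intro d hd e he
    have hd0 : d ≠ 0 := (mem_ST.mp hd).1.1.ne'
    have he0 : e ≠ 0 := (mem_ST.mp he).1.1.ne'
    have hd0' : (d:ℝ) ≠ 0 := by exact_mod_cast hd0
    have he0' : (e:ℝ) ≠ 0 := by exact_mod_cast he0
    have hl0 : (Nat.lcm d e : ℝ) ≠ 0 := by exact_mod_cast Nat.lcm_ne_zero hd0 he0
    have h2 : (Nat.gcd d e : ℝ) * (Nat.lcm d e : ℝ) = d * e := by
      exact_mod_cast Nat.gcd_mul_lcm d e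
    have h3 : (Nat.gcd d e : ℝ) = ∑ l ∈ ST q z, if l ∣ d ∧ l ∣ e then (Nat.totient l : ℝ) else 0 := by
      rw [← Finset.sum_filter]
      have e1 : (ST q z).filter (fun l => l ∣ d ∧ l ∣ e) = (Nat.gcd d e).divisors := by
        ext l
        simp only [Finset.mem_filter, Nat.mem_divisors, Nat.dvd_gcd_iff]
        constructor
        · rintro ⟨_, h⟩; exact ⟨h, Nat.gcd_ne_zero_left hd0⟩
        · rintro ⟨h, _⟩; exact ⟨ST_dvd hd h.1, h⟩
      rw [e1]
      exact_mod_cast (Nat.sum_totient (Nat.gcd d e)).symm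
    have h4 : lam q z d * lam q z e / (Nat.lcm d e : ℝ)
        = (Nat.gcd d e : ℝ) * (lam q z d / d * (lam q z e / e)) := by
      field_simp
      linear_combination (-(lam q z d * lam q z e)) * h2
    rw [h4, h3, Finset.sum_mul]
    refine Finset.sum_congr rfl fun l _ => ?_
    by_cases ha : l ∣ d <;> by_cases hb : l ∣ e <;> simp [ha, hb]
  rw [Finset.sum_congr rfl fun d hd => Finset.sum_congr rfl (h1 d hd)]
  have h2 : ∑ d ∈ ST q z, ∑ e ∈ ST q z, ∑ l ∈ ST q z, (Nat.totient l : ℝ) *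
      ((if l ∣ d then lam q z d / d else 0) * (if l ∣ e then lam q z e / e else 0))
      = ∑ l ∈ ST q z, (Nat.totient l : ℝ) * (∑ d ∈ ST q z, if l ∣ d then lam q z d / d else 0) ^ 2 := by
    rw [Finset.sum_congr rfl fun d _ => Finset.sum_comm, Finset.sum_comm]
    refine Finset.sum_congr rfl fun l _ => ?_
    rw [sq, Finset.sum_mul_sum, Finset.mul_sum]
    refine Finset.sum_congr rfl fun d _ => ?_
    rw [Finset.mul_sum]
  rw [h2]
  have h3 : ∀ l ∈ ST q z, (Nat.totient l : ℝ) *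
      (∑ d ∈ ST q z, if l ∣ d then lam q z d / d else 0) ^ 2
      = (1 / (Nat.totient l : ℝ)) * (1 / SG q z ^ 2) := by
    intro l hl
    rw [← Finset.sum_filter, lam_div_sum hl, mul_pow, muR_sq (mem_ST.mp hl).2.1]
    have := tot_pos hl
    field_simp
  rw [Finset.sum_congr rfl h3, ← Finset.sum_mul]
  change SG q z * _ = _
  field_simp

theorem selberg {q z : ℕ} (hq : q.Prime) (hz : 2 ≤ z) (S : Finset ℕ) (v : ℕ → ℝ)
    (hv : ∀ n, 0 ≤ v n) (V R : ℝ) (hV : 0 ≤ V) (hR : 0 ≤ R)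
    (h : ∀ d, 1 ≤ d → d ≤ z ^ 2 → ¬ q ∣ d →
      |∑ n ∈ S.filter (fun n => d ∣ n), v n - V / d| ≤ R) :
    ∑ n ∈ S.filter (fun n => n.Prime ∧ z < n), v n
      ≤ V * (1 + 1 / ((q:ℝ) - 1)) / Real.log z + R * (z * (1 + Real.log z)) ^ 2 := by
  have hz1 : 1 ≤ z := by omega
  have hlog : 0 < Real.log z := Real.log_pos (by exact_mod_cast hz)
  have hG := SG_pos hq hz1
  set T := ST q z with hT
  have s1 : ∑ n ∈ S.filter (fun n => n.Prime ∧ z < n), v n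
      ≤ ∑ n ∈ S, v n * (∑ d ∈ T, if d ∣ n then lam q z d else 0) ^ 2 := by
    refine le_trans (Finset.sum_le_sum (g := fun n => v n * (∑ d ∈ T, if d ∣ n then lam q z d else 0) ^ 2) fun n hn => ?_)
      (Finset.sum_le_sum_of_subset_of_nonneg (Finset.filter_subset _ _)
        (fun n _ _ => mul_nonneg (hv n) (sq_nonneg _)))
    rw [Finset.mem_filter] at hn
    have : (∑ d ∈ T, if d ∣ n then lam q z d else 0) = 1 := by
      rw [Finset.sum_eq_single_of_mem 1 (one_mem_ST hq hz1)]
      · simp [lam_one hq hz1]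
      · intro d hd hd1
        rw [if_neg]
        intro hdn
        rcases (Nat.dvd_prime hn.2.1).mp hdn with h | h
        · exact hd1 h
        · have := (mem_ST.mp hd).1.2; omega
    rw [this]; simp
  have s2 : ∑ n ∈ S, v n * (∑ d ∈ T, if d ∣ n then lam q z d else 0) ^ 2
      = ∑ d ∈ T, ∑ e ∈ T, lam q z d * lam q z e *
        ∑ n ∈ S.filter (fun n => Nat.lcm d e ∣ n), v n := by
    have : ∀ n ∈ S, v n * (∑ d ∈ T, if d ∣ n then lam q z d else 0) ^ 2
        = ∑ d ∈ T, ∑ e ∈ T, lam q z d * lam q z e * (if Nat.lcm d e ∣ n then v n else 0) := by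
      intro n _
      rw [sq, Finset.sum_mul_sum, Finset.mul_sum]
      refine Finset.sum_congr rfl fun d _ => ?_
      rw [Finset.mul_sum]
      refine Finset.sum_congr rfl fun e _ => ?_
      have : Nat.lcm d e ∣ n ↔ d ∣ n ∧ e ∣ n := Nat.lcm_dvd_iff
      by_cases ha : d ∣ n <;> by_cases hb : e ∣ n <;> simp [ha, hb, this]
      ring
    rw [Finset.sum_congr rfl this, Finset.sum_comm]
    refine Finset.sum_congr rfl fun d _ => ?_
    rw [Finset.sum_comm]
    refine Finset.sum_congr rfl fun e _ => ?_
    rw [← Finset.mul_sum, Finset.sum_filter]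
  have s3 : ∀ d ∈ T, ∀ e ∈ T, lam q z d * lam q z e *
        ∑ n ∈ S.filter (fun n => Nat.lcm d e ∣ n), v n
        ≤ V * (lam q z d * lam q z e / (Nat.lcm d e : ℝ)) + R * (|lam q z d| * |lam q z e|) := by
    intro d hd e he
    have hd' := mem_ST.mp hd
    have he' := mem_ST.mp he
    have hdv : Nat.lcm d e ∣ d * e := Nat.lcm_dvd_mul d e
    have := h (Nat.lcm d e) (Nat.lcm_pos hd'.1.1 he'.1.1)
      ((Nat.le_of_dvd (Nat.mul_pos hd'.1.1 he'.1.1) hdv).trans (by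
        rw [sq]; exact Nat.mul_le_mul hd'.1.2 he'.1.2))
      (fun hh => by
        rcases hq.dvd_mul.mp (hh.trans hdv) with h1 | h1
        · exact hd'.2.2 h1
        · exact he'.2.2 h1)
    set W := ∑ n ∈ S.filter (fun n => Nat.lcm d e ∣ n), v n
    have e1 : lam q z d * lam q z e * W = V * (lam q z d * lam q z e / (Nat.lcm d e : ℝ))
        + (lam q z d * lam q z e) * (W - V / (Nat.lcm d e : ℝ)) := by ring
    rw [e1]
    refine add_le_add le_rfl ?_
    refine (le_abs_self _).trans ?_
    rw [abs_mul, abs_mul, mul_comm]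
    exact mul_le_mul_of_nonneg_right this (by positivity)
  rw [s2] at s1
  refine s1.trans ((Finset.sum_le_sum fun d hd => Finset.sum_le_sum (s3 d hd)).trans ?_)
  simp only [Finset.sum_add_distrib, ← Finset.mul_sum]
  rw [lam_quad hq hz1]
  refine add_le_add ?_ ?_
  · rw [mul_one_div, mul_div_assoc]
    rw [div_eq_mul_inv]
    refine mul_le_mul_of_nonneg_left ?_ hV
    rw [le_div_iff₀ hlog, inv_mul_le_iff₀ hG]
    exact SG_ge hq hz1
  · refine mul_le_mul_of_nonneg_left ?_ hR
    rw [← Finset.sum_mul, ← sq]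
    exact pow_le_pow_left₀ (Finset.sum_nonneg fun _ _ => abs_nonneg _) (lam_abs_sum hq hz1) 2

end FI

namespace FI
open ArithmeticFunction

lemma cnt_class (r : ℕ) (hr : 0 < r) [NeZero r] (a b : ℕ) (hab : a ≤ b) (h : ZMod r) :
    |(∑ k ∈ Finset.Ioc a b, if (k : ZMod r) = h then (1:ℝ) else 0) - ((b:ℝ) - a) / r| ≤ 1 := by
  have h1 : (∑ k ∈ Finset.Ioc a b, if (k : ZMod r) = h then (1:ℝ) else 0)
      = (((Finset.Ioc a b).filter (fun k => k ≡ h.val [MOD r])).card : ℝ) := by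
    rw [Finset.card_filter]
    push_cast
    refine Finset.sum_congr rfl fun k _ => ?_
    have : (k : ZMod r) = h ↔ k ≡ h.val [MOD r] := by
      rw [← ZMod.natCast_eq_natCast_iff, ZMod.natCast_zmod_val]
    simp [this]
  have h2 := Nat.Ioc_filter_modEq_card a b hr h.val
  rw [h1]
  have h3 : (((Finset.Ioc a b).filter (fun k => k ≡ h.val [MOD r])).card : ℝ)
      = ((max (⌊((b:ℚ) - h.val) / r⌋ - ⌊((a:ℚ) - h.val) / r⌋) 0 : ℤ) : ℝ) := by
    rw [← h2]; simp
  rw [h3]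
  have hr' : (0:ℚ) < r := by exact_mod_cast hr
  have hle : ((a:ℚ) - h.val) / r ≤ ((b:ℚ) - h.val) / r := by
    have : (a:ℚ) ≤ b := by exact_mod_cast hab
    gcongr
  have hfl := Int.floor_le_floor hle
  rw [max_eq_left (by linarith)]
  have f1 := Int.floor_le (((b:ℚ) - h.val) / r)
  have f2 := Int.lt_floor_add_one (((b:ℚ) - h.val) / r)
  have f3 := Int.floor_le (((a:ℚ) - h.val) / r)
  have f4 := Int.lt_floor_add_one (((a:ℚ) - h.val) / r)
  have e : ((b:ℚ) - h.val) / r - ((a:ℚ) - h.val) / r = ((b:ℚ) - a) / r := by ring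
  have key : |((⌊((b:ℚ) - h.val) / r⌋ - ⌊((a:ℚ) - h.val) / r⌋ : ℤ) : ℚ) - ((b:ℚ) - a) / r| ≤ 1 := by
    rw [abs_le, ← e]; push_cast; constructor <;> linarith
  generalize ⌊((b:ℚ) - h.val) / r⌋ - ⌊((a:ℚ) - h.val) / r⌋ = t at key ⊢
  have := (Rat.cast_le (K := ℝ)).mpr key
  push_cast at this
  exact this

/-- the weight -/
noncomputable def vq (f : ℕ → ℝ) (r n : ℕ) : ℝ :=
  (if (r:ℤ) ∣ (n:ℤ) - 1 then (1 + f n) / 2 else 0) + (if (r:ℤ) ∣ (n:ℤ) + 1 then (1 - f n) / 2 else 0)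

lemma vq_nonneg {f : ℕ → ℝ} {D : ℕ} (hf : Chr f D) (r n : ℕ) : 0 ≤ vq f r n := by
  have := abs_le.mp (hf.le n)
  unfold vq
  refine add_nonneg ?_ ?_ <;> split_ifs <;> linarith

lemma TS_Ioc (r : ℕ) (g : ℕ → ℝ) (a b : ℕ) (hab : a ≤ b) (h : ZMod r) :
    ∑ k ∈ Finset.Ioc a b, (if (k : ZMod r) = h then g k else 0)
      = TS r g (b + 1) h - TS r g (a + 1) h := by
  unfold TS
  rw [Finset.sum_range_sub_sum_range (by omega)]
  refine Finset.sum_congr ?_ fun _ _ => rfl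
  ext k; simp; omega

lemma sum_dvd_Ioc (a b d : ℕ) (hd : 0 < d) (F : ℕ → ℝ) :
    ∑ n ∈ (Finset.Ioc a b).filter (fun n => d ∣ n), F n
      = ∑ k ∈ Finset.Ioc (a / d) (b / d), F (d * k) := by
  rw [← Finset.sum_image (f := F) (g := fun k => d * k)
    (fun x _ y _ h => Nat.eq_of_mul_eq_mul_left hd h)]
  refine Finset.sum_congr ?_ fun _ _ => rfl
  ext n
  simp only [Finset.mem_filter, Finset.mem_Ioc, Finset.mem_image]
  constructor
  · rintro ⟨⟨h1, h2⟩, k, rfl⟩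
    refine ⟨k, ⟨?_, ?_⟩, rfl⟩
    · rwa [Nat.div_lt_iff_lt_mul hd, mul_comm]
    · rwa [Nat.le_div_iff_mul_le hd, mul_comm]
  · rintro ⟨k, ⟨h1, h2⟩, rfl⟩
    rw [Nat.div_lt_iff_lt_mul hd, mul_comm] at h1
    rw [Nat.le_div_iff_mul_le hd, mul_comm] at h2
    exact ⟨⟨h1, h2⟩, Dvd.intro k rfl⟩

lemma vq_level {f : ℕ → ℝ} {D : ℕ} (hf : Chr f D) (r : ℕ) [NeZero r] (hr : 0 < r) (E : ℝ)
    (hE : ∀ y (h h' : ZMod r), |TS r f y h - TS r f y h'| ≤ E)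
    (X u : ℕ) (hXu : X ≤ u) (d : ℕ) (hd : 1 ≤ d) (hdr : Nat.Coprime d r) :
    |∑ n ∈ (Finset.Ioc X u).filter (fun n => d ∣ n), vq f r n - (((u:ℝ) - X) / r) / d| ≤ 2 + E := by
  rw [sum_dvd_Ioc X u d hd]
  set a := X / d
  set b := u / d
  have hab : a ≤ b := Nat.div_le_div_right hXu
  set w := ZMod.unitOfCoprime d hdr with hw
  have hwc : (w : ZMod r) = (d : ZMod r) := ZMod.coe_unitOfCoprime d hdr
  set h : ZMod r := ((w⁻¹ : (ZMod r)ˣ) : ZMod r) with hh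
  have hc1 : ∀ k : ℕ, ((r:ℤ) ∣ ((d * k : ℕ) : ℤ) - 1) ↔ (k : ZMod r) = h := by
    intro k
    rw [← ZMod.intCast_zmod_eq_zero_iff_dvd]
    push_cast
    rw [sub_eq_zero, ← hwc, hh]
    constructor
    · intro e; rw [← Units.inv_mul_cancel_left w (k : ZMod r), e, mul_one]
    · intro e; rw [e, Units.mul_inv]
  have hc2 : ∀ k : ℕ, ((r:ℤ) ∣ ((d * k : ℕ) : ℤ) + 1) ↔ (k : ZMod r) = -h := by
    intro k
    rw [← ZMod.intCast_zmod_eq_zero_iff_dvd]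
    push_cast
    rw [← hwc, hh, add_eq_zero_iff_eq_neg]
    constructor
    · intro e; rw [← Units.inv_mul_cancel_left w (k : ZMod r), e]; simp
    · intro e; rw [e, mul_neg, Units.mul_inv]
  have hs : ∀ k ∈ Finset.Ioc a b, vq f r (d * k)
      = (1/2) * ((if (k : ZMod r) = h then (1:ℝ) else 0) + (if (k : ZMod r) = -h then (1:ℝ) else 0))
        + (f d / 2) * ((if (k : ZMod r) = h then f k else 0) - (if (k : ZMod r) = -h then f k else 0)) := by
    intro k _
    unfold vq
    simp only [hc1, hc2, hf.mul]
    split_ifs <;> ring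
  rw [Finset.sum_congr rfl hs, Finset.sum_add_distrib, ← Finset.mul_sum, ← Finset.mul_sum,
    Finset.sum_add_distrib, Finset.sum_sub_distrib, TS_Ioc r f a b hab, TS_Ioc r f a b hab]
  have c1 := abs_le.mp (cnt_class r hr a b hab h)
  have c2 := abs_le.mp (cnt_class r hr a b hab (-h))
  have t1 := hE (b+1) h (-h)
  have t2 := hE (a+1) h (-h)
  set N1 := (∑ k ∈ Finset.Ioc a b, if (k : ZMod r) = h then (1:ℝ) else 0)
  set N2 := (∑ k ∈ Finset.Ioc a b, if (k : ZMod r) = -h then (1:ℝ) else 0)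
  have hfd := hf.le d
  have g1 : |f d / 2 * (TS r f (b + 1) h - TS r f (a + 1) h - (TS r f (b + 1) (-h) - TS r f (a + 1) (-h)))|
      ≤ E := by
    rw [abs_mul, abs_div, abs_two]
    have : |TS r f (b + 1) h - TS r f (a + 1) h - (TS r f (b + 1) (-h) - TS r f (a + 1) (-h))| ≤ 2 * E := by
      have e : TS r f (b + 1) h - TS r f (a + 1) h - (TS r f (b + 1) (-h) - TS r f (a + 1) (-h))
        = (TS r f (b + 1) h - TS r f (b + 1) (-h)) - (TS r f (a + 1) h - TS r f (a + 1) (-h)) := by ring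
      rw [e]
      refine (abs_sub _ _).trans ?_
      linarith
    calc _ ≤ 1 / 2 * (2 * E) := by gcongr
      _ = E := by ring
  have hr1 : (1:ℝ) ≤ r := by exact_mod_cast hr
  have hd1 : (1:ℝ) ≤ d := by exact_mod_cast hd
  have hd0 : (0:ℝ) < d := by linarith
  have fa1 : (a:ℝ) ≤ X / d := Nat.cast_div_le
  have fb1 : (b:ℝ) ≤ u / d := Nat.cast_div_le
  have fa2 : (X:ℝ) / d < a + 1 := by
    rw [div_lt_iff₀ hd0]; exact_mod_cast (Nat.div_lt_iff_lt_mul hd).mp (Nat.lt_succ_self (X / d))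
  have fb2 : (u:ℝ) / d < b + 1 := by
    rw [div_lt_iff₀ hd0]; exact_mod_cast (Nat.div_lt_iff_lt_mul hd).mp (Nat.lt_succ_self (u / d))
  have e1 : (((u:ℝ) - X) / r) / d = (u / d - X / d) / r := by field_simp
  have e2 : |((b:ℝ) - a) / r - (u / d - X / d) / r| ≤ 1 := by
    rw [← sub_div, abs_div, abs_of_pos (by linarith : (0:ℝ) < r), div_le_one (by linarith)]
    refine le_trans ?_ hr1
    rw [abs_le]; constructor <;> linarith
  rw [e1]
  have e2' := abs_le.mp e2
  have g1' := abs_le.mp g1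
  rw [abs_le]
  constructor <;> linarith

/-- Selberg applied on a block -/
theorem sel_block {f : ℕ → ℝ} {D : ℕ} (hf : Chr f D) {Q : ℕ} (hQ : Q.Prime) (r : ℕ) (hr : 0 < r)
    (hQr : ∀ d, ¬ Q ∣ d → Nat.Coprime d r) (E : ℝ) (hE0 : 0 ≤ E)
    (hE : ∀ y (h h' : ZMod r), |TS r f y h - TS r f y h'| ≤ E)
    (X Y : ℕ) (hX : 1 ≤ X) (hXY : X ≤ Y) (z : ℕ) (hz : 2 ≤ z) (hzX : z ≤ X) :
    ∑ p ∈ (Finset.Ioc X Y).filter Nat.Prime, vq f r p / p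
      ≤ (1 / r) * (1 + 1 / ((Q:ℝ) - 1)) / Real.log z * Real.log ((Y:ℝ) / X)
        + (2 + E) * (z * (1 + Real.log z)) ^ 2 / X := by
  have : NeZero r := ⟨hr.ne'⟩
  have hlz : 0 < Real.log z := Real.log_pos (by exact_mod_cast hz)
  have hQ1 : 0 < (Q:ℝ) - 1 := by
    have : (1:ℝ) < Q := by exact_mod_cast hQ.one_lt
    linarith
  set M : ℝ := (1 / r) * (1 + 1 / ((Q:ℝ) - 1)) / Real.log z with hM
  have hM0 : 0 ≤ M := by positivity
  set F : ℝ := (2 + E) * (z * (1 + Real.log z)) ^ 2 with hF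
  have h1 := abel_block (fun n => (if n.Prime then vq f r n else 0) - M) X hX F Y hXY (by
    intro u hu1 hu2
    have s := selberg hQ hz (Finset.Ioc X u) (vq f r) (fun n => vq_nonneg hf r n)
      (((u:ℝ) - X) / r) (2 + E) (by
        have : (X:ℝ) ≤ u := by exact_mod_cast hu1
        exact div_nonneg (by linarith) (by positivity)) (by linarith)
      (fun d hd _ hQd => vq_level hf r hr E hE X u hu1 d hd (hQr d hQd))
    rw [Finset.sum_sub_distrib, ← Finset.sum_filter]
    have e1 : (Finset.Ioc X u).filter Nat.Prime = (Finset.Ioc X u).filter (fun n => n.Prime ∧ z < n) := by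
      refine Finset.filter_congr fun n hn => ?_
      have := (Finset.mem_Ioc.mp hn).1
      constructor
      · intro h; exact ⟨h, by omega⟩
      · exact fun h => h.1
    rw [e1]
    have e2 : ∑ n ∈ Finset.Ioc X u, M = ((u:ℝ) - X) / r * (1 + 1 / ((Q:ℝ) - 1)) / Real.log z := by
      rw [Finset.sum_const, Nat.card_Ioc, nsmul_eq_mul, Nat.cast_sub hu1, hM]; ring
    rw [e2]; linarith)
  have e3 : ∑ p ∈ (Finset.Ioc X Y).filter Nat.Prime, vq f r p / p
      = ∑ n ∈ Finset.Ioc X Y, ((if n.Prime then vq f r n else 0) - M) / n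
        + M * ∑ n ∈ Finset.Ioc X Y, (1:ℝ) / n := by
    rw [Finset.mul_sum, ← Finset.sum_add_distrib, Finset.sum_filter]
    refine Finset.sum_congr rfl fun n _ => ?_
    split_ifs <;> ring
  have e4 : ∑ n ∈ Finset.Ioc X Y, (1:ℝ) / n ≤ Real.log ((Y:ℝ) / X) := by
    clear h1 e3
    have hX0 : (0:ℝ) < X := by exact_mod_cast hX
    induction Y, hXY using Nat.le_induction with
    | base => simp [hX0.ne']
    | succ Y hY ih =>
      rw [Finset.sum_Ioc_succ_top (by omega)]
      have hY0 : (0:ℝ) < Y := by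
        have : (X:ℝ) ≤ Y := by exact_mod_cast hY
        linarith
      have hh := Real.one_sub_inv_le_log_of_pos (x := ((Y + 1 : ℕ) : ℝ) / Y) (by positivity)
      have ee : Real.log (((Y + 1 : ℕ) : ℝ) / X) = Real.log ((Y:ℝ) / X) + Real.log (((Y + 1 : ℕ) : ℝ) / Y) := by
        rw [← Real.log_mul (by positivity) (by positivity)]
        congr 1; field_simp
      rw [ee]
      have e5 : 1 - (((Y + 1 : ℕ) : ℝ) / Y)⁻¹ = 1 / ((Y + 1 : ℕ) : ℝ) := by
        push_cast; field_simp; ring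
      linarith
  rw [e3]
  have := mul_le_mul_of_nonneg_left e4 hM0
  linarith

end FI

namespace FI
open ArithmeticFunction Filter Topology

theorem sel_sum {f : ℕ → ℝ} {D : ℕ} (hf : Chr f D) (E : ℝ) (hE0 : 0 ≤ E)
    (P : Finset ℕ) (w : ℕ → ℝ) (hw : ∀ r ∈ P, 0 ≤ w r) (Qf : ℕ → ℕ) (c : ℝ) (hc : 0 ≤ c)
    (hP : ∀ r ∈ P, 0 < r ∧ (Qf r).Prime ∧ (∀ d, ¬ Qf r ∣ d → Nat.Coprime d r) ∧
      (∀ y (h h' : ZMod r), |TS r f y h - TS r f y h'| ≤ E) ∧ 1 + 1 / ((Qf r : ℝ) - 1) ≤ c)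
    (X K : ℕ) (hX : 1 ≤ X) (hK : 1 ≤ K) (z : ℕ) (hz : 2 ≤ z) (hzX : z ≤ X) (W0 W1 : ℝ)
    (h0 : ∑ r ∈ P, w r ≤ W0) (h1 : ∑ r ∈ P, w r / r ≤ W1) :
    ∑ r ∈ P, w r * ∑ p ∈ (Finset.Ioc X (K * X)).filter Nat.Prime, vq f r p * Real.log p / p
      ≤ Real.log (K * X) * (W1 * c / Real.log z * Real.log K
        + (2 + E) * (z * (1 + Real.log z)) ^ 2 / X * W0) := by
  have hlz : 0 < Real.log z := Real.log_pos (by exact_mod_cast hz)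
  have hXY : X ≤ K * X := Nat.le_mul_of_pos_left X hK
  have hX0 : (0:ℝ) < X := by exact_mod_cast hX
  have hK0 : (1:ℝ) ≤ K := by exact_mod_cast hK
  have hX1 : (1:ℝ) ≤ X := by exact_mod_cast hX
  have hlogK : 0 ≤ Real.log K := Real.log_nonneg hK0
  have hLY : 0 ≤ Real.log (K * X) := Real.log_nonneg (by nlinarith)
  set G := (2 + E) * (z * (1 + Real.log z)) ^ 2 / X with hG
  have hG0 : 0 ≤ G := by positivity
  have hr : ∀ r ∈ P, w r * ∑ p ∈ (Finset.Ioc X (K * X)).filter Nat.Prime, vq f r p * Real.log p / p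
      ≤ Real.log (K * X) * (w r / r * (|c| / Real.log z * Real.log K) + G * w r) := by
    intro r hr
    obtain ⟨hr0, hQ, hQr, hEr, hcr⟩ := hP r hr
    have s := sel_block hf hQ r hr0 hQr E hE0 hEr X (K * X) hX hXY z hz hzX
    have e1 : ((K * X : ℕ) : ℝ) / X = K := by push_cast; field_simp
    rw [e1] at s
    have s2 : ∑ p ∈ (Finset.Ioc X (K * X)).filter Nat.Prime, vq f r p * Real.log p / p
        ≤ Real.log (K * X) * ∑ p ∈ (Finset.Ioc X (K * X)).filter Nat.Prime, vq f r p / p := by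
      rw [Finset.mul_sum]
      refine Finset.sum_le_sum fun p hp => ?_
      have hp' := Finset.mem_Ioc.mp (Finset.mem_filter.mp hp).1
      have hp0 : (0:ℝ) < p := by exact_mod_cast (Finset.mem_filter.mp hp).2.pos
      have : Real.log p ≤ Real.log (K * X) := Real.log_le_log hp0 (by exact_mod_cast hp'.2)
      have hv := vq_nonneg hf r p
      have : vq f r p / p * Real.log p ≤ vq f r p / p * Real.log (K * X) :=
        mul_le_mul_of_nonneg_left this (by positivity)
      calc _ = vq f r p / p * Real.log p := by ring
        _ ≤ _ := this
        _ = _ := by ring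
    have hcc : 1 + 1 / ((Qf r : ℝ) - 1) ≤ |c| := hcr.trans (le_abs_self c)
    have s3 : (1 / (r:ℝ)) * (1 + 1 / ((Qf r:ℝ) - 1)) / Real.log z * Real.log K
        ≤ (1 / (r:ℝ)) * |c| / Real.log z * Real.log K := by gcongr
    calc _ ≤ w r * (Real.log (K * X) * ((1 / (r:ℝ)) * |c| / Real.log z * Real.log K + G)) := by
          refine mul_le_mul_of_nonneg_left (s2.trans ?_) (hw r hr)
          refine mul_le_mul_of_nonneg_left ?_ hLY
          linarith
      _ = _ := by ring
  refine (Finset.sum_le_sum hr).trans ?_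
  rw [← Finset.mul_sum, Finset.sum_add_distrib, ← Finset.sum_mul, ← Finset.mul_sum]
  refine mul_le_mul_of_nonneg_left ?_ hLY
  refine add_le_add ?_ (mul_le_mul_of_nonneg_left h0 hG0)
  rw [abs_of_nonneg hc]
  calc _ ≤ W1 * (c / Real.log z * Real.log K) := mul_le_mul_of_nonneg_right h1 (by positivity)
    _ = _ := by ring

lemma exp_poly_tendsto (δ : ℝ) (hδ : 0 < δ) (k : ℕ) :
    Tendsto (fun T : ℝ => Real.exp (-(δ * T)) * (1 + T) ^ k) atTop (𝓝 0) := by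
  have h1 : Tendsto (fun T : ℝ => T ^ k * Real.exp (-(δ * T))) atTop (𝓝 0) := by
    have := (Real.tendsto_pow_mul_exp_neg_atTop_nhds_zero k).comp
      (tendsto_id.const_mul_atTop hδ)
    have h2 := this.const_mul ((1 / δ) ^ k)
    rw [mul_zero] at h2
    refine h2.congr fun T => ?_
    simp only [Function.comp, id]
    rw [mul_pow, ← mul_assoc, ← mul_assoc, ← mul_pow]
    rw [one_div_mul_cancel hδ.ne']
    simp
  have h2 := (h1.comp (tendsto_atTop_add_const_left atTop (1:ℝ) tendsto_id)).const_mul (Real.exp δ)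
  rw [mul_zero] at h2
  refine h2.congr fun T => ?_
  simp only [Function.comp, id]
  rw [mul_comm ((1 + T) ^ k), ← mul_assoc, ← Real.exp_add]
  congr 2; ring

lemma phi_tendsto (L c a s C θ B δ : ℝ) (ha : 0 < a) (hθ : 0 < θ) (hδ : 0 < δ) :
    Tendsto (fun T : ℝ => (1 + L / T) * ((s * T + C) * (c + 2 * Real.exp (-(a * T))) /
      (θ * T - Real.log 2) * L + B * (Real.exp (-(δ * T)) * (1 + T) ^ 3))) atTop
      (𝓝 (s * c / θ * L)) := by
  have t1 : Tendsto (fun T : ℝ => 1 + L / T) atTop (𝓝 (1 + 0)) :=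
    tendsto_const_nhds.add (tendsto_const_nhds.div_atTop tendsto_id)
  have t2 : Tendsto (fun T : ℝ => c + 2 * Real.exp (-(a * T))) atTop (𝓝 (c + 2 * 0)) := by
    refine tendsto_const_nhds.add (Tendsto.const_mul _ ?_)
    simpa using exp_poly_tendsto a ha 0
  have t3 : Tendsto (fun T : ℝ => (s * T + C) / (θ * T - Real.log 2)) atTop (𝓝 ((s + 0) / (θ - 0))) := by
    have h1 : Tendsto (fun T : ℝ => (s + C / T) / (θ - Real.log 2 / T)) atTop (𝓝 ((s + 0) / (θ - 0))) := by
      refine Tendsto.div (tendsto_const_nhds.add (tendsto_const_nhds.div_atTop tendsto_id))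
        (tendsto_const_nhds.sub (tendsto_const_nhds.div_atTop tendsto_id)) (by simpa using hθ.ne')
    refine h1.congr' ?_
    filter_upwards [eventually_gt_atTop 0] with T hT
    have : s + C / T = (s * T + C) / T := by field_simp
    have h2 : θ - Real.log 2 / T = (θ * T - Real.log 2) / T := by field_simp
    rw [this, h2, div_div_div_cancel_right₀ hT.ne']
  have t4 := (exp_poly_tendsto δ hδ 3).const_mul B
  have := t1.mul (((t3.mul t2).mul_const L).add t4)
  convert this using 2
  · ring
  · ring

lemma sel_param {θ : ℝ} (hθ : 0 < θ) (hθ1 : θ ≤ 1) : ∀ᶠ X : ℕ in atTop,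
    2 ≤ ⌊(X:ℝ) ^ θ⌋₊ ∧ ⌊(X:ℝ) ^ θ⌋₊ ≤ X ∧ 0 < θ * Real.log X - Real.log 2 ∧
    θ * Real.log X - Real.log 2 ≤ Real.log ⌊(X:ℝ) ^ θ⌋₊ ∧ 1 ≤ Real.log X := by
  have h1 : Tendsto (fun X : ℕ => (X:ℝ) ^ θ) atTop atTop :=
    (tendsto_rpow_atTop hθ).comp tendsto_natCast_atTop_atTop
  have h2 : Tendsto (fun X : ℕ => Real.log X) atTop atTop :=
    Real.tendsto_log_atTop.comp tendsto_natCast_atTop_atTop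
  filter_upwards [h1.eventually_ge_atTop 4, h2.eventually_ge_atTop 1, eventually_ge_atTop 1]
    with X hX hL h1X
  have hX0 : (0:ℝ) < X := by exact_mod_cast h1X
  have hX1 : (1:ℝ) ≤ X := by exact_mod_cast h1X
  have hlt := Nat.lt_floor_add_one ((X:ℝ) ^ θ)
  have hlogθ : Real.log ((X:ℝ) ^ θ) = θ * Real.log X := Real.log_rpow hX0 θ
  have e : θ * Real.log X - Real.log 2 = Real.log ((X:ℝ) ^ θ / 2) := by
    rw [Real.log_div (by positivity) (by norm_num), hlogθ]
  refine ⟨Nat.le_floor (by push_cast; linarith), ?_, ?_, ?_, hL⟩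
  · have : (X:ℝ) ^ θ ≤ X := by
      calc (X:ℝ) ^ θ ≤ (X:ℝ) ^ (1:ℝ) := Real.rpow_le_rpow_of_exponent_le hX1 hθ1
        _ = X := Real.rpow_one _
    have := Nat.floor_le_floor this
    simpa using this
  · rw [e]; exact Real.log_pos (by linarith)
  · rw [e]; exact Real.log_le_log (by positivity) (by linarith)

/-- common finishing estimate -/
lemma sel_finish (K : ℕ) (hK : 1 ≤ K) {θ : ℝ} (hθ : 0 < θ) {β : ℝ} (hβ : 0 ≤ β)
    (hβθ : β + 2 * θ < 1) (a s c C κ : ℝ) (hs : 0 ≤ s) (hc : 0 ≤ c) (hC : 0 ≤ C) (ha : 0 < a)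
    (hκ : s * c / θ * Real.log K < κ) (E : ℝ) (hE : 0 ≤ E) :
    ∀ᶠ X : ℕ in atTop, Real.log (K * X) * ((s * Real.log X + C) * (c + 2 * (X:ℝ) ^ (-a)) /
      Real.log ⌊(X:ℝ) ^ θ⌋₊ * Real.log K
        + (2 + E) * (⌊(X:ℝ) ^ θ⌋₊ * (1 + Real.log ⌊(X:ℝ) ^ θ⌋₊)) ^ 2 / X * ((X:ℝ) ^ β * Real.log X))
      ≤ κ * Real.log X := by
  have h2 : Tendsto (fun X : ℕ => Real.log X) atTop atTop :=
    Real.tendsto_log_atTop.comp tendsto_natCast_atTop_atTop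
  have hδ : 0 < 1 - β - 2 * θ := by linarith
  have ev := ((phi_tendsto (Real.log K) c a s C θ (2 + E) (1 - β - 2 * θ) ha hθ hδ).comp h2).eventually_lt_const hκ
  filter_upwards [ev, sel_param hθ (by linarith), eventually_ge_atTop 1] with X hev hz hX1
  obtain ⟨hz2, hzX, hp1, hp2, hT1⟩ := hz
  set T := Real.log X with hT
  set z := ⌊(X:ℝ) ^ θ⌋₊ with hzd
  have hX0 : (0:ℝ) < X := by exact_mod_cast hX1
  have hK0 : (1:ℝ) ≤ K := by exact_mod_cast hK
  have hlogK : 0 ≤ Real.log K := Real.log_nonneg hK0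
  have hrp : ∀ b : ℝ, (X:ℝ) ^ b = Real.exp (b * T) := fun b => by
    rw [Real.rpow_def_of_pos hX0, mul_comm]
  have eX : (X:ℝ) = Real.exp T := (Real.exp_log hX0).symm
  have hzle : (z:ℝ) ≤ Real.exp (θ * T) := by
    rw [← hrp]; exact Nat.floor_le (by positivity)
  have hz0 : (0:ℝ) < z := by exact_mod_cast (by omega : 0 < z)
  have hlz : Real.log z ≤ T := Real.log_le_log hz0 (by exact_mod_cast hzX)
  have hlz0 : 0 ≤ Real.log z := Real.log_nonneg (by exact_mod_cast (by omega : 1 ≤ z))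
  have e1 : Real.log (K * X) = T * (1 + Real.log K / T) := by
    rw [Real.log_mul (by positivity) (by positivity)]
    field_simp; ring
  have t1 : (s * T + C) * (c + 2 * (X:ℝ) ^ (-a)) / Real.log z * Real.log K
      ≤ (s * T + C) * (c + 2 * Real.exp (-(a * T))) / (θ * T - Real.log 2) * Real.log K := by
    rw [hrp, neg_mul]
    have : 0 ≤ T := by linarith
    gcongr
  have t2 : (2 + E) * (z * (1 + Real.log z)) ^ 2 / X * ((X:ℝ) ^ β * T)
      ≤ (2 + E) * (Real.exp (-((1 - β - 2 * θ) * T)) * (1 + T) ^ 3) := by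
    have h3 : (z * (1 + Real.log z)) ^ 2 ≤ (Real.exp (θ * T) * (1 + T)) ^ 2 := by gcongr
    have e3 : Real.exp (-((1 - β - 2 * θ) * T)) = Real.exp (θ * T) ^ 2 * Real.exp (β * T) / X := by
      rw [← Real.exp_nat_mul, ← Real.exp_add, eX, ← Real.exp_sub]
      congr 1; push_cast; ring
    calc _ ≤ (2 + E) * (Real.exp (θ * T) * (1 + T)) ^ 2 / X * (Real.exp (β * T) * (1 + T)) := by
          rw [hrp β]
          have : 0 ≤ T := by linarith
          gcongr
          linarith
      _ = _ := by rw [e3]; ring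
  rw [e1, mul_assoc, mul_comm κ T]
  refine mul_le_mul_of_nonneg_left ?_ (by linarith)
  simp only [Function.comp] at hev
  refine le_trans ?_ hev.le
  refine mul_le_mul_of_nonneg_left (add_le_add t1 t2) ?_
  have : 0 ≤ Real.log K / T := div_nonneg hlogK (by linarith)
  linarith

theorem lemC {f : ℕ → ℝ} {D : ℕ} (hf : Chr f D) (K : ℕ) (hK : 2 ≤ K) (α β κ : ℝ) (hα : 0 < α)
    (hαβ : α ≤ β) (hβ1 : β < 1) (hκ : 2 * (β - α) / (1 - β) < κ) :
    ∀ᶠ X : ℕ in atTop, ∀ P : Finset ℕ,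
      (∀ q ∈ P, q.Prime ∧ (X:ℝ) ^ α < q ∧ (q:ℝ) ≤ (X:ℝ) ^ β) →
      ∑ q ∈ P, Real.log q * ∑ p ∈ (Finset.Ioc X (K * X)).filter Nat.Prime,
        vq f q p * Real.log p / p ≤ κ * Real.log K * Real.log X := by
  have hb : 0 < 1 - β := by linarith
  have hκ0 : 0 < κ := lt_of_le_of_lt (div_nonneg (by linarith) hb.le) hκ
  have h1 : (β - α) / κ < (1 - β) / 2 := by
    rw [div_lt_div_iff₀ hκ0 (by norm_num)]
    rw [div_lt_iff₀ hb] at hκ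
    linarith
  obtain ⟨θ, hθ1, hθ2⟩ := exists_between h1
  have hθ0 : 0 < θ := lt_of_le_of_lt (div_nonneg (by linarith) hκ0.le) hθ1
  have hK1 : (1:ℝ) < K := by exact_mod_cast hK
  have hlogK : 0 < Real.log K := Real.log_pos hK1
  have hκ' : (β - α) * 1 / θ * Real.log K < κ * Real.log K := by
    refine mul_lt_mul_of_pos_right ?_ hlogK
    rw [div_lt_iff₀ hθ0]
    rw [div_lt_iff₀ hκ0] at hθ1
    linarith
  have hC0 := C0_pos
  have hgrow : Tendsto (fun X : ℕ => (X:ℝ) ^ α) atTop atTop :=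
    (tendsto_rpow_atTop hα).comp tendsto_natCast_atTop_atTop
  filter_upwards [sel_finish K (by omega) hθ0 (by linarith : 0 ≤ β) (by linarith) α (β - α) 1 (C0 + 1)
    (κ * Real.log K) (by linarith) (by norm_num) (by linarith) hα hκ' (2 * D) (by positivity),
    sel_param hθ0 (by linarith), hgrow.eventually_ge_atTop (D + 1), eventually_ge_atTop 2]
    with X hfin hz hXD hX2 P hP
  obtain ⟨hz2, hzX, _, _, hT1⟩ := hz
  have hX0 : (0:ℝ) < X := by exact_mod_cast (by omega : 0 < X)
  refine le_trans ?_ hfin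
  refine sel_sum hf (2 * D) (by positivity) P (fun q => Real.log q) (fun q hq => ?_) id
    (1 + 2 * (X:ℝ) ^ (-α)) (by positivity) (fun q hq => ?_) X K (by omega) (by omega) _ hz2 hzX _ _ ?_ ?_
  · exact Real.log_nonneg (by exact_mod_cast (hP q hq).1.one_le)
  · obtain ⟨hqp, hq1, hq2⟩ := hP q hq
    refine ⟨hqp.pos, hqp, fun d hd => (Nat.Coprime.symm ((Nat.Prime.coprime_iff_not_dvd hqp).mpr hd)), ?_, ?_⟩
    · intro y h h'
      refine class_diff hf hqp (fun hd => ?_) y h h'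
      have := Nat.le_of_dvd hf.pos hd
      have : (q:ℝ) ≤ D := by exact_mod_cast this
      linarith
    · simp only [id]
      have h2 : (2:ℝ) ≤ q := by exact_mod_cast hqp.two_le
      rw [Real.rpow_neg hX0.le]
      have h3 : (0:ℝ) < (X:ℝ) ^ α := by positivity
      have : 1 / ((q:ℝ) - 1) ≤ 2 * ((X:ℝ) ^ α)⁻¹ := by
        rw [div_le_iff₀ (by linarith), ← div_eq_mul_inv, div_mul_eq_mul_div, le_div_iff₀ h3]
        linarith
      linarith
  · have hl : ∀ q ∈ P, Real.log q ≤ Real.log X := by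
      intro q hq
      obtain ⟨hqp, hq1, hq2⟩ := hP q hq
      refine Real.log_le_log (by exact_mod_cast hqp.pos) (hq2.trans ?_)
      calc (X:ℝ) ^ β ≤ (X:ℝ) ^ (1:ℝ) :=
            Real.rpow_le_rpow_of_exponent_le (by exact_mod_cast (by omega : 1 ≤ X)) hβ1.le
        _ = X := Real.rpow_one _
    have hc : (P.card : ℝ) ≤ (X:ℝ) ^ β := by
      have hsub : P ⊆ Finset.Ioc 0 ⌊(X:ℝ) ^ β⌋₊ := by
        intro q hq
        obtain ⟨hqp, hq1, hq2⟩ := hP q hq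
        exact Finset.mem_Ioc.mpr ⟨hqp.pos, Nat.le_floor hq2⟩
      have := Finset.card_le_card hsub
      rw [Nat.card_Ioc, Nat.sub_zero] at this
      exact le_trans (by exact_mod_cast this) (Nat.floor_le (by positivity))
    calc ∑ q ∈ P, Real.log q ≤ ∑ q ∈ P, Real.log X := Finset.sum_le_sum hl
      _ = P.card * Real.log X := by simp
      _ ≤ _ := by gcongr
  · exact mertens_rpow X hX2 α β hα.le hαβ P hP

lemma chr_zero : Chr (fun _ => 0) 1 := ⟨by simp, by simp, by simp, one_pos⟩

theorem lemA (K : ℕ) (hK : 2 ≤ K) (ε : ℝ) (hε : 0 < ε) (hε1 : ε ≤ 1 / 4) :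
    ∀ᶠ X : ℕ in atTop,
      ∑ r ∈ Finset.Ioc 1 ⌊(X:ℝ) ^ ε⌋₊, vonMangoldt r * ∑ p ∈ (Finset.Ioc X (K * X)).filter Nat.Prime,
        vq (fun _ => 0) r p * Real.log p / p ≤ 9 * ε * Real.log K * Real.log X := by
  have hθ0 : (0:ℝ) < 1 / 4 := by norm_num
  have hK1 : (1:ℝ) < K := by exact_mod_cast hK
  have hlogK : 0 < Real.log K := Real.log_pos hK1
  have hκ' : ε * 2 / (1 / 4) * Real.log K < 9 * ε * Real.log K := by
    refine mul_lt_mul_of_pos_right ?_ hlogK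
    rw [div_lt_iff₀ hθ0]
    linarith
  have hC0 := C0_pos
  filter_upwards [sel_finish K (by omega) hθ0 hε.le (by linarith) 1 ε 2 C0
    (9 * ε * Real.log K) hε.le (by norm_num) hC0.le one_pos hκ' 0 le_rfl,
    sel_param hθ0 (by linarith), sel_param hε (by linarith), eventually_ge_atTop 2]
    with X hfin hz hz' hX2
  obtain ⟨hz2, hzX, _, _, hT1⟩ := hz
  have hX0 : (0:ℝ) < X := by exact_mod_cast (by omega : 0 < X)
  refine le_trans ?_ hfin
  set B := ⌊(X:ℝ) ^ ε⌋₊ with hB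
  have hBle : (B:ℝ) ≤ (X:ℝ) ^ ε := Nat.floor_le (by positivity)
  have hB2 : 2 ≤ B := hz'.1
  have hBX : B ≤ X := hz'.2.1
  have hlB : Real.log B ≤ ε * Real.log X := by
    rw [← Real.log_rpow hX0]
    exact Real.log_le_log (by exact_mod_cast (by omega : 0 < B)) hBle
  have hsplit : ∀ F : ℕ → ℝ, ∑ r ∈ Finset.Ioc 1 B, vonMangoldt r * F r
      = ∑ r ∈ (Finset.Ioc 1 B).filter IsPrimePow, vonMangoldt r * F r := by
    intro F
    symm
    refine Finset.sum_subset (Finset.filter_subset _ _) fun r hr hr' => ?_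
    have : ¬ IsPrimePow r := fun h => hr' (Finset.mem_filter.mpr ⟨hr, h⟩)
    rw [vonMangoldt_eq_zero_iff.mpr this, zero_mul]
  rw [hsplit]
  have hsubs : (Finset.Ioc 1 B).filter IsPrimePow ⊆ Finset.Ioc 1 B := Finset.filter_subset _ _
  refine sel_sum chr_zero 0 le_rfl _ (fun r => vonMangoldt r) (fun r _ => vonMangoldt_nonneg)
    (fun r => r.minFac)
    (2 + 2 * (X:ℝ) ^ (-1:ℝ)) (by positivity) (fun r hr => ?_) X K (by omega) (by omega) _ hz2 hzX _ _ ?_ ?_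
  · obtain ⟨hr1, hr2⟩ := Finset.mem_filter.mp hr
    have hr1' := (Finset.mem_Ioc.mp hr1).1
    have hmp : r.minFac.Prime := Nat.minFac_prime (by omega)
    refine ⟨by omega, hmp, fun d hd => ?_, ?_, ?_⟩
    · obtain ⟨p, k, hp, hk, rfl⟩ := (isPrimePow_nat_iff _).mp hr2
      rw [Nat.Prime.pow_minFac hp hk.ne'] at hd
      exact Nat.Coprime.pow_right k (Nat.Coprime.symm ((Nat.Prime.coprime_iff_not_dvd hp).mpr hd))
    · intro y h h'
      simp [TS]
    · have h2 : (2:ℝ) ≤ r.minFac := by exact_mod_cast hmp.two_le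
      have h3 : (0:ℝ) ≤ 2 * (X:ℝ) ^ (-1:ℝ) := by positivity
      have : 1 / ((r.minFac:ℝ) - 1) ≤ 1 := by
        rw [div_le_one (by linarith)]; linarith
      linarith
  · calc ∑ r ∈ (Finset.Ioc 1 B).filter IsPrimePow, vonMangoldt r
        ≤ ∑ r ∈ Finset.Ioc 1 B, vonMangoldt r :=
          Finset.sum_le_sum_of_subset_of_nonneg hsubs fun _ _ _ => vonMangoldt_nonneg
      _ ≤ ∑ r ∈ Finset.Ioc 1 B, Real.log X := by
          refine Finset.sum_le_sum fun r hr => ?_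
          have := Finset.mem_Ioc.mp hr
          refine vonMangoldt_le_log.trans ?_
          exact Real.log_le_log (by exact_mod_cast (by omega : 0 < r)) (by exact_mod_cast (by omega))
      _ = ((B - 1 : ℕ) : ℝ) * Real.log X := by simp
      _ ≤ (X:ℝ) ^ ε * Real.log X := by
          have : ((B - 1 : ℕ) : ℝ) ≤ B := by exact_mod_cast Nat.sub_le B 1
          gcongr
          linarith
  · refine (Finset.sum_le_sum_of_subset_of_nonneg hsubs fun r _ _ =>
      div_nonneg vonMangoldt_nonneg (by positivity)).trans ?_
    have := mertens_block 1 B le_rfl (by omega)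
    simp at this
    linarith

end FI

namespace FI
open ArithmeticFunction Filter Topology

lemma vq_kap (f : ℕ → ℝ) (q n : ℕ) :
    vq f q n - (if q ∣ n then 0 else 1 / ((q:ℝ) - 1))
      = (1/2) * ((1 * kap q 1 n + f n * kap q 1 n) + (1 * kap q (-1) n - f n * kap q (-1) n)) := by
  unfold vq kap
  rw [sub_neg_eq_add]
  split_ifs <;> ring

lemma vq_ET (f : ℕ → ℝ) (q u : ℕ) :
    ∑ n ∈ Finset.Ioc 0 u, vonMangoldt n * (vq f q n - (if q ∣ n then 0 else 1 / ((q:ℝ) - 1)))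
      = (1/2) * ((ET (fun _ => 1) q 1 u vonMangoldt + ET f q 1 u vonMangoldt)
        + (ET (fun _ => 1) q (-1) u vonMangoldt - ET f q (-1) u vonMangoldt)) := by
  unfold ET
  rw [← Finset.sum_add_distrib, ← Finset.sum_sub_distrib, ← Finset.sum_add_distrib, Finset.mul_sum]
  refine Finset.sum_congr rfl fun n _ => ?_
  rw [vq_kap]; ring

lemma vq_ET_abs (f : ℕ → ℝ) (q u : ℕ) :
    |∑ n ∈ Finset.Ioc 0 u, vonMangoldt n * (vq f q n - (if q ∣ n then 0 else 1 / ((q:ℝ) - 1)))|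
      ≤ (1/2) * ((|ET (fun _ => 1) q 1 u vonMangoldt| + |ET f q 1 u vonMangoldt|)
        + (|ET (fun _ => 1) q (-1) u vonMangoldt| + |ET f q (-1) u vonMangoldt|)) := by
  rw [vq_ET, abs_mul, abs_of_pos (by norm_num : (0:ℝ) < 1/2)]
  refine mul_le_mul_of_nonneg_left ?_ (by norm_num)
  refine (abs_add_le _ _).trans (add_le_add (abs_add_le _ _) (abs_sub _ _))

lemma BV_vq {f : ℕ → ℝ} {D : ℕ} (hf : Chr f D) (ε : ℝ) (hε : 0 < ε) (hε1 : ε ≤ 1 / 10) :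
    ∃ C : ℝ, 0 < C ∧ ∀ u : ℕ, 2 ≤ u → ∀ P : Finset ℕ,
      (∀ q ∈ P, q.Prime ∧ (u:ℝ) ^ (ε / 2) < q ∧ (q:ℝ) ≤ (u:ℝ) ^ (1 / 2 - ε) ∧ ¬ q ∣ D) →
      ∑ q ∈ P, |∑ n ∈ Finset.Ioc 0 u, vonMangoldt n *
        (vq f q n - (if q ∣ n then 0 else 1 / ((q:ℝ) - 1)))| ≤ C * (u:ℝ) ^ (1 - ε / 4) := by
  obtain ⟨C1, hC1, h1⟩ := BV_all chr_one ε hε hε1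
  obtain ⟨C2, hC2, h2⟩ := BV_all hf ε hε hε1
  refine ⟨C1 + C2, by positivity, fun u hu P hP => ?_⟩
  refine (Finset.sum_le_sum fun q _ => vq_ET_abs f q u).trans ?_
  rw [← Finset.mul_sum, Finset.sum_add_distrib, Finset.sum_add_distrib, Finset.sum_add_distrib]
  have hu1 : ∀ q ∈ P, ¬ (q:ℤ) ∣ 1 := fun q hq h => by
    have := (hP q hq).1.one_lt
    have := Int.le_of_dvd one_pos h
    omega
  have hu2 : ∀ q ∈ P, ¬ (q:ℤ) ∣ -1 := fun q hq h => hu1 q hq ((Int.dvd_neg).mp h)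
  have hd1 : ∀ q ∈ P, ¬ q ∣ 1 := fun q hq => (hP q hq).1.not_dvd_one
  have a1 := h1 u hu 1 P fun q hq => ⟨(hP q hq).1, (hP q hq).2.1, (hP q hq).2.2.1, hd1 q hq, hu1 q hq⟩
  have a2 := h1 u hu (-1) P fun q hq => ⟨(hP q hq).1, (hP q hq).2.1, (hP q hq).2.2.1, hd1 q hq, hu2 q hq⟩
  have a3 := h2 u hu 1 P fun q hq => ⟨(hP q hq).1, (hP q hq).2.1, (hP q hq).2.2.1, (hP q hq).2.2.2, hu1 q hq⟩
  have a4 := h2 u hu (-1) P fun q hq => ⟨(hP q hq).1, (hP q hq).2.1, (hP q hq).2.2.1, (hP q hq).2.2.2, hu2 q hq⟩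
  linarith

theorem lemB {f : ℕ → ℝ} {D : ℕ} (hf : Chr f D) (K : ℕ) (hK : 2 ≤ K) (ε : ℝ) (hε : 0 < ε)
    (hε1 : ε ≤ 1 / 10) :
    ∀ᶠ X : ℕ in atTop, ∀ P : Finset ℕ,
      (∀ q ∈ P, q.Prime ∧ (X:ℝ) ^ ε < q ∧ (q:ℝ) ≤ (X:ℝ) ^ (1 / 2 - ε)) →
      ∑ q ∈ P, Real.log q * ∑ p ∈ (Finset.Ioc X (K * X)).filter Nat.Prime,
        vq f q p * Real.log p / p ≤ (Real.log K / 2 + C0) * Real.log X := by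
  obtain ⟨C, hC, hBV⟩ := BV_vq hf ε hε hε1
  have hC0 := C0_pos
  have hK1 : (1:ℝ) < K := by exact_mod_cast hK
  have hlogK : 0 < Real.log K := Real.log_pos hK1
  have hlogt : Tendsto (fun X : ℕ => Real.log X) atTop atTop :=
    Real.tendsto_log_atTop.comp tendsto_natCast_atTop_atTop
  have hgrow : Tendsto (fun X : ℕ => (X:ℝ) ^ ε) atTop atTop :=
    (tendsto_rpow_atTop hε).comp tendsto_natCast_atTop_atTop
  have hsmall : Tendsto (fun X : ℕ => (2 * C * (K:ℝ)) * (Real.exp (-((ε/4) * Real.log X)) * (1 + Real.log X) ^ 1))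
      atTop (𝓝 0) := by
    have := ((exp_poly_tendsto (ε/4) (by linarith) 1).comp hlogt).const_mul (2 * C * (K:ℝ))
    rw [mul_zero] at this
    exact this
  filter_upwards [hgrow.eventually_ge_atTop (D + 1), hgrow.eventually_ge_atTop (2 / ε), eventually_ge_atTop (K + 2),
    hlogt.eventually_ge_atTop 1, hlogt.eventually_ge_atTop ((2 * (C0 + 1) + 1 / (Real.log K + C0)) / ε),
    hsmall.eventually_le_const (zero_lt_one)]
    with X hXD hXε hXK hT1 hTbig hsm P hP
  have hX0 : (0:ℝ) < X := by exact_mod_cast (by omega : 0 < X)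
  have hX1 : (1:ℝ) ≤ X := by exact_mod_cast (by omega : 1 ≤ X)
  have hXY : X ≤ K * X := Nat.le_mul_of_pos_left X (by omega)
  set T := Real.log X with hT
  set g : ℕ → ℕ → ℝ := fun q n => vq f q n - (if q ∣ n then 0 else 1 / ((q:ℝ) - 1)) with hg
  -- partial sums
  have hlq : ∀ q ∈ P, Real.log q ≤ T := by
    intro q hq
    obtain ⟨hqp, hq1, hq2⟩ := hP q hq
    refine Real.log_le_log (by exact_mod_cast hqp.pos) (hq2.trans ?_)
    calc (X:ℝ) ^ (1/2 - ε) ≤ (X:ℝ) ^ (1:ℝ) :=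
          Real.rpow_le_rpow_of_exponent_le hX1 (by linarith)
      _ = X := Real.rpow_one _
  have hlq0 : ∀ q ∈ P, 0 ≤ Real.log q := fun q hq =>
    Real.log_nonneg (by exact_mod_cast (hP q hq).1.one_le)
  have hpart : ∀ u, X ≤ u → u ≤ K * X →
      ∑ q ∈ P, Real.log q * |∑ n ∈ Finset.Ioc 0 u, vonMangoldt n * g q n| ≤ X / 2 := by
    intro u hu1 hu2
    have huX : (X:ℝ) ≤ u := by exact_mod_cast hu1
    have huY : (u:ℝ) ≤ K * X := by exact_mod_cast hu2
    have hu0 : (0:ℝ) < u := by linarith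
    have huX2 : (u:ℝ) ≤ (X:ℝ) ^ (2:ℝ) := by
      rw [Real.rpow_two, sq]
      refine huY.trans (mul_le_mul_of_nonneg_right ?_ hX0.le)
      exact_mod_cast (by omega)
    have h := hBV u (by omega) P (fun q hq => by
      obtain ⟨hqp, hq1, hq2⟩ := hP q hq
      refine ⟨hqp, lt_of_le_of_lt ?_ hq1, hq2.trans ?_, fun hd => ?_⟩
      · calc (u:ℝ) ^ (ε/2) ≤ ((X:ℝ) ^ (2:ℝ)) ^ (ε/2) :=
              Real.rpow_le_rpow hu0.le huX2 (by linarith)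
          _ = (X:ℝ) ^ ε := by rw [← Real.rpow_mul hX0.le]; congr 1; ring
      · exact Real.rpow_le_rpow hX0.le huX (by linarith)
      · have := Nat.le_of_dvd hf.pos hd
        have : (q:ℝ) ≤ D := by exact_mod_cast this
        linarith)
    calc ∑ q ∈ P, Real.log q * |∑ n ∈ Finset.Ioc 0 u, vonMangoldt n * g q n|
        ≤ ∑ q ∈ P, T * |∑ n ∈ Finset.Ioc 0 u, vonMangoldt n * g q n| :=
          Finset.sum_le_sum fun q hq => mul_le_mul_of_nonneg_right (hlq q hq) (abs_nonneg _)
      _ = T * ∑ q ∈ P, |∑ n ∈ Finset.Ioc 0 u, vonMangoldt n * g q n| := by rw [Finset.mul_sum]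
      _ ≤ T * (C * (u:ℝ) ^ (1 - ε / 4)) := mul_le_mul_of_nonneg_left h (by linarith)
      _ ≤ (1 + T) * (C * (K * (X:ℝ) ^ (1 - ε / 4))) := by
          have h3 : (u:ℝ) ^ (1 - ε/4) ≤ K * (X:ℝ) ^ (1 - ε / 4) := by
            calc (u:ℝ) ^ (1 - ε/4) ≤ (K * X) ^ (1 - ε/4) := Real.rpow_le_rpow hu0.le huY (by linarith)
              _ = (K:ℝ) ^ (1 - ε/4) * (X:ℝ) ^ (1 - ε/4) := Real.mul_rpow (by linarith) hX0.le
              _ ≤ (K:ℝ) ^ (1:ℝ) * (X:ℝ) ^ (1 - ε/4) := by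
                  gcongr
                  · exact hK1.le
                  · linarith
              _ = _ := by rw [Real.rpow_one]
          gcongr
          linarith
      _ = (2 * C * K * (Real.exp (-((ε/4) * T)) * (1 + T) ^ 1)) * (X / 2) := by
          have : (X:ℝ) ^ (1 - ε/4) = X * Real.exp (-((ε/4) * T)) := by
            rw [sub_eq_add_neg, Real.rpow_add hX0, Real.rpow_one, Real.rpow_def_of_pos hX0]
            congr 2; ring
          rw [this]; ring
      _ ≤ 1 * (X / 2) := mul_le_mul_of_nonneg_right hsm (by positivity)
      _ = _ := one_mul _
  have hblock := abel_block (fun n => ∑ q ∈ P, Real.log q * (vonMangoldt n * g q n)) X (by omega) X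
    (K * X) hXY (by
      intro u hu1 hu2
      rw [Finset.sum_comm]
      have e : ∀ q : ℕ, ∑ n ∈ Finset.Ioc X u, Real.log q * (vonMangoldt n * g q n)
          = Real.log q * (∑ n ∈ Finset.Ioc 0 u, vonMangoldt n * g q n
            - ∑ n ∈ Finset.Ioc 0 X, vonMangoldt n * g q n) := by
        intro q
        rw [← Finset.mul_sum]
        congr 1
        rw [eq_sub_iff_add_eq, add_comm, Finset.sum_Ioc_consecutive _ (Nat.zero_le _) hu1]
      simp only [e]
      have p1 := hpart u hu1 hu2
      have p2 := hpart X le_rfl hXY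
      have : ∑ q ∈ P, Real.log q * (∑ n ∈ Finset.Ioc 0 u, vonMangoldt n * g q n
            - ∑ n ∈ Finset.Ioc 0 X, vonMangoldt n * g q n)
          ≤ ∑ q ∈ P, (Real.log q * |∑ n ∈ Finset.Ioc 0 u, vonMangoldt n * g q n|
            + Real.log q * |∑ n ∈ Finset.Ioc 0 X, vonMangoldt n * g q n|) := by
        refine Finset.sum_le_sum fun q hq => ?_
        rw [← mul_add]
        refine mul_le_mul_of_nonneg_left ?_ (hlq0 q hq)
        exact (le_abs_self _).trans (abs_sub _ _)
      rw [Finset.sum_add_distrib] at this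
      linarith)
  rw [div_self hX0.ne'] at hblock
  have hsw : ∑ n ∈ Finset.Ioc X (K * X), (∑ q ∈ P, Real.log q * (vonMangoldt n * g q n)) / n
      = ∑ q ∈ P, Real.log q * ∑ n ∈ Finset.Ioc X (K * X), vonMangoldt n * g q n / n := by
    simp only [Finset.sum_div]
    rw [Finset.sum_comm]
    refine Finset.sum_congr rfl fun q _ => ?_
    rw [Finset.mul_sum]
    refine Finset.sum_congr rfl fun n _ => by ring
  rw [hsw] at hblock
  have hMer : ∑ n ∈ Finset.Ioc X (K * X), vonMangoldt n / (n:ℝ) ≤ Real.log K + C0 := by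
    have := mertens_block X (K * X) (by omega) hXY
    push_cast at this
    rw [Real.log_mul (by positivity) (by positivity)] at this
    linarith
  have hq' : ∀ q ∈ P, Real.log q * ∑ p ∈ (Finset.Ioc X (K * X)).filter Nat.Prime,
        vq f q p * Real.log p / p ≤ Real.log q * ∑ n ∈ Finset.Ioc X (K * X), vonMangoldt n * g q n / n
          + Real.log q / q * ((1 + ε) * (Real.log K + C0)) := by
    intro q hq
    obtain ⟨hqp, hq1, hq2⟩ := hP q hq
    have h2 : (2:ℝ) ≤ q := by exact_mod_cast hqp.two_le
    have s1 : ∑ p ∈ (Finset.Ioc X (K * X)).filter Nat.Prime, vq f q p * Real.log p / p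
        ≤ ∑ n ∈ Finset.Ioc X (K * X), vonMangoldt n * vq f q n / n := by
      refine le_trans (le_of_eq ?_) (Finset.sum_le_sum_of_subset_of_nonneg (Finset.filter_subset Nat.Prime _)
        fun n _ _ => div_nonneg (mul_nonneg vonMangoldt_nonneg (vq_nonneg hf q n)) (by positivity))
      refine Finset.sum_congr rfl fun p hp => ?_
      rw [vonMangoldt_apply_prime (Finset.mem_filter.mp hp).2, mul_comm]
    have s2 : ∑ n ∈ Finset.Ioc X (K * X), vonMangoldt n * vq f q n / n
        ≤ ∑ n ∈ Finset.Ioc X (K * X), vonMangoldt n * g q n / n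
          + 1 / ((q:ℝ) - 1) * ∑ n ∈ Finset.Ioc X (K * X), vonMangoldt n / (n:ℝ) := by
      rw [Finset.mul_sum, ← Finset.sum_add_distrib]
      refine Finset.sum_le_sum fun n _ => ?_
      have hΛ : 0 ≤ vonMangoldt n / (n:ℝ) := div_nonneg vonMangoldt_nonneg (by positivity)
      have : vq f q n ≤ g q n + 1 / ((q:ℝ) - 1) := by
        simp only [hg]
        have : 0 ≤ 1 / ((q:ℝ) - 1) := div_nonneg zero_le_one (by linarith)
        split_ifs <;> linarith
      calc _ = vonMangoldt n / (n:ℝ) * vq f q n := by ring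
        _ ≤ vonMangoldt n / (n:ℝ) * (g q n + 1 / ((q:ℝ) - 1)) := mul_le_mul_of_nonneg_left this hΛ
        _ = _ := by ring
    have s3 : 1 / ((q:ℝ) - 1) ≤ 1 / q * (1 + ε) := by
      rw [one_div_mul_eq_div, div_le_div_iff₀ (by linarith) (by linarith)]
      have : 2 / ε ≤ q := by linarith
      rw [div_le_iff₀ hε] at this
      nlinarith
    have s4 : 1 / ((q:ℝ) - 1) * ∑ n ∈ Finset.Ioc X (K * X), vonMangoldt n / (n:ℝ)
        ≤ 1 / q * (1 + ε) * (Real.log K + C0) := by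
      refine mul_le_mul s3 hMer (Finset.sum_nonneg fun n _ => div_nonneg vonMangoldt_nonneg (by positivity)) (by positivity)
    have := mul_le_mul_of_nonneg_left (s1.trans (s2.trans (add_le_add le_rfl s4))) (hlq0 q hq)
    refine this.trans (le_of_eq ?_)
    ring
  refine (Finset.sum_le_sum hq').trans ?_
  rw [Finset.sum_add_distrib, ← Finset.sum_mul]
  have hm := mertens_rpow X (by omega) ε (1/2 - ε) hε.le (by linarith) P hP
  have hpos : 0 < Real.log K + C0 := by linarith
  have hm2 := mul_le_mul_of_nonneg_right hm (by positivity : 0 ≤ (1 + ε) * (Real.log K + C0))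
  rw [div_le_iff₀ hε] at hTbig
  have fin1 : ((1 / 2 - ε - ε) * T + (C0 + 1)) * (1 + ε) ≤ (1/2) * T - 1 / (Real.log K + C0) := by
    have k1 : 0 ≤ ε * T := by positivity
    have k2 : 0 ≤ ε * (ε * T) := by positivity
    have k3 : ε * (C0 + 1) ≤ 1 * (C0 + 1) := mul_le_mul_of_nonneg_right (by linarith) (by linarith)
    have k4 : ((1 / 2 - ε - ε) * T + (C0 + 1)) * (1 + ε)
      = (1/2) * T - 3/2 * (ε * T) - 2 * (ε * (ε * T)) + (C0 + 1) + ε * (C0 + 1) := by ring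
    rw [k4]
    linarith
  have fin2 := mul_le_mul_of_nonneg_right fin1 hpos.le
  have fin3 : 1 / (Real.log K + C0) * (Real.log K + C0) = 1 := by field_simp
  rw [sub_mul ((1/2) * T), fin3] at fin2
  have fin4 : 0 ≤ C0 * T := by positivity
  rw [← mul_assoc ((1 / 2 - ε - ε) * Real.log X + (C0 + 1))] at hm2
  have fin5 : (1/2) * T * (Real.log K + C0) = (Real.log K / 2 + C0) * T - (C0 * T) / 2 := by ring
  linarith

end FI

namespace FI
open ArithmeticFunction Filter Topology

lemma vq0_sum (X Y r : ℕ) (hX : 1 ≤ X) (hXY : X ≤ Y) :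
    ∑ n ∈ Finset.Ioc X Y, vq (fun _ => 0) r n ≤ 2 * (Y:ℝ) / r := by
  have h1 : ∑ n ∈ Finset.Ioc X Y, (if (r:ℤ) ∣ (n:ℤ) - 1 then (1:ℝ) else 0) ≤ (Y:ℝ) / r := by
    rw [← Finset.sum_filter, Finset.sum_const, nsmul_eq_mul, mul_one]
    have : ((Finset.Ioc X Y).filter (fun n : ℕ => (r:ℤ) ∣ (n:ℤ) - 1)).card ≤ Y / r := by
      rw [← Nat.Ioc_filter_dvd_card_eq_div]
      refine Finset.card_le_card_of_injOn (fun n => n - 1) ?_ ?_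
      · intro n hn
        simp only [Finset.coe_filter, Set.mem_ofPred_eq, Finset.mem_Ioc] at hn ⊢
        refine ⟨by omega, ?_⟩
        have h2 := hn.2
        rw [← Int.natCast_one, ← Nat.cast_sub (by omega)] at h2
        exact_mod_cast h2
      · intro a ha b hb hab
        simp only [Finset.coe_filter, Set.mem_ofPred_eq, Finset.mem_Ioc] at ha hb hab
        omega
    exact (by exact_mod_cast this : _ ≤ ((Y / r : ℕ) : ℝ)).trans Nat.cast_div_le
  have h2 : ∑ n ∈ Finset.Ioc X Y, (if (r:ℤ) ∣ (n:ℤ) + 1 then (1:ℝ) else 0) ≤ ((Y + 1 : ℕ):ℝ) / r := by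
    rw [← Finset.sum_filter, Finset.sum_const, nsmul_eq_mul, mul_one]
    have : ((Finset.Ioc X Y).filter (fun n : ℕ => (r:ℤ) ∣ (n:ℤ) + 1)).card ≤ (Y + 1) / r := by
      rw [← Nat.Ioc_filter_dvd_card_eq_div]
      refine Finset.card_le_card_of_injOn (fun n => n + 1) ?_ ?_
      · intro n hn
        simp only [Finset.coe_filter, Set.mem_ofPred_eq, Finset.mem_Ioc] at hn ⊢
        exact ⟨by omega, by exact_mod_cast hn.2⟩
      · intro a ha b hb hab
        simp only at hab
        omega
    exact (by exact_mod_cast this : _ ≤ (((Y + 1) / r : ℕ) : ℝ)).trans Nat.cast_div_le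
  have e : ∀ n, vq (fun _ => 0) r n = (1/2) * ((if (r:ℤ) ∣ (n:ℤ) - 1 then (1:ℝ) else 0)
      + (if (r:ℤ) ∣ (n:ℤ) + 1 then (1:ℝ) else 0)) := by
    intro n; unfold vq; split_ifs <;> norm_num
  simp only [e]
  rw [← Finset.mul_sum, Finset.sum_add_distrib]
  have hY : (1:ℝ) ≤ Y := by exact_mod_cast hX.trans hXY
  have h3 : ((Y + 1 : ℕ):ℝ) / r ≤ 2 * (Y:ℝ) / r := by
    push_cast
    gcongr
    linarith
  have h4 : 2 * (Y:ℝ) / r = 2 * ((Y:ℝ) / r) := by ring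
  have h5 : 0 ≤ (Y:ℝ)/r := by positivity
  linarith

theorem lemA2 (K : ℕ) (hK : 2 ≤ K) (ε δ : ℝ) (hε : 0 < ε) (hδ : 0 < δ) :
    ∀ᶠ X : ℕ in atTop, ∀ B : ℕ,
      ∑ r ∈ Finset.Ioc ⌊(X:ℝ) ^ ε⌋₊ B, (if r.Prime then 0 else vonMangoldt r) *
        ∑ p ∈ (Finset.Ioc X (K * X)).filter Nat.Prime, vq (fun _ => 0) r p * Real.log p / p
        ≤ δ * Real.log X := by
  have hK1 : (1:ℝ) < K := by exact_mod_cast hK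
  have hs := summable_iff_vanishing_norm.mp summable_nonprime (δ / (4 * K)) (by positivity)
  obtain ⟨s, hs⟩ := hs
  obtain ⟨N, hN⟩ := s.exists_nat_subset_range
  have hgrow : Tendsto (fun X : ℕ => (X:ℝ) ^ ε) atTop atTop :=
    (tendsto_rpow_atTop hε).comp tendsto_natCast_atTop_atTop
  filter_upwards [hgrow.eventually_ge_atTop (N:ℝ), eventually_ge_atTop (K + 2)] with X hXN hXK B
  have hX0 : (0:ℝ) < X := by exact_mod_cast (by omega : 0 < X)
  have hX1 : (1:ℝ) ≤ X := by exact_mod_cast (by omega : 1 ≤ X)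
  have hXY : X ≤ K * X := Nat.le_mul_of_pos_left X (by omega)
  have hT0 : 0 ≤ Real.log X := Real.log_nonneg hX1
  have hLY : Real.log (K * X) ≤ 2 * Real.log X := by
    rw [Real.log_mul (by positivity) (by positivity)]
    have : Real.log K ≤ Real.log X := Real.log_le_log (by linarith) (by exact_mod_cast (by omega))
    linarith
  have hLY0 : 0 ≤ Real.log (K * X) := Real.log_nonneg (by nlinarith)
  have hin : ∀ r : ℕ, ∑ p ∈ (Finset.Ioc X (K * X)).filter Nat.Prime, vq (fun _ => 0) r p * Real.log p / p
      ≤ 4 * K * Real.log X * (1 / r) := by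
    intro r
    calc _ ≤ ∑ p ∈ (Finset.Ioc X (K * X)).filter Nat.Prime, vq (fun _ => 0) r p * (Real.log (K * X) / X) := by
          refine Finset.sum_le_sum fun p hp => ?_
          have hp' := Finset.mem_Ioc.mp (Finset.mem_filter.mp hp).1
          have hp0 : (0:ℝ) < p := by exact_mod_cast (Finset.mem_filter.mp hp).2.pos
          have h1 : Real.log p ≤ Real.log (K * X) := Real.log_le_log hp0 (by exact_mod_cast hp'.2)
          rw [mul_div_assoc]
          refine mul_le_mul_of_nonneg_left ?_ (vq_nonneg chr_zero r p)
          exact div_le_div₀ hLY0 h1 hX0 (by exact_mod_cast hp'.1.le)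
      _ ≤ ∑ p ∈ Finset.Ioc X (K * X), vq (fun _ => 0) r p * (Real.log (K * X) / X) := by
          refine Finset.sum_le_sum_of_subset_of_nonneg (Finset.filter_subset Nat.Prime _) fun n _ _ => ?_
          exact mul_nonneg (vq_nonneg chr_zero r n) (by positivity)
      _ = (∑ p ∈ Finset.Ioc X (K * X), vq (fun _ => 0) r p) * (Real.log (K * X) / X) := by
          rw [Finset.sum_mul]
      _ ≤ (2 * ((K * X : ℕ):ℝ) / r) * (2 * Real.log X / X) := by
          have := vq0_sum X (K * X) r (by omega) hXY
          gcongr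
      _ = _ := by push_cast; field_simp; ring
  calc _ ≤ ∑ r ∈ Finset.Ioc ⌊(X:ℝ) ^ ε⌋₊ B, (if r.Prime then 0 else vonMangoldt r) *
        (4 * K * Real.log X * (1 / r)) := by
        refine Finset.sum_le_sum fun r _ => mul_le_mul_of_nonneg_left (hin r) ?_
        split_ifs
        · exact le_rfl
        · exact vonMangoldt_nonneg
    _ = (4 * K * Real.log X) * ∑ r ∈ Finset.Ioc ⌊(X:ℝ) ^ ε⌋₊ B, (if r.Prime then 0 else vonMangoldt r) / (r:ℝ) := by
        rw [Finset.mul_sum]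
        refine Finset.sum_congr rfl fun r _ => by ring
    _ ≤ (4 * K * Real.log X) * (δ / (4 * K)) := by
        refine mul_le_mul_of_nonneg_left ?_ (by positivity)
        have := hs (Finset.Ioc ⌊(X:ℝ) ^ ε⌋₊ B) (by
          rw [Finset.disjoint_left]
          intro r hr hr'
          have h1 := Finset.mem_range.mp (hN hr')
          have h2 := (Finset.mem_Ioc.mp hr).1
          have h3 : N ≤ ⌊(X:ℝ) ^ ε⌋₊ := Nat.le_floor hXN
          omega)
        exact (le_abs_self _).trans (le_of_lt this)
    _ = _ := by field_simp

end FI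

namespace FI
open ArithmeticFunction Filter Topology

/-- the quadratic character -/
noncomputable def fA (d : ℤ) (n : ℕ) : ℝ := if Odd n then (jacobiSym d n : ℝ) else 0

lemma fA_chr (d : ℤ) (hd : d ≠ 0) : Chr (fA d) (4 * d).natAbs := by
  refine ⟨?_, ?_, ?_, by simpa using hd⟩
  · intro m n
    unfold fA
    by_cases hm : Odd m
    · by_cases hn : Odd n
      · have : NeZero m := ⟨hm.pos.ne'⟩
        have : NeZero n := ⟨hn.pos.ne'⟩
        rw [if_pos (hm.mul hn), if_pos hm, if_pos hn, jacobiSym.mul_right]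
        push_cast; rfl
      · rw [if_neg hn, if_neg (fun h => hn (Nat.odd_mul.mp h).2), mul_zero]
    · rw [if_neg hm, if_neg (fun h => hm (Nat.odd_mul.mp h).1), zero_mul]
  · intro n
    unfold fA
    split_ifs
    · rcases jacobiSym.trichotomy d n with h | h | h <;> simp [h]
    · simp
  · intro n
    have hD : (4 * d).natAbs = 4 * d.natAbs := by rw [Int.natAbs_mul]; rfl
    rw [hD]
    unfold fA
    have hpar : Odd (n + 4 * d.natAbs) ↔ Odd n := by
      rw [Nat.odd_iff, Nat.odd_iff]; omega
    by_cases hn : Odd n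
    · rw [if_pos (hpar.mpr hn), if_pos hn, jacobiSym.mod_right d (hpar.mpr hn),
        jacobiSym.mod_right d hn, Nat.add_mod_right]
    · rw [if_neg (fun h => hn (hpar.mp h)), if_neg hn]

section ring
variable {R : Type*} [Ring R] (p : ℕ) [hp : Fact p.Prime] [CharP R p]

lemma cast_of_zmod {a b : ℤ} (h : (a : ZMod p) = (b : ZMod p)) : (a : R) = (b : R) := by
  rw [CharP.intCast_eq_intCast R p]
  exact (ZMod.intCast_eq_intCast_iff a b p).mp h

lemma ring_frob (t : ℤ) (a : R) (ha : a * a = (t:R) * a - 1) (hp2 : p ≠ 2) (χ : ℤ)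
    (hχ : ((t ^ 2 - 4 : ℤ) : ZMod p) ^ (p / 2) = (χ : ZMod p)) :
    2 * a ^ p - (t:R) = (χ : R) * (2 * a - (t:R)) := by
  have hta : a * (t:R) = (t:R) * a := (Int.cast_commute t a).symm.eq
  have hB : (2 * a - (t:R)) * (2 * a - (t:R)) = ((t ^ 2 - 4 : ℤ) : R) := by
    calc (2 * a - (t:R)) * (2 * a - (t:R))
        = 4 * (a * a) - 2 * (a * (t:R)) - 2 * ((t:R) * a) + (t:R) * (t:R) := by
          rw [mul_sub, sub_mul, sub_mul]
          rw [show (2:R) * a * (2 * a) = 4 * (a * a) by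
            rw [← mul_assoc, mul_assoc 2 a 2, (Commute.ofNat_right a 2).eq]; noncomm_ring]
          rw [show (t:R) * (2 * a) = 2 * ((t:R) * a) by
            rw [← mul_assoc, (Commute.ofNat_right (t:R) 2).eq, mul_assoc]]
          rw [mul_assoc 2 a]
          abel
      _ = _ := by
          rw [hta, ha]; push_cast; noncomm_ring; simp; abel
  have hcp : ∀ c : ℤ, (c : R) ^ p = (c : R) := by
    intro c
    have := cast_of_zmod (R := R) p (a := c ^ p) (b := c) (by push_cast; exact ZMod.pow_card _)
    simpa using this
  have hBp : (2 * a - (t:R)) ^ p = 2 * a ^ p - (t:R) := by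
    rw [sub_pow_char_of_commute p ((Int.cast_commute t (2 * a)).symm),
      (Commute.ofNat_left 2 a).mul_pow, hcp]
    have := hcp 2
    push_cast at this
    rw [this]
  have hodd : p = 2 * (p / 2) + 1 := by
    have := hp.out.eq_two_or_odd
    omega
  have hBp2 : (2 * a - (t:R)) ^ p = (χ : R) * (2 * a - (t:R)) := by
    conv_lhs => rw [hodd]
    rw [pow_succ, pow_mul, sq, hB]
    congr 1
    have := cast_of_zmod (R := R) p (a := (t ^ 2 - 4) ^ (p / 2)) (b := χ) (by push_cast; push_cast at hχ; exact hχ)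
    simpa using this
  rw [← hBp, hBp2]

lemma two_cancel (hp2 : p ≠ 2) {x y : R} (h : 2 * x = 2 * y) : x = y := by
  have hodd : p % 2 = 1 := by
    have := hp.out.eq_two_or_odd
    omega
  have hs : (((p + 1) / 2 : ℕ) : R) * 2 = 1 := by
    have : ((p + 1) / 2) * 2 = p + 1 := by omega
    have h2 : ((((p + 1) / 2) * 2 : ℕ) : R) = ((p + 1 : ℕ) : R) := by rw [this]
    push_cast at h2
    rw [h2, CharP.cast_eq_zero R p, zero_add]
  have := congrArg (fun w => (((p + 1) / 2 : ℕ) : R) * w) h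
  simp only [← mul_assoc] at this
  rwa [hs, one_mul, one_mul] at this

lemma ring_order (t : ℤ) (a : R) (ha : a * a = (t:R) * a - 1) (hp2 : p ≠ 2) (χ : ℤ)
    (hχ : ((t ^ 2 - 4 : ℤ) : ZMod p) ^ (p / 2) = (χ : ZMod p)) :
    (χ = 1 → a ^ (p - 1) = 1) ∧ (χ = -1 → a ^ (p + 1) = 1) := by
  have h := ring_frob p t a ha hp2 χ hχ
  have hta : a * (t:R) = (t:R) * a := (Int.cast_commute t a).symm.eq
  have hinv : ((t:R) - a) * a = 1 := by rw [sub_mul, ha]; abel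
  constructor
  · intro h1
    rw [h1] at h
    have h2 : 2 * a ^ p = 2 * a := by simpa using h
    have h3 := two_cancel p hp2 h2
    have h4 : a ^ p = a * a ^ (p - 1) := by
      rw [← pow_succ']; congr 1; have := hp.out.pos; omega
    rw [h4] at h3
    have h5 := congrArg (fun w => ((t:R) - a) * w) h3
    simp only [← mul_assoc] at h5
    rwa [hinv, one_mul] at h5
  · intro h1
    rw [h1] at h
    have h2 : 2 * a ^ p = 2 * ((t:R) - a) := by
      have : 2 * a ^ p = (((-1 : ℤ) : R) * (2 * a - (t:R))) + t := by rw [← h]; abel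
      rw [this]; push_cast; noncomm_ring
    have h3 := two_cancel p hp2 h2
    rw [pow_succ, h3, hinv]

end ring

lemma CH {A : Matrix (Fin 2) (Fin 2) ℤ} (hA : A.det = 1) :
    A * A = ((A.trace : ℤ) : Matrix (Fin 2) (Fin 2) ℤ) * A - 1 := by
  rw [Matrix.det_fin_two] at hA
  have e : ((A.trace : ℤ) : Matrix (Fin 2) (Fin 2) ℤ) * A = A.trace • A := by
    rw [zsmul_eq_mul]
  have ht := Matrix.trace_fin_two A
  rw [e]
  generalize A.trace = s at ht
  ext i j
  rw [Matrix.sub_apply, Matrix.smul_apply, Matrix.mul_apply, Fin.sum_univ_two, smul_eq_mul, ht]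
  fin_cases i <;> fin_cases j <;> simp <;> linarith

/-- reduction mod `p` -/
noncomputable def red (p : ℕ) : Matrix (Fin 2) (Fin 2) ℤ →+* Matrix (Fin 2) (Fin 2) (ZMod p) :=
  (Int.castRingHom (ZMod p)).mapMatrix

lemma red_one_iff (p : ℕ) (A : Matrix (Fin 2) (Fin 2) ℤ) (k : ℕ) :
    (∀ i j, (p : ℤ) ∣ (A ^ k - 1) i j) ↔ red p A ^ k = 1 := by
  rw [← map_pow, ← sub_eq_zero, ← map_one (red p), ← map_sub, ← Matrix.ext_iff]
  refine forall_congr' fun i => forall_congr' fun j => ?_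
  change _ ↔ (((A ^ k - 1) i j : ℤ) : ZMod p) = 0
  rw [ZMod.intCast_zmod_eq_zero_iff_dvd]

lemma order_dvd {A : Matrix (Fin 2) (Fin 2) ℤ} (hA : A.det = 1) {p : ℕ} (hp : p.Prime)
    (hpd : ¬ p ∣ (4 * (A.trace ^ 2 - 4)).natAbs) :
    (fA (A.trace ^ 2 - 4) p = 1 ∧ red p A ^ (p - 1) = 1) ∨
    (fA (A.trace ^ 2 - 4) p = -1 ∧ red p A ^ (p + 1) = 1) := by
  have : Fact p.Prime := ⟨hp⟩
  set d := A.trace ^ 2 - 4 with hd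
  have hpd' : ¬ (p:ℤ) ∣ 4 * d := fun h => hpd (Int.natCast_dvd.mp h)
  have hp2 : p ≠ 2 := by
    rintro rfl
    exact hpd' (Dvd.dvd.mul_right (by norm_num) d)
  have hodd : Odd p := hp.odd_of_ne_two hp2
  have hne : (d : ZMod p) ≠ 0 := by
    intro h
    exact hpd' (Dvd.dvd.mul_left ((ZMod.intCast_zmod_eq_zero_iff_dvd _ _).mp h) 4)
  have hCH : red p A * red p A = ((A.trace : ℤ) : Matrix (Fin 2) (Fin 2) (ZMod p)) * red p A - 1 := by
    rw [← map_mul, CH hA]; simp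
  have h := ring_order p A.trace (red p A) hCH hp2 (legendreSym p d) (legendreSym.eq_pow p d).symm
  have hf : fA d p = (legendreSym p d : ℝ) := by
    unfold fA
    rw [if_pos hodd, jacobiSym.legendreSym.to_jacobiSym]
  rcases legendreSym.eq_one_or_neg_one p hne with h1 | h1
  · left; exact ⟨by rw [hf, h1]; simp, h.1 h1⟩
  · right; exact ⟨by rw [hf, h1]; simp, h.2 h1⟩

lemma matOrd_eq {A : Matrix (Fin 2) (Fin 2) ℤ} {p k : ℕ} (hk : 0 < k) (h : red p A ^ k = 1) :
    matOrd A p ∣ k ∧ 0 < matOrd A p ∧ red p A ^ (matOrd A p) = 1 := by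
  have hne : {k | 0 < k ∧ ∀ i j, (p : ℤ) ∣ (A ^ k - 1) i j}.Nonempty := ⟨k, hk, (red_one_iff p A k).mpr h⟩
  have hm : matOrd A p ∈ {k | 0 < k ∧ ∀ i j, (p : ℤ) ∣ (A ^ k - 1) i j} := Nat.sInf_mem hne
  have h2 := (red_one_iff p A _).mp hm.2
  have hfin : 0 < orderOf (red p A) := orderOf_pos_iff.mpr (isOfFinOrder_iff_pow_eq_one.mpr ⟨k, hk, h⟩)
  have h3 : matOrd A p ≤ orderOf (red p A) :=
    Nat.sInf_le ⟨hfin, (red_one_iff p A _).mpr (pow_orderOf_eq_one _)⟩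
  have h4 := Nat.le_of_dvd hm.1 (orderOf_dvd_of_pow_eq_one h2)
  have h5 : matOrd A p = orderOf (red p A) := le_antisymm h3 h4
  exact ⟨h5 ▸ orderOf_dvd_of_pow_eq_one h, hm.1, h2⟩


lemma tau_rec {A : Matrix (Fin 2) (Fin 2) ℤ} (hA : A.det = 1) (k : ℕ) :
    (A ^ (k + 2)).trace = A.trace * (A ^ (k + 1)).trace - (A ^ k).trace := by
  have h : A ^ (k + 2) = A.trace • A ^ (k + 1) - A ^ k := by
    rw [zsmul_eq_mul, pow_succ, pow_succ, mul_assoc, CH hA, mul_sub, mul_one, ← mul_assoc,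
      (Int.cast_commute A.trace (A ^ k)).symm.eq, mul_assoc, ← pow_succ]
  rw [h, Matrix.trace_sub, Matrix.trace_smul, smul_eq_mul]

lemma tau_bounds {A : Matrix (Fin 2) (Fin 2) ℤ} (hA : A.det = 1) (htr : 2 < |A.trace|) (k : ℕ) :
    |(A ^ k).trace| + 1 ≤ |(A ^ (k + 1)).trace| ∧
    |(A ^ (k + 1)).trace| ≤ (|A.trace| + 1) * |(A ^ k).trace| := by
  induction k with
  | zero =>
    simp only [pow_zero, zero_add, pow_one, Matrix.trace_one, Fintype.card_fin]
    constructor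
    · norm_num; linarith
    · norm_num; linarith
  | succ k ih =>
    obtain ⟨h1, h2⟩ := ih
    rw [show k + 1 + 1 = k + 2 from rfl, tau_rec hA]
    have a0 := abs_nonneg ((A ^ k).trace)
    have e1 := abs_sub_abs_le_abs_sub (A.trace * (A ^ (k + 1)).trace) ((A ^ k).trace)
    have e2 := abs_sub (A.trace * (A ^ (k + 1)).trace) ((A ^ k).trace)
    rw [abs_mul] at e1 e2
    constructor
    · nlinarith
    · nlinarith

lemma tau_ge {A : Matrix (Fin 2) (Fin 2) ℤ} (hA : A.det = 1) (htr : 2 < |A.trace|) (k : ℕ) :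
    2 + (k:ℤ) ≤ |(A ^ k).trace| := by
  induction k with
  | zero => simp
  | succ k ih =>
    have := (tau_bounds hA htr k).1
    push_cast; linarith

lemma tau_le {A : Matrix (Fin 2) (Fin 2) ℤ} (hA : A.det = 1) (htr : 2 < |A.trace|) (k : ℕ) :
    |(A ^ k).trace| ≤ 2 * (|A.trace| + 1) ^ k := by
  induction k with
  | zero => simp
  | succ k ih =>
    have := (tau_bounds hA htr k).2
    rw [pow_succ (|A.trace| + 1)]
    nlinarith [abs_nonneg A.trace]

lemma det_sub_one {A : Matrix (Fin 2) (Fin 2) ℤ} (hA : A.det = 1) (k : ℕ) :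
    (A ^ k - 1).det = 2 - (A ^ k).trace := by
  have h : (A ^ k).det = 1 := by rw [Matrix.det_pow, hA, one_pow]
  rw [Matrix.det_fin_two] at h ⊢
  rw [Matrix.trace_fin_two]
  simp
  linarith

lemma card_pf (M : ℕ) (hM : M ≠ 0) : (M.primeFactors.card : ℝ) ≤ Real.log M / Real.log 2 := by
  have h2 : 0 < Real.log 2 := Real.log_pos (by norm_num)
  have h : 2 ^ M.primeFactors.card ≤ M := by
    calc 2 ^ M.primeFactors.card ≤ ∏ p ∈ M.primeFactors, p :=
          Finset.pow_card_le_prod _ _ _ (fun p hp => (Nat.prime_of_mem_primeFactors hp).two_le)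
      _ ≤ M := Nat.le_of_dvd (Nat.pos_of_ne_zero hM) (Nat.prod_primeFactors_dvd M)
  rw [le_div_iff₀ h2, ← Real.log_pow]
  apply Real.log_le_log (by positivity)
  exact_mod_cast h

open Classical in
lemma exc_count {A : Matrix (Fin 2) (Fin 2) ℤ} (hA : A.det = 1) (htr : 2 < |A.trace|) :
    ∃ c : ℝ, 0 < c ∧ ∀ (J : ℕ) (E : Finset ℕ), (∀ p ∈ E, p.Prime ∧ ∃ j, 0 < j ∧ j ≤ J ∧ red p A ^ j = 1) →
      (E.card : ℝ) ≤ c * (J:ℝ) ^ 2 := by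
  have h2 : 0 < Real.log 2 := Real.log_pos (by norm_num)
  set T : ℝ := ((|A.trace| + 1 : ℤ) : ℝ) with hT
  have hT4 : 4 ≤ T := by
    have : (4:ℤ) ≤ |A.trace| + 1 := by omega
    rw [hT]; exact_mod_cast this
  have hlT : 0 < Real.log T := Real.log_pos (by linarith)
  refine ⟨2 * Real.log T / Real.log 2, by positivity, fun J E hE => ?_⟩
  let M : ℕ → ℕ := fun j => (2 - (A ^ j).trace).natAbs
  have hM : ∀ j, 0 < j → M j ≠ 0 := by
    intro j hj h0
    have h1 : 2 - (A ^ j).trace = 0 := Int.natAbs_eq_zero.mp h0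
    have h3 := tau_ge hA htr j
    rw [show (A ^ j).trace = 2 by linarith] at h3
    norm_num at h3; omega
  have hMle : ∀ j, 0 < j → (M j : ℝ) ≤ T ^ (2 * j) := by
    intro j hj
    have e1 : ((M j : ℕ) : ℤ) = |2 - (A ^ j).trace| := Int.natCast_natAbs _
    have e2 : |2 - (A ^ j).trace| ≤ 2 + |(A ^ j).trace| := by
      have := abs_sub (2:ℤ) ((A ^ j).trace); simpa using this
    have e3 := tau_le hA htr j
    have e4 : ((M j : ℕ) : ℤ) ≤ 2 + 2 * (|A.trace| + 1) ^ j := by rw [e1]; linarith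
    have e5 : (M j : ℝ) ≤ 2 + 2 * T ^ j := by rw [hT]; exact_mod_cast e4
    have e6 : T ≤ T ^ j := le_self_pow₀ (by linarith) hj.ne'
    rw [two_mul, pow_add]
    nlinarith
  have hsub : E ⊆ (Finset.Ioc 0 J).biUnion (fun j => (M j).primeFactors) := by
    intro p hp
    obtain ⟨hpp, j, hj0, hjJ, hj⟩ := hE p hp
    rw [Finset.mem_biUnion]
    refine ⟨j, Finset.mem_Ioc.mpr ⟨hj0, hjJ⟩, ?_⟩
    rw [Nat.mem_primeFactors]
    refine ⟨hpp, ?_, hM j hj0⟩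
    have hd := (red_one_iff p A j).mpr hj
    have : (p:ℤ) ∣ (A ^ j - 1).det := by
      rw [Matrix.det_fin_two]
      exact dvd_sub (Dvd.dvd.mul_right (hd 0 0) _) (Dvd.dvd.mul_right (hd 0 1) _)
    rw [det_sub_one hA] at this
    exact Int.natCast_dvd.mp this
  calc (E.card : ℝ) ≤ ∑ j ∈ Finset.Ioc 0 J, ((M j).primeFactors.card : ℝ) := by
        exact_mod_cast (Finset.card_le_card hsub).trans Finset.card_biUnion_le
    _ ≤ ∑ j ∈ Finset.Ioc 0 J, 2 * J * Real.log T / Real.log 2 := by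
        refine Finset.sum_le_sum fun j hj => ?_
        rw [Finset.mem_Ioc] at hj
        refine (card_pf _ (hM j hj.1)).trans ?_
        gcongr
        calc Real.log (M j) ≤ Real.log (T ^ (2 * j)) :=
              Real.log_le_log (by exact_mod_cast Nat.pos_of_ne_zero (hM j hj.1)) (hMle j hj.1)
          _ = 2 * j * Real.log T := by rw [Real.log_pow]; push_cast; ring
          _ ≤ _ := by
              have : (j:ℝ) ≤ J := by exact_mod_cast hj.2
              gcongr
    _ = _ := by
        rw [Finset.sum_const, Nat.card_Ioc, nsmul_eq_mul]; push_cast; simp; ring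

end FI

namespace FI
open ArithmeticFunction Filter Topology

lemma per_prime {A : Matrix (Fin 2) (Fin 2) ℤ} (hA : A.det = 1) (htr : 2 < |A.trace|) {η : ℝ}
    (hη₁ : 1 / 2 < η) (hη₂ : η < 3 / 5) {p Y a J : ℕ} (hp : p.Prime) (hpY : p ≤ Y)
    (hpD : (4 * (A.trace ^ 2 - 4)).natAbs < p) (hbad : BadPrime A η p)
    (hJ : 2 * (Y:ℝ) ^ (1 - η) < (J:ℝ) + 1)
    (P : Finset ℕ) (hP : ∀ q : ℕ, q.Prime → a < q → (q:ℝ) ≤ (Y:ℝ) ^ η → q ∈ P) :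
    (∃ j, 0 < j ∧ j ≤ J ∧ red p A ^ j = 1) ∨
    Real.log p ≤ Real.log 2 + 2 * ∑ r ∈ Finset.Ioc 1 a, vonMangoldt r * vq (fun _ => 0) r p
      + 2 * ∑ r ∈ Finset.Ioc a (Y + 1), (if r.Prime then 0 else vonMangoldt r) * vq (fun _ => 0) r p
      + ∑ q ∈ P, Real.log q * vq (fA (A.trace ^ 2 - 4)) q p := by
  set d := A.trace ^ 2 - 4 with hd
  have hd0 : d ≠ 0 := by
    have h9 : 2 * 2 < |A.trace| * |A.trace| := by nlinarith
    rw [abs_mul_abs_self] at h9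
    rw [hd]; nlinarith
  have hf := fA_chr d hd0
  have hpd : ¬ p ∣ (4 * d).natAbs := fun h => by
    have := Nat.le_of_dvd hf.pos h
    omega
  have hord : (matOrd A p : ℝ) < (p:ℝ) ^ η := hbad.resolve_left hpd
  have hp0 : (0:ℝ) < p := by exact_mod_cast hp.pos
  have hp2 : (2:ℝ) ≤ p := by exact_mod_cast hp.two_le
  -- common pm
  obtain ⟨m, hm0, hmp, hpm, hred, hv⟩ : ∃ m : ℕ, 0 < m ∧ m ≤ p + 1 ∧ p ≤ 2 * m ∧ red p A ^ m = 1 ∧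
      (∀ r : ℕ, r ∣ m → 1 ≤ vq (fA d) r p ∧ 1 ≤ 2 * vq (fun _ => 0) r p) := by
    have h2 := hp.two_le
    rcases order_dvd hA hp hpd with ⟨h1, hr⟩ | ⟨h1, hr⟩
    · refine ⟨p - 1, by omega, by omega, by omega, hr, fun r hrm => ?_⟩
      have hz : (r:ℤ) ∣ (p:ℤ) - 1 := by
        have : ((p - 1 : ℕ) : ℤ) = (p:ℤ) - 1 := by push_cast [Nat.cast_sub hp.one_le]; rfl
        rw [← this]; exact_mod_cast hrm
      unfold vq
      rw [if_pos hz, if_pos hz, h1]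
      constructor <;> split_ifs <;> norm_num
    · refine ⟨p + 1, by omega, by omega, by omega, hr, fun r hrm => ?_⟩
      have hz : (r:ℤ) ∣ (p:ℤ) + 1 := by exact_mod_cast hrm
      unfold vq
      rw [if_pos hz, if_pos hz, h1]
      constructor <;> split_ifs <;> norm_num
  obtain ⟨ho1, ho2, ho3⟩ := matOrd_eq hm0 hred
  by_cases hq : ∃ q : ℕ, q.Prime ∧ q ∣ m ∧ (p:ℝ) ^ η < q
  · left
    obtain ⟨q, hqp, ⟨c, hc⟩, hqη⟩ := hq
    have hnd : ¬ q ∣ matOrd A p := fun h => by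
      have h1 : ((q:ℕ):ℝ) ≤ matOrd A p := by exact_mod_cast Nat.le_of_dvd ho2 h
      linarith
    have hoc : matOrd A p ∣ c := by
      rw [hc] at ho1
      exact Nat.Coprime.dvd_of_dvd_mul_left ((Nat.Prime.coprime_iff_not_dvd hqp).mpr hnd).symm ho1
    have hc0 : 0 < c := by
      rcases Nat.eq_zero_or_pos c with h | h
      · rw [h] at hc; omega
      · exact h
    refine ⟨c, hc0, ?_, ?_⟩
    · have hη0 : 0 < (p:ℝ) ^ η := Real.rpow_pos_of_pos hp0 _
      have e1 : (p:ℝ) ^ η * c ≤ 2 * p := by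
        have : (q:ℝ) * c ≤ p + 1 := by exact_mod_cast hc ▸ hmp
        have hc' : (0:ℝ) ≤ c := by positivity
        nlinarith
      have e2 : (p:ℝ) = (p:ℝ) ^ η * (p:ℝ) ^ (1 - η) := by
        rw [← Real.rpow_add hp0]; simp
      have e3 : (c:ℝ) ≤ 2 * (p:ℝ) ^ (1 - η) := by
        have : (p:ℝ) ^ η * c ≤ (p:ℝ) ^ η * (2 * (p:ℝ) ^ (1 - η)) := by
          calc _ ≤ 2 * (p:ℝ) := e1
            _ = _ := by conv_lhs => rw [e2]
                        ring
        exact le_of_mul_le_mul_left this hη0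
      have e4 : (p:ℝ) ^ (1 - η) ≤ (Y:ℝ) ^ (1 - η) :=
        Real.rpow_le_rpow hp0.le (by exact_mod_cast hpY) (by linarith)
      have : (c:ℝ) < J + 1 := by linarith
      have : c < J + 1 := by exact_mod_cast this
      omega
    · obtain ⟨w, hw⟩ := hoc
      rw [hw, pow_mul, ho3, one_pow]
  · right
    push Not at hq
    have hlog : Real.log p ≤ Real.log 2 + Real.log m := by
      rw [← Real.log_mul (by norm_num) (by exact_mod_cast hm0.ne')]
      exact Real.log_le_log hp0 (by exact_mod_cast hpm)
    have hsum : Real.log m = ∑ r ∈ m.divisors, (vonMangoldt r : ℝ) := vonMangoldt_sum.symm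
    have hdec : ∀ r ∈ m.divisors, (vonMangoldt r : ℝ) = (if 1 < r ∧ r ≤ a then vonMangoldt r else 0)
        + (if a < r then (if r.Prime then 0 else vonMangoldt r) else 0)
        + (if a < r ∧ r.Prime then vonMangoldt r else 0) := by
      intro r hr
      have hr0 : 0 < r := Nat.pos_of_mem_divisors hr
      rcases Nat.lt_or_ge 1 r with h1 | h1
      · rcases Nat.lt_or_ge a r with h2 | h2
        · have : ¬ r ≤ a := by omega
          by_cases h3 : r.Prime <;> simp [h2, this, h3]
        · have : ¬ a < r := by omega
          simp [h1, h2, this]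
      · have : r = 1 := by omega
        subst this; simp
    have h1 : ∑ r ∈ m.divisors, (if 1 < r ∧ r ≤ a then (vonMangoldt r : ℝ) else 0) ≤
        2 * ∑ r ∈ Finset.Ioc 1 a, vonMangoldt r * vq (fun _ => 0) r p := by
      rw [← Finset.sum_filter, Finset.mul_sum]
      refine (Finset.sum_le_sum (g := fun r => 2 * (vonMangoldt r * vq (fun _ => 0) r p)) ?_).trans
        (Finset.sum_le_sum_of_subset_of_nonneg ?_ ?_)
      · intro r hr
        have hr' := Nat.dvd_of_mem_divisors (Finset.mem_filter.mp hr).1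
        have := (hv r hr').2
        nlinarith [vonMangoldt_nonneg (n := r)]
      · intro r hr
        exact Finset.mem_Ioc.mpr (Finset.mem_filter.mp hr).2
      · intro r _ _
        have := vq_nonneg chr_zero r p
        have := vonMangoldt_nonneg (n := r)
        positivity
    have h2 : ∑ r ∈ m.divisors, (if a < r then (if r.Prime then 0 else (vonMangoldt r : ℝ)) else 0) ≤
        2 * ∑ r ∈ Finset.Ioc a (Y + 1), (if r.Prime then 0 else vonMangoldt r) * vq (fun _ => 0) r p := by
      have hnn : ∀ r : ℕ, 0 ≤ (if r.Prime then 0 else (vonMangoldt r : ℝ)) := by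
        intro r; split_ifs; exacts [le_rfl, vonMangoldt_nonneg]
      rw [← Finset.sum_filter, Finset.mul_sum]
      refine (Finset.sum_le_sum (g := fun r => 2 * ((if r.Prime then 0 else (vonMangoldt r : ℝ)) * vq (fun _ => 0) r p)) ?_).trans
        (Finset.sum_le_sum_of_subset_of_nonneg ?_ ?_)
      · intro r hr
        have hr' := Nat.dvd_of_mem_divisors (Finset.mem_filter.mp hr).1
        have := (hv r hr').2
        nlinarith [hnn r]
      · intro r hr
        have hr' := Nat.le_of_dvd hm0 (Nat.dvd_of_mem_divisors (Finset.mem_filter.mp hr).1)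
        exact Finset.mem_Ioc.mpr ⟨(Finset.mem_filter.mp hr).2, by omega⟩
      · intro r _ _
        have := vq_nonneg chr_zero r p
        have := hnn r
        positivity
    have h3 : ∑ r ∈ m.divisors, (if a < r ∧ r.Prime then (vonMangoldt r : ℝ) else 0) ≤
        ∑ q ∈ P, Real.log q * vq (fA d) q p := by
      rw [← Finset.sum_filter]
      refine (Finset.sum_le_sum (g := fun r : ℕ => Real.log r * vq (fA d) r p) ?_).trans
        (Finset.sum_le_sum_of_subset_of_nonneg ?_ ?_)
      · intro r hr
        have hr' := Nat.dvd_of_mem_divisors (Finset.mem_filter.mp hr).1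
        have hrp := (Finset.mem_filter.mp hr).2.2
        have := (hv r hr').1
        rw [vonMangoldt_apply_prime hrp]
        nlinarith [Real.log_natCast_nonneg r]
      · intro r hr
        have hr' := Nat.dvd_of_mem_divisors (Finset.mem_filter.mp hr).1
        obtain ⟨har, hrp⟩ := (Finset.mem_filter.mp hr).2
        refine hP r hrp har ((hq r hrp hr').trans ?_)
        exact Real.rpow_le_rpow hp0.le (by exact_mod_cast hpY) (by linarith)
      · intro r _ _
        have := vq_nonneg hf r p
        have := Real.log_natCast_nonneg r
        positivity
    rw [Finset.sum_congr rfl hdec, Finset.sum_add_distrib, Finset.sum_add_distrib] at hsum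
    linarith

lemma params {η : ℝ} (hη₁ : 1 / 2 < η) (hη₂ : η < 3 / 5) :
    ∃ ε κ1 κ2 s : ℝ, 0 < ε ∧ ε ≤ 1 / 10 ∧
      2 * ((1/2 + η)/2 - (1/2 - ε)) / (1 - (1/2+η)/2) < κ1 ∧
      2 * ((η + ε) - (1/2 + η)/2) / (1 - (η + ε)) < κ2 ∧
      s = 1/2 + 18 * ε + κ1 + κ2 ∧ s < 1 - (3 - 5 * η) / (2 * (1 - η)) := by
  let F : ℝ → ℝ := fun ε => 1/2 + 18 * ε + (2 * ((1/2 + η)/2 - (1/2 - ε)) / (1 - (1/2+η)/2) + ε)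
    + (2 * ((η + ε) - (1/2 + η)/2) / (1 - (η + ε)) + ε)
  have hc : ContinuousAt F 0 := by
    have : 1 - (η + 0) ≠ 0 := by linarith
    have : (1 - (1/2+η)/2) ≠ 0 := by linarith
    fun_prop (disch := assumption)
  have hF0 : F 0 < 1 - (3 - 5 * η) / (2 * (1 - η)) := by
    have e1 : 0 < 1 - η := by linarith
    have e2 : 0 < 1 - (1/2+η)/2 := by linarith
    have e3 : 2 * ((1/2 + η)/2 - (1/2 - 0)) / (1 - (1/2+η)/2) < (η - 1/2) / (1 - η) := by
      rw [div_lt_div_iff₀ e2 e1]; nlinarith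
    have e4 : 2 * ((η + 0) - (1/2 + η)/2) / (1 - (η + 0)) = (η - 1/2) / (1 - η) := by
      rw [add_zero]; ring
    have e5 : 1 - (3 - 5 * η) / (2 * (1 - η)) = 1/2 + 2 * ((η - 1/2) / (1 - η)) := by
      field_simp; ring
    show 1/2 + 18 * 0 + (2 * ((1/2 + η)/2 - (1/2 - 0)) / (1 - (1/2+η)/2) + 0)
      + (2 * ((η + 0) - (1/2 + η)/2) / (1 - (η + 0)) + 0) < _
    rw [e4, e5]; linarith
  have hev : ∀ᶠ ε in 𝓝[>] (0:ℝ), F ε < 1 - (3 - 5 * η) / (2 * (1 - η)) :=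
    (hc.eventually_lt_const hF0).filter_mono nhdsWithin_le_nhds
  have hev2 : ∀ᶠ ε in 𝓝[>] (0:ℝ), ε ∈ Set.Ioc (0:ℝ) (1/10) := Ioc_mem_nhdsGT (by norm_num)
  obtain ⟨ε, h1, h2⟩ := (hev.and hev2).exists
  exact ⟨ε, _, _, F ε, h2.1, h2.2, lt_add_of_pos_right _ h2.1, lt_add_of_pos_right _ h2.1, by rfl, h1⟩

end FI

namespace FI
open ArithmeticFunction Filter Topology

lemma swap_sum (I S : Finset ℕ) (c : ℕ → ℝ) (v : ℕ → ℕ → ℝ) :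
    ∑ p ∈ I, (∑ r ∈ S, c r * v r p) * (Real.log p / p)
      = ∑ r ∈ S, c r * ∑ p ∈ I, v r p * Real.log p / p := by
  simp_rw [Finset.sum_mul, Finset.mul_sum]
  rw [Finset.sum_comm]
  refine Finset.sum_congr rfl fun r _ => Finset.sum_congr rfl fun p _ => ?_
  ring

lemma exc_tendsto (c : ℝ) (K : ℕ) (hK : 2 ≤ K) (η : ℝ) (hη₁ : 1 / 2 < η) (hη₂ : η < 1) :
    ∀ᶠ X : ℕ in atTop, c * (2 * ((K * X : ℕ):ℝ) ^ (1 - η)) ^ 2 * (Real.log ((K * X : ℕ):ℝ) / X) ≤ 1 := by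
  have hK0 : (0:ℝ) < K := by positivity
  obtain ⟨C, hC, hlog⟩ := log_pow_le (η - 1/2) (by linarith) 1
  have h1 : Tendsto (fun X : ℕ => |c| * 4 * C * K * ((K * X : ℕ):ℝ) ^ (-(η - 1/2))) atTop (𝓝 (|c| * 4 * C * K * 0)) := by
    apply Tendsto.const_mul
    refine (tendsto_rpow_neg_atTop (by linarith : 0 < η - 1/2)).comp ?_
    refine tendsto_natCast_atTop_atTop.comp ?_
    exact tendsto_id.const_mul_atTop' (by omega)
  rw [mul_zero] at h1
  filter_upwards [h1.eventually_lt_const (zero_lt_one), eventually_ge_atTop 1] with X hX hX1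
  refine le_trans ?_ hX.le
  have hX0 : (0:ℝ) < X := by exact_mod_cast hX1
  set Z : ℝ := ((K * X : ℕ):ℝ) with hZ
  have hZe : Z = K * X := by rw [hZ]; push_cast; rfl
  have hZ1 : 1 ≤ Z := by rw [hZ]; exact_mod_cast Nat.mul_pos (by omega) hX1
  have hZ0 : 0 < Z := by linarith
  have hl := hlog Z hZ1
  rw [pow_one] at hl
  have e1 : Real.log Z / X = K * (Real.log Z / Z) := by rw [hZe]; field_simp
  have e2 : (2 * Z ^ (1 - η)) ^ 2 = 4 * Z ^ (2 - 2 * η) := by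
    rw [mul_pow, ← Real.rpow_natCast (Z ^ (1 - η)), ← Real.rpow_mul hZ0.le]; norm_num; ring_nf
  have e3 : Z ^ (-(η - 1/2)) = Z ^ (2 - 2 * η) * (Z ^ (η - 1/2) / Z) := by
    rw [← mul_div_assoc, ← Real.rpow_add hZ0, ← Real.rpow_sub_one hZ0.ne']; ring_nf
  rw [e1, e2, e3]
  have hL0 : 0 ≤ Real.log Z := Real.log_nonneg hZ1
  calc c * (4 * Z ^ (2 - 2 * η)) * (K * (Real.log Z / Z))
      ≤ |c| * (4 * Z ^ (2 - 2 * η)) * (K * (Real.log Z / Z)) := by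
        gcongr; exact le_abs_self c
    _ ≤ |c| * (4 * Z ^ (2 - 2 * η)) * (K * ((C * Z ^ (η - 1/2)) / Z)) := by
        gcongr; linarith
    _ = _ := by ring

open Classical in
lemma block_K {A : Matrix (Fin 2) (Fin 2) ℤ} (hA : A.det = 1) (htr : 2 < |A.trace|) {η : ℝ}
    (hη₁ : 1 / 2 < η) (hη₂ : η < 3 / 5) (ε κ1 κ2 : ℝ) (hε : 0 < ε) (hε1 : ε ≤ 1 / 10)
    (hκ1 : 2 * ((1/2 + η)/2 - (1/2 - ε)) / (1 - (1/2+η)/2) < κ1)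
    (hκ2 : 2 * ((η + ε) - (1/2 + η)/2) / (1 - (η + ε)) < κ2) (K : ℕ) (hK : 2 ≤ K) :
    ∀ᶠ X : ℕ in atTop, ∑ p ∈ (Finset.Ioc X (K * X)).filter (fun p => p.Prime ∧ BadPrime A η p),
      Real.log p / p ≤ (1/2 + 18 * ε + κ1 + κ2) * Real.log K + C0 + 4 := by
  set d := A.trace ^ 2 - 4 with hd
  have hd0 : d ≠ 0 := by
    have h9 : 2 * 2 < |A.trace| * |A.trace| := by nlinarith
    rw [abs_mul_abs_self] at h9
    rw [hd]; nlinarith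
  have hf := fA_chr d hd0
  obtain ⟨c, hc, hexc⟩ := exc_count hA htr
  have hK0 : (0:ℝ) < K := by positivity
  have ev1 : ∀ᶠ X : ℕ in atTop, Real.log 2 * (Real.log K + C0) ≤ Real.log X :=
    (Real.tendsto_log_atTop.comp tendsto_natCast_atTop_atTop).eventually_ge_atTop _
  have ev2 : ∀ᶠ X : ℕ in atTop, (K:ℝ) ^ η ≤ (X:ℝ) ^ ε :=
    ((tendsto_rpow_atTop hε).comp tendsto_natCast_atTop_atTop).eventually_ge_atTop _
  filter_upwards [lemA K hK ε hε (by linarith), lemA2 K hK ε 1 hε one_pos, lemB hf K hK ε hε hε1,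
    lemC hf K hK (1/2 - ε) ((1/2 + η)/2) κ1 (by linarith) (by linarith) (by linarith) hκ1,
    lemC hf K hK ((1/2 + η)/2) (η + ε) κ2 (by linarith) (by linarith) (by linarith) hκ2,
    ev1, ev2, exc_tendsto c K hK η hη₁ (by linarith), eventually_gt_atTop (4 * d).natAbs,
    eventually_ge_atTop 3] with X hA1 hA2 hB hC1 hC2 hl hKη hex hXD hX3
  set Y := K * X with hY
  set a := ⌊(X:ℝ) ^ ε⌋₊ with ha
  set J := ⌊2 * (Y:ℝ) ^ (1 - η)⌋₊ with hJ
  set I := (Finset.Ioc X Y).filter Nat.Prime with hI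
  have hX0 : (0:ℝ) < X := by positivity
  have hX1 : (1:ℝ) ≤ X := by exact_mod_cast (by omega : 1 ≤ X)
  have hlX : 0 < Real.log X := Real.log_pos (by exact_mod_cast (by omega : 1 < X))
  have hXY : X ≤ Y := by rw [hY]; nlinarith
  set P0 := (Finset.range (⌊(Y:ℝ) ^ η⌋₊ + 1)).filter (fun q => q.Prime ∧ a < q) with hP0
  have hYη : (Y:ℝ) ^ η ≤ (X:ℝ) ^ (η + ε) := by
    rw [hY]; push_cast
    rw [Real.mul_rpow hK0.le hX0.le, Real.rpow_add hX0, mul_comm]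
    gcongr
  have hP0mem : ∀ q ∈ P0, q.Prime ∧ (X:ℝ) ^ ε < q ∧ (q:ℝ) ≤ (X:ℝ) ^ (η + ε) := by
    intro q hq
    rw [hP0, Finset.mem_filter, Finset.mem_range] at hq
    refine ⟨hq.2.1, Nat.lt_of_floor_lt hq.2.2, le_trans ?_ hYη⟩
    exact (Nat.le_floor_iff (by positivity)).mp (by omega)
  let V : ℕ → ℝ := fun q => Real.log q * ∑ p ∈ I, vq (fA d) q p * Real.log p / p
  have hP0sum : ∑ q ∈ P0, V q ≤ (Real.log K / 2 + C0) * Real.log X + κ1 * Real.log K * Real.log X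
      + κ2 * Real.log K * Real.log X := by
    rw [← Finset.sum_filter_add_sum_filter_not P0 (fun q : ℕ => (q:ℝ) ≤ (X:ℝ) ^ (1/2 - ε)),
      ← Finset.sum_filter_add_sum_filter_not (P0.filter (fun q : ℕ => ¬ (q:ℝ) ≤ (X:ℝ) ^ (1/2 - ε)))
        (fun q : ℕ => (q:ℝ) ≤ (X:ℝ) ^ ((1/2 + η)/2)), ← add_assoc]
    refine add_le_add (add_le_add (hB _ ?_) (hC1 _ ?_)) (hC2 _ ?_)
    · intro q hq
      rw [Finset.mem_filter] at hq
      exact ⟨(hP0mem q hq.1).1, (hP0mem q hq.1).2.1, hq.2⟩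
    · intro q hq
      rw [Finset.mem_filter, Finset.mem_filter] at hq
      exact ⟨(hP0mem q hq.1.1).1, not_le.mp hq.1.2, hq.2⟩
    · intro q hq
      rw [Finset.mem_filter, Finset.mem_filter] at hq
      exact ⟨(hP0mem q hq.1.1).1, not_le.mp hq.2, (hP0mem q hq.1.1).2.2⟩
  let G : ℕ → ℝ := fun p => Real.log 2 + 2 * ∑ r ∈ Finset.Ioc 1 a, vonMangoldt r * vq (fun _ => 0) r p
      + 2 * ∑ r ∈ Finset.Ioc a (Y + 1), (if r.Prime then 0 else vonMangoldt r) * vq (fun _ => 0) r p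
      + ∑ q ∈ P0, Real.log q * vq (fA d) q p
  have hnn : ∀ r : ℕ, 0 ≤ (if r.Prime then 0 else (vonMangoldt r : ℝ)) := by
    intro r; split_ifs; exacts [le_rfl, vonMangoldt_nonneg]
  have hw : ∀ p : ℕ, 0 ≤ Real.log p / p := fun p => div_nonneg (Real.log_natCast_nonneg p) (by positivity)
  have hG0 : ∀ p, 0 ≤ G p := by
    intro p
    have g0 : 0 ≤ Real.log 2 := Real.log_nonneg (by norm_num)
    have g1 : 0 ≤ ∑ r ∈ Finset.Ioc 1 a, vonMangoldt r * vq (fun _ => 0) r p :=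
      Finset.sum_nonneg fun r _ => mul_nonneg vonMangoldt_nonneg (vq_nonneg chr_zero r p)
    have g2 : 0 ≤ ∑ r ∈ Finset.Ioc a (Y + 1), (if r.Prime then 0 else vonMangoldt r) * vq (fun _ => 0) r p :=
      Finset.sum_nonneg fun r _ => mul_nonneg (hnn r) (vq_nonneg chr_zero r p)
    have g3 : 0 ≤ ∑ q ∈ P0, Real.log q * vq (fA d) q p :=
      Finset.sum_nonneg fun r _ => mul_nonneg (Real.log_natCast_nonneg r) (vq_nonneg hf r p)
    show 0 ≤ Real.log 2 + 2 * _ + 2 * _ + _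
    linarith
  have hmert : ∑ p ∈ I, Real.log p / p ≤ Real.log K + C0 := by
    have h1 := mertens_block X Y (by omega) hXY
    have h2 : Real.log Y - Real.log X = Real.log K := by
      rw [hY]; push_cast; rw [Real.log_mul hK0.ne' hX0.ne']; ring
    rw [h2] at h1
    refine le_trans ?_ h1
    calc ∑ p ∈ I, Real.log p / p = ∑ p ∈ I, vonMangoldt p / (p:ℝ) := by
          refine Finset.sum_congr rfl fun p hp => ?_
          rw [vonMangoldt_apply_prime (Finset.mem_filter.mp hp).2]
      _ ≤ _ := Finset.sum_le_sum_of_subset_of_nonneg (Finset.filter_subset _ _)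
          (fun p _ _ => div_nonneg vonMangoldt_nonneg (by positivity))
  have hGsum : ∑ p ∈ I, G p * (Real.log p / p) ≤
      Real.log X * ((1/2 + 18 * ε + κ1 + κ2) * Real.log K + C0 + 3) := by
    have e : ∑ p ∈ I, G p * (Real.log p / p) = Real.log 2 * ∑ p ∈ I, Real.log p / p
        + 2 * ∑ r ∈ Finset.Ioc 1 a, vonMangoldt r * ∑ p ∈ I, vq (fun _ => 0) r p * Real.log p / p
        + 2 * ∑ r ∈ Finset.Ioc a (Y + 1), (if r.Prime then 0 else vonMangoldt r) *
            ∑ p ∈ I, vq (fun _ => 0) r p * Real.log p / p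
        + ∑ q ∈ P0, V q := by
      rw [← swap_sum I (Finset.Ioc 1 a) (fun r => vonMangoldt r) (fun r p => vq (fun _ => 0) r p),
        ← swap_sum I (Finset.Ioc a (Y+1)) (fun r => if r.Prime then 0 else vonMangoldt r) (fun r p => vq (fun _ => 0) r p),
        ← swap_sum I P0 (fun r => Real.log r) (fun r p => vq (fA d) r p),
        Finset.mul_sum, Finset.mul_sum, Finset.mul_sum, ← Finset.sum_add_distrib,
        ← Finset.sum_add_distrib, ← Finset.sum_add_distrib]
      refine Finset.sum_congr rfl fun p _ => ?_
      show (Real.log 2 + 2 * _ + 2 * _ + _) * _ = _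
      ring
    have h2 := hA2 (Y + 1)
    have h3 : Real.log 2 * ∑ p ∈ I, Real.log p / p ≤ Real.log X :=
      (mul_le_mul_of_nonneg_left hmert (Real.log_nonneg (by norm_num))).trans hl
    rw [e]
    linarith
  set Bd := (Finset.Ioc X Y).filter (fun p => p.Prime ∧ BadPrime A η p) with hBd
  have hBdI : ∀ p ∈ Bd, p ∈ I ∧ BadPrime A η p := by
    intro p hp
    rw [hBd, Finset.mem_filter] at hp
    exact ⟨Finset.mem_filter.mpr ⟨hp.1, hp.2.1⟩, hp.2.2⟩
  have hIm : ∀ p ∈ I, X < p ∧ p ≤ Y ∧ p.Prime := by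
    intro p hp
    rw [hI, Finset.mem_filter, Finset.mem_Ioc] at hp
    exact ⟨hp.1.1, hp.1.2, hp.2⟩
  rw [← Finset.sum_filter_add_sum_filter_not Bd (fun p => ∃ j, 0 < j ∧ j ≤ J ∧ red p A ^ j = 1)]
  have hE : ∑ p ∈ Bd.filter (fun p => ∃ j, 0 < j ∧ j ≤ J ∧ red p A ^ j = 1), Real.log p / p ≤ 1 := by
    refine le_trans ?_ hex
    have hcard := hexc J (Bd.filter (fun p => ∃ j, 0 < j ∧ j ≤ J ∧ red p A ^ j = 1)) (by
      intro p hp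
      rw [Finset.mem_filter] at hp
      exact ⟨(hIm p (hBdI p hp.1).1).2.2, hp.2⟩)
    have hJle : (J:ℝ) ≤ 2 * (Y:ℝ) ^ (1 - η) := Nat.floor_le (by positivity)
    calc _ ≤ ∑ p ∈ Bd.filter (fun p => ∃ j, 0 < j ∧ j ≤ J ∧ red p A ^ j = 1), Real.log Y / X := by
          refine Finset.sum_le_sum fun p hp => ?_
          obtain ⟨h1, h2, h3⟩ := hIm p (hBdI p (Finset.mem_filter.mp hp).1).1
          have : (0:ℝ) < p := by exact_mod_cast h3.pos
          have : (p:ℝ) ≤ Y := by exact_mod_cast h2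
          have : (X:ℝ) ≤ p := by exact_mod_cast h1.le
          have : 0 ≤ Real.log p := Real.log_natCast_nonneg p
          gcongr
      _ ≤ (c * (J:ℝ) ^ 2) * (Real.log Y / X) := by
          rw [Finset.sum_const, nsmul_eq_mul]
          have : 0 ≤ Real.log Y := Real.log_natCast_nonneg Y
          gcongr
      _ ≤ _ := by
          have : 0 ≤ Real.log Y := Real.log_natCast_nonneg Y
          gcongr
  have hN : Real.log X * ∑ p ∈ Bd.filter (fun p => ¬ ∃ j, 0 < j ∧ j ≤ J ∧ red p A ^ j = 1), Real.log p / p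
      ≤ Real.log X * ((1/2 + 18 * ε + κ1 + κ2) * Real.log K + C0 + 3) := by
    refine le_trans ?_ hGsum
    rw [Finset.mul_sum]
    refine (Finset.sum_le_sum (g := fun p : ℕ => G p * (Real.log p / p)) ?_).trans
      (Finset.sum_le_sum_of_subset_of_nonneg ?_ (fun p _ _ => mul_nonneg (hG0 p) (hw p)))
    · intro p hp
      rw [Finset.mem_filter] at hp
      obtain ⟨hpI, hpb⟩ := hBdI p hp.1
      obtain ⟨h1, h2, h3⟩ := hIm p hpI
      refine mul_le_mul_of_nonneg_right ?_ (hw p)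
      refine (Real.log_le_log hX0 (by exact_mod_cast h1.le : (X:ℝ) ≤ p)).trans ?_
      refine (per_prime hA htr hη₁ hη₂ h3 h2 (lt_trans hXD h1) hpb (J := J) (a := a)
        (Nat.lt_floor_add_one _) P0 ?_).resolve_left hp.2
      intro q hq haq hqY
      rw [hP0, Finset.mem_filter, Finset.mem_range]
      exact ⟨Nat.lt_succ_of_le (Nat.le_floor hqY), hq, haq⟩
    · intro p hp
      exact (hBdI p (Finset.mem_filter.mp hp).1).1
  have hN' := le_of_mul_le_mul_left hN hlX
  linarith

open Classical in
lemma block_final {A : Matrix (Fin 2) (Fin 2) ℤ} (hA : A.det = 1) (htr : 2 < |A.trace|) {η : ℝ}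
    (hη₁ : 1 / 2 < η) (hη₂ : η < 3 / 5) :
    ∃ K X0 : ℕ, 2 ≤ K ∧ 2 ≤ X0 ∧ ∀ X : ℕ, X0 ≤ X →
      ∑ p ∈ (Finset.Ioc X (K * X)).filter (fun p => p.Prime ∧ BadPrime A η p),
      Real.log p / p ≤ (1 - (3 - 5 * η) / (2 * (1 - η))) * Real.log K := by
  obtain ⟨ε, κ1, κ2, s, hε, hε1, h1, h2, hs, hlt⟩ := params hη₁ hη₂
  have hev : ∀ᶠ K : ℕ in atTop, (C0 + 4) / ((1 - (3 - 5 * η) / (2 * (1 - η))) - s) ≤ Real.log K :=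
    (Real.tendsto_log_atTop.comp tendsto_natCast_atTop_atTop).eventually_ge_atTop _
  obtain ⟨K, hK, hK2⟩ := (hev.and (eventually_ge_atTop 2)).exists
  obtain ⟨X0, hX0⟩ := eventually_atTop.mp (block_K hA htr hη₁ hη₂ ε κ1 κ2 hε hε1 h1 h2 K hK2)
  refine ⟨K, max X0 2, hK2, le_max_right _ _, fun X hX => ?_⟩
  refine (hX0 X ((le_max_left _ _).trans hX)).trans ?_
  rw [div_le_iff₀ (by linarith)] at hK
  rw [← hs]
  linarith

end FI

namespace FI
open ArithmeticFunction Filter Topology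

open Classical in
lemma recip_sum {Q : ℕ → Prop} {ρ : ℝ} (hρ : 0 < ρ) (K X0 : ℕ) (hK : 2 ≤ K) (hX0 : 2 ≤ X0)
    (h : ∀ X : ℕ, X0 ≤ X → ∑ p ∈ (Finset.Ioc X (K * X)).filter (fun p => p.Prime ∧ Q p),
      Real.log p / p ≤ ρ * Real.log K) (n : ℕ) :
    ∑ p ∈ (Finset.Ioc X0 (X0 * K ^ (n + 1))).filter (fun p => p.Prime ∧ Q p), (1:ℝ) / p ≤
      ρ * (Real.log K / Real.log X0 + Real.log (Real.log (X0 * K ^ n : ℕ)) - Real.log (Real.log X0)) := by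
  have hlK : 0 < Real.log K := Real.log_pos (by exact_mod_cast (by omega : 1 < K))
  have hlX : 0 < Real.log X0 := Real.log_pos (by exact_mod_cast (by omega : 1 < X0))
  have hblock : ∀ X : ℕ, X0 ≤ X → ∑ p ∈ (Finset.Ioc X (K * X)).filter (fun p => p.Prime ∧ Q p), (1:ℝ) / p
      ≤ ρ * (Real.log K / Real.log X) := by
    intro X hX
    have hlX' : 0 < Real.log X := Real.log_pos (by exact_mod_cast (by omega : 1 < X))
    rw [← mul_div_assoc, le_div_iff₀ hlX']
    refine le_trans ?_ (h X hX)
    rw [Finset.sum_mul]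
    refine Finset.sum_le_sum fun p hp => ?_
    rw [Finset.mem_filter, Finset.mem_Ioc] at hp
    have hp0 : (0:ℝ) < p := by exact_mod_cast hp.2.1.pos
    have : Real.log X ≤ Real.log p := Real.log_le_log (by exact_mod_cast (by omega : 0 < X)) (by exact_mod_cast hp.1.1.le)
    rw [div_mul_eq_mul_div, one_mul]
    gcongr
  have hlog : ∀ n : ℕ, Real.log (X0 * K ^ n : ℕ) = Real.log X0 + n * Real.log K := by
    intro n
    push_cast
    rw [Real.log_mul (by positivity) (by positivity), Real.log_pow]
  induction n with
  | zero =>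
    have := hblock X0 le_rfl
    simpa [mul_comm] using this
  | succ n ih =>
    have hKn : 0 < K ^ (n + 1) := Nat.pow_pos (by omega)
    have hle1 : X0 ≤ X0 * K ^ (n + 1) := Nat.le_mul_of_pos_right _ hKn
    have hle2 : X0 * K ^ (n + 1) ≤ X0 * K ^ (n + 1 + 1) :=
      Nat.mul_le_mul_left _ (Nat.pow_le_pow_right (by omega) (by omega))
    have hb := hblock (X0 * K ^ (n + 1)) hle1
    rw [show K * (X0 * K ^ (n + 1)) = X0 * K ^ (n + 1 + 1) by ring] at hb
    have hsplit := Finset.sum_Ioc_consecutive (fun p : ℕ => if p.Prime ∧ Q p then (1:ℝ) / p else 0) hle1 hle2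
    simp only [← Finset.sum_filter] at hsplit
    rw [← hsplit]
    have hl1 := hlog n
    have hl2 := hlog (n + 1)
    set u := Real.log (X0 * K ^ n : ℕ) with hu
    set w := Real.log (X0 * K ^ (n + 1) : ℕ) with hw
    have hu0 : 0 < u := by rw [hl1]; positivity
    have hwu : w = u + Real.log K := by rw [hl1, hl2]; push_cast; ring
    have hw0 : 0 < w := by rw [hwu]; positivity
    have key : Real.log K / w ≤ Real.log w - Real.log u := by
      have := Real.one_sub_inv_le_log_of_pos (div_pos hw0 hu0)
      rw [Real.log_div hw0.ne' hu0.ne', inv_div] at this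
      have e : 1 - u / w = Real.log K / w := by rw [eq_div_iff hw0.ne', sub_mul, div_mul_cancel₀ _ hw0.ne']; linarith
      linarith
    have := mul_le_mul_of_nonneg_left key hρ.le
    linarith

open Classical in
lemma prod_bound {Q : ℕ → Prop} {ρ : ℝ} (hρ : 0 < ρ) (K X0 : ℕ) (hK : 2 ≤ K) (hX0 : 2 ≤ X0)
    (h : ∀ X : ℕ, X0 ≤ X → ∑ p ∈ (Finset.Ioc X (K * X)).filter (fun p => p.Prime ∧ Q p),
      Real.log p / p ≤ ρ * Real.log K) :
    ∃ C : ℝ, 0 < C ∧ ∀ n : ℕ, X0 ≤ n →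
      ∏ p ∈ (Finset.Ioc 0 n).filter (fun p => p.Prime ∧ Q p), (1 - 1 / (p:ℝ))⁻¹ ≤ C * Real.log n ^ ρ := by
  have hlK : 0 < Real.log K := Real.log_pos (by exact_mod_cast (by omega : 1 < K))
  have hlX : 0 < Real.log X0 := Real.log_pos (by exact_mod_cast (by omega : 1 < X0))
  have hsm : Summable (fun m : ℕ => 1 / (m:ℝ) ^ 2) := Real.summable_one_div_nat_pow.mpr (by norm_num)
  set T := ∑' m : ℕ, 1 / (m:ℝ) ^ 2 with hT
  set c := ρ * (Real.log K / Real.log X0 - Real.log (Real.log X0)) with hc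
  refine ⟨Real.exp (2 * T + X0 + c), Real.exp_pos _, fun n hn => ?_⟩
  have hln : 0 < Real.log n := Real.log_pos (by exact_mod_cast (by omega : 1 < n))
  have h1 : ∏ p ∈ (Finset.Ioc 0 n).filter (fun p => p.Prime ∧ Q p), (1 - 1 / (p:ℝ))⁻¹ ≤
      ∏ p ∈ (Finset.Ioc 0 n).filter (fun p => p.Prime ∧ Q p), Real.exp (1 / (p:ℝ) + 2 * (1 / (p:ℝ) ^ 2)) := by
    have h2p : ∀ p ∈ (Finset.Ioc 0 n).filter (fun p => p.Prime ∧ Q p), (2:ℝ) ≤ p := by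
      intro p hp
      exact_mod_cast (Finset.mem_filter.mp hp).2.1.two_le
    refine Finset.prod_le_prod ?_ ?_
    · intro p hp
      have := h2p p hp
      have : 1 / (p:ℝ) ≤ 1 := by rw [div_le_one (by linarith)]; linarith
      exact inv_nonneg.mpr (by linarith)
    · intro p hp
      have h2 := h2p p hp
      have e1 : (1 - 1 / (p:ℝ))⁻¹ = 1 / ((p:ℝ) - 1) + 1 := by
        have : (p:ℝ) - 1 ≠ 0 := by linarith
        have : (p:ℝ) ≠ 0 := by linarith
        field_simp; ring
      have e2 : 1 / ((p:ℝ) - 1) ≤ 1 / (p:ℝ) + 2 * (1 / (p:ℝ) ^ 2) := by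
        have e3 : 1 / (p:ℝ) + 2 * (1 / (p:ℝ) ^ 2) = ((p:ℝ) + 2) / (p:ℝ) ^ 2 := by
          have : (p:ℝ) ≠ 0 := by linarith
          field_simp
        rw [e3, div_le_div_iff₀ (by linarith) (by positivity)]
        nlinarith
      rw [e1]
      have := Real.add_one_le_exp (1 / (p:ℝ) + 2 * (1 / (p:ℝ) ^ 2))
      linarith
  refine h1.trans ?_
  rw [← Real.exp_sum, Real.rpow_def_of_pos hln, ← Real.exp_add, Real.exp_le_exp, Finset.sum_add_distrib,
    ← Finset.mul_sum]
  have h2 : ∑ p ∈ (Finset.Ioc 0 n).filter (fun p => p.Prime ∧ Q p), 1 / (p:ℝ) ^ 2 ≤ T :=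
    hsm.sum_le_tsum _ (fun i _ => by positivity)
  have h3 : ∑ p ∈ (Finset.Ioc 0 X0).filter (fun p => p.Prime ∧ Q p), 1 / (p:ℝ) ≤ X0 := by
    calc _ ≤ ∑ p ∈ (Finset.Ioc 0 X0).filter (fun p => p.Prime ∧ Q p), (1:ℝ) := by
          refine Finset.sum_le_sum fun p hp => ?_
          have : (1:ℝ) ≤ p := by exact_mod_cast (Finset.mem_filter.mp hp).2.1.one_le
          rw [div_le_one (by linarith)]; exact this
      _ = (((Finset.Ioc 0 X0).filter (fun p => p.Prime ∧ Q p)).card : ℝ) := by simp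
      _ ≤ X0 := by
          have := Finset.card_filter_le (Finset.Ioc 0 X0) (fun p => p.Prime ∧ Q p)
          rw [Nat.card_Ioc] at this
          exact_mod_cast this
  have h4 : ∑ p ∈ (Finset.Ioc X0 n).filter (fun p => p.Prime ∧ Q p), 1 / (p:ℝ) ≤
      c + Real.log (Real.log n) * ρ := by
    have hex : ∃ k, n ≤ X0 * K ^ (k + 1) := by
      obtain ⟨k, hk⟩ := pow_unbounded_of_one_lt n (by omega : 1 < K)
      refine ⟨k, hk.le.trans ?_⟩
      calc K ^ k ≤ K ^ (k + 1) := Nat.pow_le_pow_right (by omega) (by omega)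
        _ ≤ _ := Nat.le_mul_of_pos_left _ (by omega)
    set k := Nat.find hex with hk
    have hk1 : n ≤ X0 * K ^ (k + 1) := Nat.find_spec hex
    have hk2 : X0 * K ^ k ≤ n := by
      rcases Nat.eq_zero_or_pos k with h0 | h0
      · rw [h0]; simpa using hn
      · have := Nat.find_min hex (m := k - 1) (by omega)
        rw [show k - 1 + 1 = k by omega] at this
        omega
    have hX0k : X0 ≤ X0 * K ^ k := Nat.le_mul_of_pos_right _ (Nat.pow_pos (by omega))
    have hlk : 0 < Real.log (X0 * K ^ k : ℕ) := Real.log_pos (by exact_mod_cast (by omega : 1 < X0 * K ^ k))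
    have hll : Real.log (Real.log (X0 * K ^ k : ℕ)) ≤ Real.log (Real.log n) := by
      apply Real.log_le_log hlk
      apply Real.log_le_log (by exact_mod_cast (by omega : 0 < X0 * K ^ k))
      exact_mod_cast hk2
    have hr := recip_sum (Q := Q) hρ K X0 hK hX0 h k
    refine (Finset.sum_le_sum_of_subset_of_nonneg ?_ (fun p _ _ => by positivity)).trans (hr.trans ?_)
    · exact Finset.filter_subset_filter _ (Finset.Ioc_subset_Ioc_right hk1)
    · have := mul_le_mul_of_nonneg_left hll hρ.le
      rw [hc]; linarith
  have hsplit := Finset.sum_Ioc_consecutive (fun p : ℕ => if p.Prime ∧ Q p then 1 / (p:ℝ) else 0)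
    (Nat.zero_le X0) hn
  simp only [← Finset.sum_filter] at hsplit
  rw [← hsplit]
  linarith

open Classical in
lemma hall (Q : ℕ → Prop) (n : ℕ) (hn : 1 ≤ n) :
    (((Finset.Ioc 0 n).filter (fun N => ∀ p ∈ N.primeFactors, Q p)).card : ℝ) * Real.log n ≤
      (Real.log 4 + 5) * n * ∏ p ∈ (Finset.Ioc 0 n).filter (fun p => p.Prime ∧ Q p), (1 - 1 / (p:ℝ))⁻¹ := by
  set S := (Finset.Ioc 0 n).filter (fun N => ∀ p ∈ N.primeFactors, Q p) with hS
  have hn0 : (0:ℝ) < n := by exact_mod_cast hn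
  have hSm : ∀ N ∈ S, 0 < N ∧ N ≤ n ∧ ∀ p ∈ N.primeFactors, Q p := by
    intro N hN
    rw [hS, Finset.mem_filter, Finset.mem_Ioc] at hN
    exact ⟨hN.1.1, hN.1.2, hN.2⟩
  have h1 : (S.card : ℝ) * Real.log n ≤ ∑ N ∈ S, Real.log N + ∑ N ∈ S, (n:ℝ) / N := by
    rw [← Finset.sum_add_distrib, ← nsmul_eq_mul, ← Finset.sum_const]
    refine Finset.sum_le_sum fun N hN => ?_
    have hN0 : (0:ℝ) < N := by exact_mod_cast (hSm N hN).1
    have := Real.log_le_self (by positivity : 0 ≤ (n:ℝ) / N)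
    rw [Real.log_div hn0.ne' hN0.ne'] at this
    linarith
  have h2 : ∑ N ∈ S, Real.log N ≤ (Real.log 4 + 4) * ∑ m ∈ S, (n:ℝ) / m := by
    calc ∑ N ∈ S, Real.log N = ∑ N ∈ S, ∑ m ∈ N.divisors, (vonMangoldt (N / m) : ℝ) := by
          refine Finset.sum_congr rfl fun N hN => ?_
          rw [Nat.sum_div_divisors N (fun r => (vonMangoldt r : ℝ)), vonMangoldt_sum]
      _ = ∑ N ∈ S, ∑ m ∈ S, (if m ∣ N then (vonMangoldt (N / m) : ℝ) else 0) := by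
          refine Finset.sum_congr rfl fun N hN => ?_
          obtain ⟨hN0, hNn, hNQ⟩ := hSm N hN
          rw [← Finset.sum_filter]
          refine Finset.sum_congr ?_ (fun _ _ => rfl)
          ext m
          rw [Nat.mem_divisors, Finset.mem_filter, hS, Finset.mem_filter, Finset.mem_Ioc]
          constructor
          · rintro ⟨hm, -⟩
            exact ⟨⟨⟨Nat.pos_of_dvd_of_pos hm hN0, (Nat.le_of_dvd hN0 hm).trans hNn⟩,
              fun p hp => hNQ p (Nat.primeFactors_mono hm hN0.ne' hp)⟩, hm⟩
          · rintro ⟨-, hm⟩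
            exact ⟨hm, hN0.ne'⟩
      _ = ∑ m ∈ S, ∑ N ∈ S, (if m ∣ N then (vonMangoldt (N / m) : ℝ) else 0) := Finset.sum_comm
      _ ≤ ∑ m ∈ S, (Real.log 4 + 4) * ((n:ℝ) / m) := by
          refine Finset.sum_le_sum fun m hm => ?_
          have hm0 := (hSm m hm).1
          calc ∑ N ∈ S, (if m ∣ N then (vonMangoldt (N / m) : ℝ) else 0)
              ≤ ∑ N ∈ Finset.Ioc 0 n, (if m ∣ N then (vonMangoldt (N / m) : ℝ) else 0) :=
                Finset.sum_le_sum_of_subset_of_nonneg (Finset.filter_subset _ _)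
                  (fun N _ _ => by split_ifs; exacts [vonMangoldt_nonneg, le_rfl])
            _ = ∑ r ∈ Finset.Ioc 0 (n / m), (vonMangoldt r : ℝ) := by
                rw [← Finset.sum_filter, sum_dvd_Ioc 0 n m hm0, Nat.zero_div]
                refine Finset.sum_congr rfl fun r _ => ?_
                rw [Nat.mul_div_cancel_left _ hm0]
            _ ≤ (Real.log 4 + 4) * ((n / m : ℕ) : ℝ) := psi_nat _
            _ ≤ _ := by
                have := Real.log_nonneg (by norm_num : (1:ℝ) ≤ 4)
                exact mul_le_mul_of_nonneg_left Nat.cast_div_le (by linarith)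
      _ = _ := by rw [Finset.mul_sum]
  have h3 : ∑ m ∈ S, (n:ℝ) / m ≤ n * ∏ p ∈ (Finset.Ioc 0 n).filter (fun p => p.Prime ∧ Q p), (1 - 1 / (p:ℝ))⁻¹ := by
    have he := euler_fin ((Finset.Ioc 0 n).filter (fun p => p.Prime ∧ Q p)) S (by
      intro N hN
      obtain ⟨hN0, hNn, hNQ⟩ := hSm N hN
      refine ⟨hN0.ne', fun p hp => ?_⟩
      rw [Finset.mem_filter, Finset.mem_Ioc]
      exact ⟨⟨Nat.pos_of_mem_primeFactors hp, (Nat.le_of_mem_primeFactors hp).trans hNn⟩,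
        Nat.prime_of_mem_primeFactors hp, hNQ p hp⟩)
    have e : ((Finset.Ioc 0 n).filter (fun p => p.Prime ∧ Q p)).filter Nat.Prime
        = (Finset.Ioc 0 n).filter (fun p => p.Prime ∧ Q p) := by
      refine Finset.filter_true_of_mem fun p hp => (Finset.mem_filter.mp hp).2.1
    rw [e] at he
    calc _ = n * ∑ m ∈ S, (1:ℝ) / m := by
          rw [Finset.mul_sum]; refine Finset.sum_congr rfl fun m _ => ?_; ring
      _ ≤ _ := mul_le_mul_of_nonneg_left he hn0.le
  have hl4 := Real.log_nonneg (by norm_num : (1:ℝ) ≤ 4)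
  calc _ ≤ (Real.log 4 + 5) * ∑ m ∈ S, (n:ℝ) / m := by linarith
    _ ≤ (Real.log 4 + 5) * (n * ∏ p ∈ (Finset.Ioc 0 n).filter (fun p => p.Prime ∧ Q p), (1 - 1 / (p:ℝ))⁻¹) := by
        gcongr
    _ = _ := by ring

end FI

/-- With `γ = (3-5η)/(2(1-η))`, the number of `N ≤ x` all of whose prime
divisors are bad is `O(x / (log x)^γ)`. -/
theorem few_integers_with_all_prime_factors_bad
    (A : Matrix (Fin 2) (Fin 2) ℤ) (hA : A.det = 1) (htr : 2 < |A.trace|)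
    (η : ℝ) (hη₁ : 1 / 2 < η) (hη₂ : η < 3 / 5) :
    ∃ C : ℝ, 0 < C ∧ ∀ x : ℝ, 2 ≤ x →
      ({N : ℕ | 1 ≤ N ∧ (N : ℝ) ≤ x ∧
          ∀ p ∈ N.primeFactors, BadPrime A η p}.ncard : ℝ) ≤
        C * x / Real.log x ^ ((3 - 5 * η) / (2 * (1 - η))) := by
  classical
  obtain ⟨K, X0, hK, hX0, hb⟩ := FI.block_final hA htr hη₁ hη₂
  set γ := (3 - 5 * η) / (2 * (1 - η)) with hγ
  have hγ0 : 0 < γ := div_pos (by linarith) (by linarith)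
  have hγ1 : γ < 1 := by rw [hγ, div_lt_one (by linarith)]; linarith
  obtain ⟨C, hC, hprod⟩ := FI.prod_bound (Q := BadPrime A η) (by linarith : 0 < 1 - γ) K X0 hK hX0
    (by intro X hX; convert hb X hX)
  have hl4 := Real.log_nonneg (by norm_num : (1:ℝ) ≤ 4)
  have hlX : 0 < Real.log X0 := Real.log_pos (by exact_mod_cast (by omega : 1 < X0))
  set C1 := (Real.log 4 + 5) * C * 2 ^ γ with hC1
  have hC10 : 0 < C1 := by positivity
  refine ⟨C1 + Real.log X0 ^ γ, by positivity, fun x hx => ?_⟩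
  set n := ⌊x⌋₊ with hn
  have hn2 : 2 ≤ n := Nat.le_floor (by exact_mod_cast hx)
  have hnx : (n:ℝ) ≤ x := Nat.floor_le (by linarith)
  have hlx : 0 < Real.log x := Real.log_pos (by linarith)
  have hset : {N : ℕ | 1 ≤ N ∧ (N : ℝ) ≤ x ∧ ∀ p ∈ N.primeFactors, BadPrime A η p}
      = ((Finset.Ioc 0 n).filter (fun N => ∀ p ∈ N.primeFactors, BadPrime A η p) : Finset ℕ) := by
    ext N
    rw [Finset.mem_coe, Finset.mem_filter, Finset.mem_Ioc, hn, Nat.le_floor_iff (by linarith)]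
    constructor
    · rintro ⟨h1, h2, h3⟩; exact ⟨⟨h1, h2⟩, h3⟩
    · rintro ⟨⟨h1, h2⟩, h3⟩; exact ⟨h1, h2, h3⟩
  rw [hset, Set.ncard_coe_finset, le_div_iff₀ (by positivity)]
  rcases Nat.lt_or_ge n X0 with hlt | hge
  · have h1 : (((Finset.Ioc 0 n).filter (fun N => ∀ p ∈ N.primeFactors, BadPrime A η p)).card : ℝ) ≤ n := by
      have := Finset.card_filter_le (Finset.Ioc 0 n) (fun N => ∀ p ∈ N.primeFactors, BadPrime A η p)
      rw [Nat.card_Ioc] at this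
      exact_mod_cast this
    have h2 : x < X0 := Nat.lt_of_floor_lt hlt
    have h3 : Real.log x ^ γ ≤ Real.log X0 ^ γ := by
      apply Real.rpow_le_rpow hlx.le _ hγ0.le
      exact Real.log_le_log (by linarith) h2.le
    calc _ ≤ x * Real.log X0 ^ γ := by
          gcongr
          exact h1.trans hnx
      _ ≤ _ := by nlinarith
  · have h1 := FI.hall (BadPrime A η) n (by omega)
    have h2 := hprod n hge
    have hn0 : (0:ℝ) < n := by positivity
    have hln : 0 < Real.log n := Real.log_pos (by exact_mod_cast (by omega : 1 < n))
    set s := (((Finset.Ioc 0 n).filter (fun N => ∀ p ∈ N.primeFactors, BadPrime A η p)).card : ℝ) with hs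
    have hs0 : 0 ≤ s := by positivity
    have h3 : s * Real.log n ≤ (Real.log 4 + 5) * n * (C * Real.log n ^ (1 - γ)) :=
      h1.trans (mul_le_mul_of_nonneg_left h2 (by positivity))
    have h4 : s * Real.log n ^ γ ≤ (Real.log 4 + 5) * n * C := by
      have e : Real.log n = Real.log n ^ γ * Real.log n ^ (1 - γ) := by
        rw [← Real.rpow_add hln]; simp
      have hp : 0 < Real.log n ^ (1 - γ) := Real.rpow_pos_of_pos hln _
      refine le_of_mul_le_mul_right ?_ hp
      calc s * Real.log n ^ γ * Real.log n ^ (1 - γ) = s * Real.log n := by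
            conv_rhs => rw [e]
            ring
        _ ≤ _ := h3
        _ = _ := by ring
    have h5 : Real.log x ≤ 2 * Real.log n := by
      have : x ≤ (n:ℝ) ^ 2 := by
        have h6 : x < n + 1 := Nat.lt_floor_add_one x
        have h7 : (2:ℝ) ≤ n := by exact_mod_cast hn2
        nlinarith
      calc Real.log x ≤ Real.log ((n:ℝ) ^ 2) := Real.log_le_log (by linarith) this
        _ = _ := by rw [Real.log_pow]; norm_num
    have h6 : Real.log x ^ γ ≤ 2 ^ γ * Real.log n ^ γ := by
      rw [← Real.mul_rpow (by norm_num) hln.le]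
      exact Real.rpow_le_rpow hlx.le h5 hγ0.le
    have h2γ : (0:ℝ) < 2 ^ γ := by positivity
    calc s * Real.log x ^ γ ≤ s * (2 ^ γ * Real.log n ^ γ) := by gcongr
      _ = 2 ^ γ * (s * Real.log n ^ γ) := by ring
      _ ≤ 2 ^ γ * ((Real.log 4 + 5) * n * C) := by gcongr
      _ = C1 * n := by rw [hC1]; ring
      _ ≤ C1 * x := by gcongr
      _ ≤ _ := by
          have : 0 < Real.log X0 ^ γ := by positivity
          nlinarith
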